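/- arXiv:1305.5365 — 4 statements merged into one kernel-verified Lean document; each statement's English description precedes it below -/
import Mathlib

section
/- Let (T(t))_{t≥0} be a bounded C₀-semigroup on a complex Hilbert space X with generator −A. Assume that σ(A) ∩ iℝ = {0} and that sup_{|s|≥η} ‖(is+A)^{-1}‖ < ∞ for some η > 0. Then lim_{t→∞} ‖T(t)A(I+A)^{-1}‖ = 0. More precisely, let m : (0,1) → (1,∞) be a continuous decreasing function with lim_{s→0+} m(s) = ∞ such that ‖(is+A)^{-1}‖ = O(m(|s|)) as s → 0, and let m^{-1} denote a right inverse of m (so m(m^{-1}(t)) = t for large t). Then for every ε ∈ (0,1), ‖T(t)A(I+A)^{-1}‖ = O( m^{-1}(t^{1-ε}) ) as t → ∞. -/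
open Filter MeasureTheory Set Complex Asymptotics

noncomputable section

/-- A `C₀`-semigroup of bounded linear operators on `X`:  a strongly continuous family
`(T t)_{t ≥ 0}` with `T 0 = 1` and `T (s+t) = T s ∘ T t`. -/
structure C0Semigroup (X : Type*) [NormedAddCommGroup X] [NormedSpace ℂ X] where
  T : ℝ → X →L[ℂ] X
  map_zero : T 0 = 1
  map_add : ∀ s t : ℝ, 0 ≤ s → 0 ≤ t → T (s + t) = T s ∘L T t
  strong_continuity : ∀ x : X, ContinuousOn (fun t : ℝ => T t x) (Set.Ici 0)

/-- A `C₀`-semigroup is bounded if `sup_{t ≥ 0} ‖T t‖ < ∞`. -/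
def C0Semigroup.Bounded {X : Type*} [NormedAddCommGroup X] [NormedSpace ℂ X]
    (Tsg : C0Semigroup X) : Prop :=
  ∃ K : ℝ, ∀ t : ℝ, 0 ≤ t → ‖Tsg.T t‖ ≤ K

/-- `R` is the bounded inverse `(lam + A)⁻¹` of `lam + A`, where `A` is a partially
defined linear operator on `X`. -/
structure IsResolvent {X : Type*} [NormedAddCommGroup X] [NormedSpace ℂ X]
    (A : X →ₗ.[ℂ] X) (lam : ℂ) (R : X →L[ℂ] X) : Prop where
  mem_domain : ∀ x : X, R x ∈ A.domain
  eq_apply : ∀ x : X, lam • R x + A ⟨R x, mem_domain x⟩ = x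
  left_inv : ∀ x : A.domain, R (lam • (x : X) + A x) = x

/-- `-A` is the generator of the `C₀`-semigroup `Tsg`:  the domain of `A` is exactly the
set of points `x` for which the right derivative of the orbit `t ↦ T t x` exists at `0`,
and there `A x` equals minus that derivative. -/
def IsGenerator {X : Type*} [NormedAddCommGroup X] [NormedSpace ℂ X]
    (Tsg : C0Semigroup X) (A : X →ₗ.[ℂ] X) : Prop :=
  ∀ x y : X,
    (∃ hx : x ∈ A.domain, A ⟨x, hx⟩ = y) ↔
      Filter.Tendsto (fun t : ℝ => (t : ℂ)⁻¹ • (Tsg.T t x - x))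
        (nhdsWithin 0 (Set.Ioi 0)) (nhds (-y))

/-- A positive measurable function `l` is slowly varying if `l (lam * s) / l s → 1`
as `s → ∞`, for every `lam > 0`. -/
def SlowlyVarying (l : ℝ → ℝ) : Prop :=
  Measurable l ∧ (∀ᶠ s in atTop, 0 < l s) ∧
    ∀ lam : ℝ, 0 < lam → Tendsto (fun s : ℝ => l (lam * s) / l s) atTop (nhds 1)

/-- `ls` is a de Bruijn conjugate of the slowly varying function `l`. -/
def IsDeBruijnConjugate (l ls : ℝ → ℝ) : Prop :=
  SlowlyVarying ls ∧
    Tendsto (fun s : ℝ => l s * ls (s * l s)) atTop (nhds 1) ∧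
    Tendsto (fun s : ℝ => ls s * l (s * ls s)) atTop (nhds 1)

/-- A monotonic slowly varying function `l` is dB-symmetric when `1 / l` is a
de Bruijn conjugate of `l`. -/
def DBSymmetric (l : ℝ → ℝ) : Prop := IsDeBruijnConjugate l fun s => (l s)⁻¹

/-- `g` is an asymptotic inverse of `f`:  `g (f s) ∼ s` and `f (g s) ∼ s` as `s → ∞`. -/
def IsAsympInverse (g f : ℝ → ℝ) : Prop :=
  Tendsto (fun s : ℝ => g (f s) / s) atTop (nhds 1) ∧
    Tendsto (fun s : ℝ => f (g s) / s) atTop (nhds 1)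

/-- The Balakrishnan integral defining the fractional power `B ^ γ` (`0 < γ < 1`) of a
bounded sectorial operator `B`. -/
def balakrishnan {X : Type*} [NormedAddCommGroup X] [NormedSpace ℂ X] [CompleteSpace X]
    (B : X →L[ℂ] X) (γ : ℝ) : X →L[ℂ] X :=
  (Real.sin (Real.pi * γ) / Real.pi) •
    ∫ t in Set.Ioi (0 : ℝ),
      (t ^ (γ - 1) : ℝ) • (B * Ring.inverse ((t : ℂ) • (1 : X →L[ℂ] X) + B))

/-- The fractional power `B ^ α`, `α ≥ 0`, of a bounded sectorial operator `B`, obtained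
from integer powers and the Balakrishnan formula for the fractional part. -/
def opPow {X : Type*} [NormedAddCommGroup X] [NormedSpace ℂ X] [CompleteSpace X]
    (B : X →L[ℂ] X) (α : ℝ) : X →L[ℂ] X :=
  if α = (⌊α⌋₊ : ℝ) then B ^ (⌊α⌋₊ : ℕ) else B ^ (⌊α⌋₊ : ℕ) * balakrishnan B (α - ⌊α⌋₊)

end


section KTHelpers
open scoped FourierTransform SchwartzMap ContDiff

lemma kt_plancherel {X : Type*} [NormedAddCommGroup X] [InnerProductSpace ℂ X] [CompleteSpace X]
    (f : ℝ → X) (h1 : Integrable f) (h2 : MemLp f 2) :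
    MemLp (𝓕 f) 2 ∧ eLpNorm (𝓕 f) 2 = eLpNorm f 2 := by
  let F : Lp X 2 (volume : Measure ℝ) := 𝓕 (h2.toLp f)
  have hcont : Continuous (𝓕 f) := VectorFourier.fourierIntegral_continuous
    Real.continuous_fourierChar (innerSL ℝ).continuous₂ h1
  have hae : ∀ᵐ x, (F : ℝ → X) x = 𝓕 f x := by
    apply ae_eq_of_integral_contDiff_smul_eq
    · exact (Lp.memLp F).locallyIntegrable (by norm_num)
    · exact hcont.locallyIntegrable
    intro g hg hgs
    have hs1 : HasCompactSupport (fun x => (g x : ℂ)) := hgs.comp_left (g := fun x : ℝ => (x : ℂ)) (by simp)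
    have hs2 : ContDiff ℝ ∞ (fun x => (g x : ℂ)) := Complex.ofRealCLM.contDiff.comp hg
    let φ : 𝓢(ℝ, ℂ) := hs1.toSchwartzMap hs2
    have e1 := congrArg (fun L => L φ) (Lp.fourier_toTemperedDistribution_eq (h2.toLp f))
    simp only [TemperedDistribution.fourier_apply, Lp.toTemperedDistribution_apply] at e1
    have e2 : ∫ x, (𝓕 φ) x • (h2.toLp f : ℝ → X) x = ∫ x, (𝓕 φ) x • f x := by
      apply integral_congr_ae
      filter_upwards [h2.coeFn_toLp] with x hx
      rw [hx]
    have e3 : ∫ x, (𝓕 (φ : ℝ → ℂ)) x • f x = ∫ x, φ x • 𝓕 f x := by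
      have := VectorFourier.integral_fourierIntegral_smul_eq_flip (L := innerₗ ℝ) (μ := volume) (ν := volume)
        (f := φ) (g := f) Real.continuous_fourierChar continuous_inner φ.integrable h1
      simpa using! this
    rw [e2] at e1
    have e4 : ∫ x, g x • (F : ℝ → X) x = ∫ x, φ x • (F : ℝ → X) x := by
      congr 1
    have e5 : ∫ x, g x • 𝓕 f x = ∫ x, φ x • 𝓕 f x := by
      congr 1
    rw [e4, e5, ← e3, ← e1]
    rfl
  have hm : MemLp (𝓕 f) 2 := (memLp_congr_ae hae).1 (Lp.memLp F)
  refine ⟨hm, ?_⟩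
  rw [← eLpNorm_congr_ae hae, ← eLpNorm_congr_ae h2.coeFn_toLp]
  have := Lp.norm_fourier_eq (h2.toLp f)
  rw [Lp.norm_def, Lp.norm_def, ENNReal.toReal_eq_toReal_iff' (Lp.eLpNorm_ne_top _) (Lp.eLpNorm_ne_top _)] at this
  exact this

/-- weight `t^k/k! e^{-λ t}` -/
noncomputable def ktW (lam : ℂ) (k : ℕ) (t : ℝ) : ℂ :=
  (t : ℂ) ^ k / (k.factorial : ℂ) * Complex.exp (-lam * t)

lemma ktW_cont (lam : ℂ) (k : ℕ) : Continuous (ktW lam k) := by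
  unfold ktW; fun_prop

lemma ktW_norm (lam : ℂ) (k : ℕ) (t : ℝ) (ht : 0 ≤ t) :
    ‖ktW lam k t‖ = t ^ k / k.factorial * Real.exp (-lam.re * t) := by
  simp [ktW, Complex.norm_exp, abs_of_nonneg ht]

lemma ktW_norm_int (lam : ℂ) (k : ℕ) (h : 0 < lam.re) :
    IntegrableOn (fun t : ℝ => t ^ k / k.factorial * Real.exp (-lam.re * t)) (Ioi 0) := by
  have := (integrableOn_rpow_mul_exp_neg_mul_rpow (p := 1) (s := k) (b := lam.re)
    (by have : (0:ℝ) ≤ k := k.cast_nonneg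
        linarith) one_pos h).div_const (k.factorial : ℝ)
  refine this.congr ?_
  filter_upwards [ae_restrict_mem measurableSet_Ioi] with t ht
  simp only [Real.rpow_one, Real.rpow_natCast]
  ring

section
variable {X : Type*} [NormedAddCommGroup X] [InnerProductSpace ℂ X]

lemma ktLap_integrable (lam : ℂ) (k : ℕ) (h : 0 < lam.re) (g : ℝ → X)
    (hg : ContinuousOn g (Ici 0)) (K : ℝ) (hK : ∀ t, 0 ≤ t → ‖g t‖ ≤ K) :
    IntegrableOn (fun t : ℝ => ktW lam k t • g t) (Ioi 0) := by
  refine Integrable.mono' ((ktW_norm_int lam k h).mul_const K) ?_ ?_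
  · refine ContinuousOn.aestronglyMeasurable ?_ measurableSet_Ioi
    exact (ktW_cont lam k).continuousOn.smul (hg.mono Ioi_subset_Ici_self)
  · filter_upwards [ae_restrict_mem measurableSet_Ioi] with t ht
    rw [norm_smul, ktW_norm _ _ _ (le_of_lt ht)]
    have : (0:ℝ) < t := ht
    exact mul_le_mul_of_nonneg_left (hK t ht.le) (by positivity)

noncomputable def ktLap (lam : ℂ) (k : ℕ) (g : ℝ → X) : X :=
  ∫ t in Ioi (0:ℝ), ktW lam k t • g t

lemma ktLap_norm_le (lam : ℂ) (h : 0 < lam.re) (g : ℝ → X)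
    (K : ℝ) (hK : ∀ t, 0 ≤ t → ‖g t‖ ≤ K) :
    ‖ktLap lam 0 g‖ ≤ K / lam.re := by
  have h1 := norm_integral_le_of_norm_le (μ := volume.restrict (Ioi (0:ℝ)))
    (f := fun t : ℝ => ktW lam 0 t • g t) ((ktW_norm_int lam 0 h).mul_const K) (by
      filter_upwards [ae_restrict_mem measurableSet_Ioi] with t ht
      rw [norm_smul, ktW_norm _ _ _ (le_of_lt ht)]
      have : (0:ℝ) < t := ht
      exact mul_le_mul_of_nonneg_left (hK t ht.le) (by positivity))
  refine h1.trans (le_of_eq ?_)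
  rw [integral_mul_const]
  simp only [pow_zero, Nat.factorial_zero, Nat.cast_one, div_one, one_mul]
  rw [integral_exp_mul_Ioi (by linarith)]
  simp
  field_simp

lemma ktLap_fourier (a : ℝ) (k : ℕ) (g : ℝ → X) (ξ : ℝ) :
    𝓕 ((Ioi (0:ℝ)).indicator (fun t => ktW a k t • g t)) ξ
      = ktLap (a + 2 * Real.pi * ξ * I) k g := by
  rw [Real.fourier_real_eq_integral_exp_smul, ktLap, ← integral_indicator measurableSet_Ioi]
  congr 1
  ext t
  by_cases ht : t ∈ Ioi (0:ℝ)
  · simp only [indicator_of_mem ht, smul_smul, ktW]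
    congr 1
    rw [mul_left_comm, ← Complex.exp_add]
    congr 2
    push_cast
    ring
  · simp [indicator_of_notMem ht]

variable [CompleteSpace X]

lemma ktLap_sq (a : ℝ) (ha : 0 < a) (g : ℝ → X)
    (hg : ContinuousOn g (Ici 0)) (K : ℝ) (hK : ∀ t, 0 ≤ t → ‖g t‖ ≤ K) :
    MemLp (fun ξ : ℝ => ktLap (a + 2 * Real.pi * ξ * I) 0 g) 2 ∧
    ∫ ξ : ℝ, ‖ktLap (a + 2 * Real.pi * ξ * I) 0 g‖ ^ 2 ≤ K ^ 2 / (2 * a) := by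
  set f : ℝ → X := (Ioi (0:ℝ)).indicator (fun t => ktW a 0 t • g t) with hf
  have ha' : 0 < (a : ℂ).re := by simpa using ha
  have h1 : Integrable f := (integrable_indicator_iff measurableSet_Ioi).2
    (ktLap_integrable a 0 ha' g hg K hK)
  have hb : ∀ t, ‖f t‖ ^ 2 ≤ (Ioi (0:ℝ)).indicator (fun t => K ^ 2 * Real.exp (-(2 * a) * t)) t := by
    intro t
    by_cases ht : t ∈ Ioi (0:ℝ)
    · have ht' : (0:ℝ) < t := ht
      simp only [hf, indicator_of_mem ht]
      rw [norm_smul, ktW_norm _ _ _ ht'.le, mul_pow]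
      have : Real.exp (-(2 * a) * t) = Real.exp (-a * t) ^ 2 := by
        rw [← Real.exp_nat_mul]; congr 1; push_cast; ring
      rw [this]
      simp only [pow_zero, Nat.factorial_zero, Nat.cast_one, div_one, one_mul, Complex.ofReal_re]
      rw [mul_comm]
      gcongr
      exact hK t ht'.le
    · simp [hf, indicator_of_notMem ht]
  have hi : Integrable ((Ioi (0:ℝ)).indicator (fun t => K ^ 2 * Real.exp (-(2 * a) * t))) :=
    (integrable_indicator_iff measurableSet_Ioi).2
      ((integrableOn_exp_mul_Ioi (by linarith) 0).const_mul _)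
  have h3 : Integrable (fun t => ‖f t‖ ^ 2) := by
    refine hi.mono' (h1.aestronglyMeasurable.norm.pow 2) (ae_of_all _ fun t => ?_)
    rw [Real.norm_of_nonneg (by positivity)]
    exact hb t
  have h2 : MemLp f 2 := (memLp_two_iff_integrable_sq_norm h1.aestronglyMeasurable).2 h3
  obtain ⟨p1, p2⟩ := kt_plancherel f h1 h2
  have hfun : 𝓕 f = (fun ξ : ℝ => ktLap (a + 2 * Real.pi * ξ * I) 0 g) :=
    funext fun ξ => ktLap_fourier a 0 g ξ
  rw [p1.eLpNorm_eq_integral_rpow_norm (by norm_num) (by norm_num),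
    h2.eLpNorm_eq_integral_rpow_norm (by norm_num) (by norm_num)] at p2
  rw [hfun] at p1 p2
  refine ⟨p1, ?_⟩
  have n1 : 0 ≤ ∫ ξ : ℝ, ‖ktLap (a + 2 * Real.pi * ξ * I) 0 g‖ ^ (2:ℝ) :=
    integral_nonneg fun _ => by positivity
  have n2 : 0 ≤ ∫ ξ : ℝ, ‖f ξ‖ ^ (2:ℝ) :=
    integral_nonneg fun _ => by positivity
  rw [ENNReal.ofReal_eq_ofReal_iff (by positivity) (by positivity)] at p2
  simp only [ENNReal.toReal_ofNat] at p2
  have p3 := Real.rpow_left_injOn (x := (2:ℝ)⁻¹) (by norm_num) n1 n2 p2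
  simp only [Real.rpow_ofNat] at p3
  rw [p3]
  refine (integral_mono h3 hi hb).trans (le_of_eq ?_)
  rw [integral_indicator measurableSet_Ioi, integral_const_mul, integral_exp_mul_Ioi (by linarith)]
  simp
  field_simp

end

section
variable {X : Type*} [NormedAddCommGroup X] [InnerProductSpace ℂ X]

lemma kt_orbit_deriv (Tsg : C0Semigroup X) (A : X →ₗ.[ℂ] X) (hgen : IsGenerator Tsg A)
    (x : X) (hx : x ∈ A.domain) (t : ℝ) (ht : 0 ≤ t) :
    HasDerivWithinAt (fun t => Tsg.T t x) (-(Tsg.T t (A ⟨x, hx⟩))) (Ioi t) t := by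
  have h1 := (hgen x (A ⟨x, hx⟩)).1 ⟨hx, rfl⟩
  have h2 : Tendsto (fun u : ℝ => u - t) (nhdsWithin t (Ioi t)) (nhdsWithin 0 (Ioi 0)) := by
    refine tendsto_nhdsWithin_iff.2 ⟨?_, ?_⟩
    · have : Tendsto (fun u : ℝ => u - t) (nhds t) (nhds (t - t)) :=
        (continuous_id.sub continuous_const).tendsto t
      rw [sub_self] at this
      exact this.mono_left nhdsWithin_le_nhds
    · filter_upwards [self_mem_nhdsWithin] with u hu
      exact sub_pos.2 (mem_Ioi.1 hu)
  have h3 := ((Tsg.T t).continuous.tendsto _).comp (h1.comp h2)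
  rw [hasDerivWithinAt_iff_tendsto_slope]
  have hs : Ioi t \ {t} = Ioi t := by
    ext u; simp only [Set.mem_sdiff, mem_Ioi, mem_singleton_iff]
    exact ⟨fun h => h.1, fun h => ⟨h, ne_of_gt h⟩⟩
  rw [hs]
  rw [map_neg] at h3
  refine h3.congr' ?_
  filter_upwards [self_mem_nhdsWithin] with u hu
  have hu' : t < u := hu
  have e : Tsg.T u x = Tsg.T t (Tsg.T (u - t) x) := by
    have := Tsg.map_add t (u - t) ht (by linarith)
    rw [add_sub_cancel] at this
    rw [this]; rfl
  simp only [Function.comp, slope, vsub_eq_sub, e]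
  rw [map_smul, map_sub, ← Complex.coe_smul]
  push_cast
  rfl

variable [CompleteSpace X]

lemma kt_ibp (Tsg : C0Semigroup X) (M : ℝ) (hM : ∀ t, 0 ≤ t → ‖Tsg.T t‖ ≤ M)
    (A : X →ₗ.[ℂ] X) (hgen : IsGenerator Tsg A)
    (x : X) (hx : x ∈ A.domain) (W W' : ℝ → ℂ) (hW : ∀ t, HasDerivAt W (W' t) t)
    (hlim : Tendsto W atTop (nhds 0))
    (h1 : IntegrableOn (fun t => W' t • Tsg.T t x) (Ioi 0))
    (h2 : IntegrableOn (fun t => W t • Tsg.T t (A ⟨x, hx⟩)) (Ioi 0)) :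
    ∫ t in Ioi (0:ℝ), (W' t • Tsg.T t x - W t • Tsg.T t (A ⟨x, hx⟩)) = - (W 0 • x) := by
  have hintg : IntegrableOn (fun t => W' t • Tsg.T t x - W t • Tsg.T t (A ⟨x, hx⟩)) (Ioi 0) :=
    h1.sub h2
  have l1 := intervalIntegral_tendsto_integral_Ioi (0:ℝ) hintg tendsto_id
  have hWc : Continuous W := continuous_iff_continuousAt.2 fun t => (hW t).continuousAt
  have l2 : ∀ b : ℝ, 0 ≤ b → ∫ t in (0:ℝ)..b, (W' t • Tsg.T t x - W t • Tsg.T t (A ⟨x, hx⟩))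
      = W b • Tsg.T b x - W 0 • x := by
    intro b hb
    have := intervalIntegral.integral_eq_sub_of_hasDeriv_right (a := 0) (b := b)
      (f := fun t => W t • Tsg.T t x)
      (f' := fun t => W' t • Tsg.T t x - W t • Tsg.T t (A ⟨x, hx⟩)) ?_ ?_ ?_
    · rw [this]
      simp [Tsg.map_zero]
    · rw [uIcc_of_le hb]
      exact hWc.continuousOn.smul ((Tsg.strong_continuity x).mono Icc_subset_Ici_self)
    · intro t ht
      rw [min_eq_left hb] at ht
      have := (hW t).hasDerivWithinAt (s := Ioi t) |>.smul
        (kt_orbit_deriv Tsg A hgen x hx t ht.1.le)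
      refine this.congr_deriv ?_
      rw [smul_neg]; abel
    · rw [intervalIntegrable_iff_integrableOn_Ioc_of_le hb]
      exact hintg.mono_set Ioc_subset_Ioi_self
  have l3 : Tendsto (fun b : ℝ => W b • Tsg.T b x - W 0 • x) atTop (nhds (0 - W 0 • x)) := by
    refine Tendsto.sub_const ?_ _
    rw [tendsto_zero_iff_norm_tendsto_zero]
    have hz : Tendsto (fun b : ℝ => ‖W b‖ * (M * ‖x‖)) atTop (nhds 0) := by
      have := (tendsto_zero_iff_norm_tendsto_zero.1 hlim).mul_const (M * ‖x‖)
      simpa using this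
    refine squeeze_zero' (Eventually.of_forall fun _ => norm_nonneg _) ?_ hz
    filter_upwards [eventually_ge_atTop 0] with b hb
    rw [norm_smul]
    gcongr
    exact (Tsg.T b).le_of_opNorm_le (hM b hb) x
  have l4 := l3.congr' (by
    filter_upwards [eventually_ge_atTop 0] with b hb
    exact (l2 b hb).symm)
  rw [zero_sub] at l4
  exact tendsto_nhds_unique l1 l4

lemma ktW_tendsto (lam : ℂ) (k : ℕ) (h : 0 < lam.re) : Tendsto (ktW lam k) atTop (nhds 0) := by
  rw [tendsto_zero_iff_norm_tendsto_zero]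
  have := (tendsto_rpow_mul_exp_neg_mul_atTop_nhds_zero k lam.re h).div_const (k.factorial : ℝ)
  rw [zero_div] at this
  refine this.congr' ?_
  filter_upwards [eventually_ge_atTop 0] with t ht
  rw [ktW_norm _ _ _ ht, Real.rpow_natCast]
  ring

lemma ktW_deriv_zero (lam : ℂ) (t : ℝ) : HasDerivAt (ktW lam 0) (-lam * ktW lam 0 t) t := by
  have h1 : HasDerivAt (fun t : ℝ => -lam * (t:ℂ)) (-lam * 1) t :=
    (Complex.ofRealCLM.hasDerivAt).const_mul (-lam)
  have h2 := h1.cexp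
  have : ktW lam 0 = fun t : ℝ => Complex.exp (-lam * t) := by ext; simp [ktW]
  rw [this]
  refine h2.congr_deriv (by ring)

lemma ktW_deriv_succ (lam : ℂ) (k : ℕ) (t : ℝ) :
    HasDerivAt (ktW lam (k + 1)) (ktW lam k t - lam * ktW lam (k + 1) t) t := by
  have h0 : HasDerivAt (fun t : ℝ => (t:ℂ)) 1 t := Complex.ofRealCLM.hasDerivAt
  have h1 : HasDerivAt (fun t : ℝ => -lam * (t:ℂ)) (-lam * 1) t := h0.const_mul (-lam)
  have h2 := ((h0.pow (k+1)).div_const ((k+1).factorial : ℂ)).mul h1.cexp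
  refine (h2.congr_deriv ?_)
  simp only [ktW, Nat.factorial_succ, Nat.cast_mul, Nat.add_sub_cancel]
  have h3 : (k.factorial : ℂ) ≠ 0 := by exact_mod_cast k.factorial_ne_zero
  have h4 : ((k+1 : ℕ) : ℂ) ≠ 0 := by exact_mod_cast k.succ_ne_zero
  simp only [Pi.pow_apply]
  field_simp
  ring

lemma kt_int (Tsg : C0Semigroup X) (M : ℝ) (hM : ∀ t, 0 ≤ t → ‖Tsg.T t‖ ≤ M)
    (lam : ℂ) (hl : 0 < lam.re)
    (k : ℕ) (x : X) : IntegrableOn (fun t : ℝ => ktW lam k t • Tsg.T t x) (Ioi 0) :=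
  ktLap_integrable lam k hl _ (Tsg.strong_continuity x) (M * ‖x‖)
    fun t ht => (Tsg.T t).le_of_opNorm_le (hM t ht) x

lemma ktLap_zero_gen (Tsg : C0Semigroup X) (M : ℝ) (hM : ∀ t, 0 ≤ t → ‖Tsg.T t‖ ≤ M)
    (A : X →ₗ.[ℂ] X) (hgen : IsGenerator Tsg A) (lam : ℂ) (hl : 0 < lam.re)
    (x : X) (hx : x ∈ A.domain) :
    ktLap lam 0 (fun t => Tsg.T t (lam • x + A ⟨x, hx⟩)) = x := by
  have := kt_ibp Tsg M hM A hgen x hx (ktW lam 0) (fun t => -lam * ktW lam 0 t)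
    (ktW_deriv_zero lam) (ktW_tendsto lam 0 hl)
    (by
      refine ((kt_int Tsg M hM lam hl 0 x).smul (-lam)).congr (ae_of_all _ fun t => ?_)
      simp only [Pi.smul_apply, smul_smul])
    (kt_int Tsg M hM lam hl 0 _)
  have e : ktW lam 0 0 = 1 := by simp [ktW]
  rw [e, one_smul] at this
  rw [← neg_inj, ← this, ktLap, ← integral_neg]
  congr 1
  ext t
  rw [map_add, map_smul, smul_add, smul_smul, mul_comm (ktW lam 0 t), neg_mul, neg_smul]
  abel

lemma ktLap_succ_gen (Tsg : C0Semigroup X) (M : ℝ) (hM : ∀ t, 0 ≤ t → ‖Tsg.T t‖ ≤ M)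
    (A : X →ₗ.[ℂ] X) (hgen : IsGenerator Tsg A) (lam : ℂ) (hl : 0 < lam.re)
    (k : ℕ) (x : X) (hx : x ∈ A.domain) :
    ktLap lam (k+1) (fun t => Tsg.T t (lam • x + A ⟨x, hx⟩)) = ktLap lam k (fun t => Tsg.T t x) := by
  have i1 := kt_int Tsg M hM lam hl k x
  have i2 := kt_int Tsg M hM lam hl (k+1) (lam • x + A ⟨x, hx⟩)
  have := kt_ibp Tsg M hM A hgen x hx (ktW lam (k+1)) _
    (ktW_deriv_succ lam k) (ktW_tendsto lam _ hl)
    (by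
      have := i1.sub ((kt_int Tsg M hM lam hl (k+1) x).smul lam)
      refine this.congr (ae_of_all _ fun t => ?_)
      simp only [Pi.sub_apply, Pi.smul_apply, sub_smul, smul_smul])
    (kt_int Tsg M hM lam hl _ _)
  have e : ktW lam (k+1) 0 = 0 := by simp [ktW]
  rw [e, zero_smul, neg_zero] at this
  have h2 := integral_sub i1 i2
  symm
  rw [← sub_eq_zero, ktLap, ktLap, ← h2, ← this]
  congr 1
  ext t
  rw [map_add, map_smul, smul_add, smul_smul, sub_smul, mul_comm (ktW lam (k+1) t)]
  abel

lemma ktLap_mem (Tsg : C0Semigroup X) (M : ℝ) (hM : ∀ t, 0 ≤ t → ‖Tsg.T t‖ ≤ M)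
    (A : X →ₗ.[ℂ] X) (hgen : IsGenerator Tsg A) (lam : ℂ) (hl : 0 < lam.re)
    (z : X) :
    ∃ h : ktLap lam 0 (fun t => Tsg.T t z) ∈ A.domain,
      A ⟨_, h⟩ = z - lam • ktLap lam 0 (fun t => Tsg.T t z) := by
  rw [hgen]
  set f : ℝ → X := fun t => ktW lam 0 t • Tsg.T t z with hf
  have hfi : IntegrableOn f (Ioi 0) := kt_int Tsg M hM lam hl 0 z
  set v := ktLap lam 0 (fun t => Tsg.T t z) with hv
  have hv' : v = ∫ t in Ioi (0:ℝ), f t := rfl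
  have hfc : ContinuousOn f (Ici 0) := (ktW_cont lam 0).continuousOn.smul (Tsg.strong_continuity z)
  have f0 : f 0 = z := by simp [hf, ktW, Tsg.map_zero]
  have key : ∀ h : ℝ, 0 < h → Tsg.T h v = Complex.exp (lam * h) • (v - ∫ t in (0:ℝ)..h, f t) := by
    intro h hh
    have e1 : v - ∫ t in (0:ℝ)..h, f t = ∫ t in Ioi h, f t := by
      rw [hv', sub_eq_iff_eq_add', intervalIntegral.integral_of_le hh.le,
        ← setIntegral_union (Ioc_disjoint_Ioi le_rfl) measurableSet_Ioi
          (hfi.mono_set Ioc_subset_Ioi_self) (hfi.mono_set (Ioi_subset_Ioi hh.le)),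
        Ioc_union_Ioi_eq_Ioi hh.le]
    have e2 := (measurePreserving_add_right volume h).setIntegral_preimage_emb
      (measurableEmbedding_addRight h) f (Ioi h)
    have e3 : (fun x => x + h) ⁻¹' Ioi h = Ioi (0:ℝ) := by ext u; simp
    rw [e1, ← e2, e3, hv', ← (Tsg.T h).integral_comp_comm hfi, ← integral_smul]
    apply setIntegral_congr_fun measurableSet_Ioi
    intro t ht
    have ht' : (0:ℝ) < t := ht
    simp only [hf, map_smul, smul_smul]
    rw [add_comm t h, Tsg.map_add h t hh.le ht'.le]
    simp only [ContinuousLinearMap.comp_apply]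
    congr 1
    simp only [ktW, pow_zero, Nat.factorial_zero, Nat.cast_one, div_one, one_mul]
    rw [← Complex.exp_add]
    congr 1
    push_cast; ring
  have d1 : HasDerivWithinAt (fun h : ℝ => ∫ t in (0:ℝ)..h, f t) (f 0) (Ici 0) 0 := by
    refine intervalIntegral.integral_hasDerivWithinAt_right (t := Ioi 0) (by simp) ?_ ?_
    · exact ⟨Ioi 0, self_mem_nhdsWithin, hfi.aestronglyMeasurable⟩
    · exact (hfc 0 self_mem_Ici).mono Ioi_subset_Ici_self
  have d2 : HasDerivAt (fun h : ℝ => Complex.exp (lam * h)) lam 0 := by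
    have h1 : HasDerivAt (fun t : ℝ => lam * (t:ℂ)) (lam * 1) 0 :=
      (Complex.ofRealCLM.hasDerivAt).const_mul lam
    refine h1.cexp.congr_deriv (by simp)
  have d3 := (d2.hasDerivWithinAt (s := Ici 0)).smul (d1.const_sub v)
  have d4 := hasDerivWithinAt_iff_tendsto_slope.1 d3
  have hs : Ici (0:ℝ) \ {0} = Ioi 0 := by
    ext u; simp only [Set.mem_sdiff, mem_Ici, mem_singleton_iff, mem_Ioi]
    exact ⟨fun h => lt_of_le_of_ne h.1 (Ne.symm h.2), fun h => ⟨h.le, h.ne'⟩⟩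
  rw [hs] at d4
  have e5 : -(z - lam • v) = Complex.exp (lam * (0:ℝ)) • -f 0 + lam • (v - ∫ t in (0:ℝ)..0, f t) := by
    simp [f0]
    abel
  rw [e5]
  refine d4.congr' ?_
  filter_upwards [self_mem_nhdsWithin] with h hh
  rw [key h hh]
  simp only [slope, vsub_eq_sub, sub_zero]
  rw [← Complex.coe_smul]
  simp

end

section
variable {X : Type*} [NormedAddCommGroup X] [InnerProductSpace ℂ X] [CompleteSpace X]

lemma ktV_exists (Tsg : C0Semigroup X) (M : ℝ) (hM : ∀ t, 0 ≤ t → ‖Tsg.T t‖ ≤ M)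
    (A : X →ₗ.[ℂ] X) (hgen : IsGenerator Tsg A) (lam : ℂ) (hl : 0 < lam.re) :
    ∃ V : X →L[ℂ] X, ‖V‖ ≤ M / lam.re ∧
      (∀ k x, (V ^ (k+1)) x = ktLap lam k (fun t => Tsg.T t x)) ∧
      (∀ (x : X) (hx : x ∈ A.domain), V (lam • x + A ⟨x, hx⟩) = x) := by
  have hM0 : 0 ≤ M := (norm_nonneg _).trans (hM 0 le_rfl)
  let V0 : X →ₗ[ℂ] X :=
    { toFun := fun x => ktLap lam 0 (fun t => Tsg.T t x)
      map_add' := by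
        intro x y
        simp only [ktLap, map_add, smul_add]
        exact integral_add (kt_int Tsg M hM lam hl 0 x) (kt_int Tsg M hM lam hl 0 y)
      map_smul' := by
        intro c x
        simp only [ktLap, map_smul, RingHom.id_apply]
        rw [← integral_smul]
        congr 1
        ext t
        rw [smul_comm] }
  have hb : ∀ x, ‖V0 x‖ ≤ M / lam.re * ‖x‖ := by
    intro x
    refine (ktLap_norm_le lam hl _ (M * ‖x‖)
      fun t ht => (Tsg.T t).le_of_opNorm_le (hM t ht) x).trans (le_of_eq (by ring))
  let V := V0.mkContinuous _ hb
  have hV : ∀ x, V x = ktLap lam 0 (fun t => Tsg.T t x) := fun x => rfl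
  have hg : ∀ (x : X) (hx : x ∈ A.domain), V (lam • x + A ⟨x, hx⟩) = x := by
    intro x hx
    rw [hV, ktLap_zero_gen Tsg M hM A hgen lam hl x hx]
  refine ⟨V, LinearMap.mkContinuous_norm_le _ (by positivity) _, ?_, hg⟩
  intro k
  induction k with
  | zero => intro x; simpa using hV x
  | succ k ih =>
    intro x
    obtain ⟨h, e⟩ := ktLap_mem Tsg M hM A hgen lam hl x
    have e2 := ktLap_succ_gen Tsg M hM A hgen lam hl k _ h
    rw [e, add_sub_cancel] at e2
    rw [e2, pow_succ, mul_apply_eq_comp, ih, hV]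

lemma kt_J_comm (Tsg : C0Semigroup X) (M : ℝ) (hM : ∀ t, 0 ≤ t → ‖Tsg.T t‖ ≤ M)
    (A : X →ₗ.[ℂ] X) (hgen : IsGenerator Tsg A) (J : X →L[ℂ] X) (hJ : IsResolvent A 1 J)
    (s : ℝ) (hs : 0 ≤ s) : J ∘L Tsg.T s = Tsg.T s ∘L J := by
  have h1 : ∀ x, J x = ktLap 1 0 (fun t => Tsg.T t x) := by
    intro x
    have := ktLap_zero_gen Tsg M hM A hgen 1 (by simp) (J x) (hJ.mem_domain x)
    rw [hJ.eq_apply x] at this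
    exact this.symm
  ext x
  simp only [ContinuousLinearMap.comp_apply, h1, ktLap]
  rw [← (Tsg.T s).integral_comp_comm (kt_int Tsg M hM 1 (by simp) 0 x)]
  apply setIntegral_congr_fun measurableSet_Ioi
  intro t ht
  have ht' : (0:ℝ) < t := ht
  simp only [map_smul, ← ContinuousLinearMap.comp_apply]
  rw [← Tsg.map_add _ _ ht'.le hs, ← Tsg.map_add _ _ hs ht'.le, add_comm]

lemma kt_adj_cont (Tsg : C0Semigroup X) (M : ℝ) (hM : ∀ t, 0 ≤ t → ‖Tsg.T t‖ ≤ M)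
    (A : X →ₗ.[ℂ] X) (hgen : IsGenerator Tsg A) (J : X →L[ℂ] X) (hJ : IsResolvent A 1 J)
    (z : X) : ContinuousOn (fun t : ℝ => (Tsg.T t).adjoint (J.adjoint z)) (Ici 0) := by
  have hM0 : 0 ≤ M := (norm_nonneg _).trans (hM 0 le_rfl)
  set C : ℝ := M * ‖(1 : X →L[ℂ] X) - J‖ with hC
  have hC0 : 0 ≤ C := by positivity
  have h1 : ∀ s t : ℝ, 0 ≤ s → s ≤ t → ‖Tsg.T t ∘L J - Tsg.T s ∘L J‖ ≤ C * (t - s) := by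
    intro s t hs hst
    refine ContinuousLinearMap.opNorm_le_bound _ (mul_nonneg hC0 (by linarith)) fun x => ?_
    have hA : A ⟨J x, hJ.mem_domain x⟩ = ((1 : X →L[ℂ] X) - J) x := by
      have := hJ.eq_apply x
      rw [one_smul] at this
      simp only [sub_apply, one_apply_eq_self]
      rw [eq_sub_iff_add_eq', this]
    have := norm_image_sub_le_of_norm_deriv_right_le_segment (a := s) (b := t)
      (f := fun u => Tsg.T u (J x)) (C := C * ‖x‖)
      ((Tsg.strong_continuity (J x)).mono fun u hu => hs.trans hu.1)
      (fun u hu => (kt_orbit_deriv Tsg A hgen (J x) (hJ.mem_domain x) u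
        (hs.trans hu.1)).Ici_of_Ioi)
      (fun u hu => by
        rw [norm_neg, hA, hC, mul_assoc]
        refine ((Tsg.T u).le_of_opNorm_le (hM u (hs.trans hu.1)) _).trans ?_
        gcongr
        exact ContinuousLinearMap.le_opNorm _ _) t ⟨hst, le_rfl⟩
    refine this.trans (le_of_eq (by ring))
  have h2 : ContinuousOn (fun t : ℝ => Tsg.T t ∘L J) (Ici 0) := by
    have : LipschitzOnWith C.toNNReal (fun t : ℝ => Tsg.T t ∘L J) (Ici 0) := by
      refine LipschitzOnWith.of_dist_le_mul fun s hs t ht => ?_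
      rw [Real.coe_toNNReal _ hC0]
      rcases le_total s t with h | h
      · rw [dist_comm, dist_comm s t, dist_eq_norm, Real.dist_eq, abs_of_nonneg (by linarith)]
        exact h1 s t hs h
      · rw [dist_eq_norm, Real.dist_eq, abs_of_nonneg (by linarith)]
        exact h1 t s ht h
    exact this.continuousOn
  have h3 : ContinuousOn (fun t : ℝ => (ContinuousLinearMap.adjoint (Tsg.T t ∘L J)) z) (Ici 0) :=
    ((ContinuousLinearMap.adjoint (𝕜 := ℂ) (E := X) (F := X)).continuous.comp_continuousOn h2).clm_apply
      continuousOn_const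
  refine h3.congr fun t ht => ?_
  beta_reduce
  rw [← kt_J_comm Tsg M hM A hgen J hJ t ht, ContinuousLinearMap.adjoint_comp]
  rfl

lemma kt_dense (A : X →ₗ.[ℂ] X) (J : X →L[ℂ] X) (hJ : IsResolvent A 1 J) :
    DenseRange (J.adjoint : X → X) := by
  have h1 : (J.adjoint.range)ᗮ = ⊥ := by
    rw [Submodule.eq_bot_iff]
    intro x hx
    have h2 : J x = 0 := by
      rw [← inner_self_eq_zero (𝕜 := ℂ), ← ContinuousLinearMap.adjoint_inner_left]
      exact hx _ ⟨J x, rfl⟩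
    have h3 := hJ.eq_apply x
    have h4 : (⟨J x, hJ.mem_domain x⟩ : A.domain) = 0 := Subtype.ext h2
    rw [h4, h2] at h3
    simpa using h3.symm
  have h2 := (Submodule.topologicalClosure_eq_top_iff).2 h1
  have h3 := (Submodule.dense_iff_topologicalClosure_eq_top).2 h2
  exact h3

lemma kt_adj_lap (Tsg : C0Semigroup X) (M : ℝ) (hM : ∀ t, 0 ≤ t → ‖Tsg.T t‖ ≤ M)
    (lam : ℂ) (hl : 0 < lam.re) (V : X →L[ℂ] X)
    (hV : ∀ x, V x = ktLap lam 0 (fun t => Tsg.T t x)) (y : X)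
    (hy : ContinuousOn (fun t : ℝ => (Tsg.T t).adjoint y) (Ici 0)) :
    V.adjoint y = ktLap (starRingEnd ℂ lam) 0 (fun t => (Tsg.T t).adjoint y) := by
  refine ext_inner_left ℂ fun w => ?_
  rw [ContinuousLinearMap.adjoint_inner_right, hV, ktLap, ktLap]
  have i2 := ktLap_integrable (starRingEnd ℂ lam) 0 (by simpa using hl) _ hy (M * ‖y‖)
    (fun t ht => by
      refine ContinuousLinearMap.le_of_opNorm_le _ ?_ y
      rw [LinearIsometryEquiv.norm_map]
      exact hM t ht)
  rw [← integral_inner i2, ← inner_conj_symm, ← integral_inner (kt_int Tsg M hM lam hl 0 w),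
    ← integral_conj]
  congr 1
  ext t
  rw [inner_smul_right, inner_smul_right, map_mul, inner_conj_symm,
    ContinuousLinearMap.adjoint_inner_right]
  congr 1
  simp [ktW, ← Complex.exp_conj]

end

lemma kt_cs (P Q : ℝ → ℝ) (hP : MemLp P 2) (hQ : MemLp Q 2) (p0 : ∀ x, 0 ≤ P x) (q0 : ∀ x, 0 ≤ Q x)
    (K L c : ℝ) (hK : 0 ≤ K) (hL : 0 ≤ L) (hc : 0 ≤ c)
    (h1 : ∫ x, P x ^ 2 ≤ K ^ 2 * c) (h2 : ∫ x, Q x ^ 2 ≤ L ^ 2 * c) :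
    Integrable (fun x => P x * Q x) ∧ ∫ x, P x * Q x ≤ K * L * c := by
  refine ⟨hP.integrable_mul hQ, ?_⟩
  have := integral_mul_le_Lp_mul_Lq_of_nonneg (μ := volume) (f := P) (g := Q) Real.HolderConjugate.two_two
    (ae_of_all _ p0) (ae_of_all _ q0) (by simpa using hP) (by simpa using hQ)
  simp only [Real.rpow_ofNat, ← Real.sqrt_eq_rpow] at this
  refine this.trans ?_
  calc _ ≤ √(K^2*c) * √(L^2*c) := by gcongr
    _ = K * L * c := by
      rw [Real.sqrt_mul (by positivity), Real.sqrt_mul (by positivity), Real.sqrt_sq hK, Real.sqrt_sq hL]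
      rw [mul_mul_mul_comm, Real.mul_self_sqrt hc]

section
variable {X : Type*} [NormedAddCommGroup X] [InnerProductSpace ℂ X] [CompleteSpace X]

/-- Pointwise bound for the integrand. -/
lemma kt_pointwise (V B J : X →L[ℂ] X) (lam : ℂ) (n : ℕ) (H N r' : ℝ) (hN : 0 ≤ N) (hr' : 0 ≤ r')
    (hVB : ∀ x, V (B x) = J x - lam • V (J x)) (hH : ‖V‖ ≤ H)
    (hcase : ‖V‖ ≤ N ∨ ‖lam‖ ≤ r') (x y : X) :
    ‖inner ℂ y ((V ^ (n + 3)) (B x))‖ ≤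
      N ^ (n+1) * (‖V.adjoint y‖ * ‖V (B x)‖) +
        (H ^ n + r' * H ^ (n+1)) * (‖V.adjoint y‖ * ‖V (J x)‖) := by
  have hH0 : 0 ≤ H := (norm_nonneg _).trans hH
  have pw : ∀ (k : ℕ) (D : ℝ), ‖V‖ ≤ D → ∀ w, ‖(V ^ k) w‖ ≤ D ^ k * ‖w‖ := by
    intro k D hD w
    induction k with
    | zero => simp
    | succ k ih =>
      rw [pow_succ', mul_apply_eq_comp]
      refine (V.le_of_opNorm_le hD _).trans ?_
      rw [pow_succ', mul_assoc]
      have : 0 ≤ D := (norm_nonneg _).trans hD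
      gcongr
  have hin : ∀ w, ‖inner ℂ y (V w)‖ ≤ ‖V.adjoint y‖ * ‖w‖ := by
    intro w
    rw [← ContinuousLinearMap.adjoint_inner_left]
    exact norm_inner_le_norm _ _
  rcases hcase with h | h
  · have e : (V ^ (n+3)) (B x) = V ((V ^ (n+1)) (V (B x))) := by
      have e0 : V ^ (n+3) = V * (V ^ (n+1) * V) := by rw [← pow_succ, ← pow_succ']
      rw [e0]; rfl
    rw [e]
    have h1 := (hin ((V ^ (n+1)) (V (B x)))).trans
      (mul_le_mul_of_nonneg_left (pw (n+1) N h _) (norm_nonneg _))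
    have h2 : 0 ≤ (H ^ n + r' * H ^ (n+1)) * (‖V.adjoint y‖ * ‖V (J x)‖) := by positivity
    nlinarith
  · have e : (V ^ (n+3)) (B x) = V ((V ^ n) (V (J x))) - lam • V ((V ^ (n+1)) (V (J x))) := by
      have e1 : (V ^ (n+3)) (B x) = V ((V ^ (n+1)) (V (B x))) := by
        have e0 : V ^ (n+3) = V * (V ^ (n+1) * V) := by rw [← pow_succ, ← pow_succ']
        rw [e0]; rfl
      rw [e1, hVB, map_sub, map_sub, map_smul, map_smul]
      congr 2
    rw [e, inner_sub_right, inner_smul_right]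
    refine (norm_sub_le _ _).trans ?_
    rw [norm_mul]
    have h1 := (hin ((V ^ n) (V (J x)))).trans
      (mul_le_mul_of_nonneg_left (pw n H hH _) (norm_nonneg _))
    have h2 := (hin ((V ^ (n+1)) (V (J x)))).trans
      (mul_le_mul_of_nonneg_left (pw (n+1) H hH _) (norm_nonneg _))
    have h3 := mul_le_mul h h2 (norm_nonneg _) hr'
    have h4 : 0 ≤ N ^ (n+1) * (‖V.adjoint y‖ * ‖V (B x)‖) := by positivity
    nlinarith

lemma kt_main_est (Tsg : C0Semigroup X) (M : ℝ) (hM : ∀ t, 0 ≤ t → ‖Tsg.T t‖ ≤ M)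
    (A : X →ₗ.[ℂ] X) (hgen : IsGenerator Tsg A)
    (Res : ℝ → X →L[ℂ] X)
    (hRes : ∀ s : ℝ, s ≠ 0 → IsResolvent A (Complex.I * (s : ℂ)) (Res s))
    (J : X →L[ℂ] X) (hJ : IsResolvent A 1 J) (n : ℕ)
    (t r N : ℝ) (ht : 0 < t) (hr : 0 < r) (hN : 0 ≤ N) (hNt : N ≤ t / 2)
    (hb : ∀ s : ℝ, r ≤ |s| → ‖Res s‖ ≤ N) :
    t ^ (n+2) / (n+2).factorial * Real.exp (-1) * ‖Tsg.T t ∘L ((1 : X →L[ℂ] X) - J)‖ ≤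
      ((2 * N) ^ (n+1) * ‖(1 : X →L[ℂ] X) - J‖ +
        ((M * t) ^ n + (t⁻¹ + r) * (M * t) ^ (n+1)) * ‖J‖) * (M ^ 2 * (t / 2)) := by
  have hM0 : 0 ≤ M := (norm_nonneg _).trans (hM 0 le_rfl)
  set B := (1 : X →L[ℂ] X) - J with hB
  set a : ℝ := t⁻¹ with ha_def
  have ha : 0 < a := inv_pos.2 ht
  set lam : ℝ → ℂ := fun ξ => a + 2 * Real.pi * ξ * I with hlam
  have lam_re : ∀ ξ, (lam ξ).re = a := by intro ξ; simp [hlam]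
  have hl : ∀ ξ, 0 < (lam ξ).re := fun ξ => by rw [lam_re]; exact ha
  choose V hV1 hV2 hV3 using fun ξ => ktV_exists Tsg M hM A hgen (lam ξ) (hl ξ)
  have hV0 : ∀ ξ x, V ξ x = ktLap (lam ξ) 0 (fun t => Tsg.T t x) := fun ξ x => by
    simpa using hV2 ξ 0 x
  have hAJ : ∀ x, A ⟨J x, hJ.mem_domain x⟩ = B x := by
    intro x
    have := hJ.eq_apply x
    rw [one_smul] at this
    simp only [hB, sub_apply, one_apply_eq_self]
    rw [eq_sub_iff_add_eq', this]
  have hVB : ∀ ξ x, V ξ (B x) = J x - lam ξ • V ξ (J x) := by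
    intro ξ x
    have := hV3 ξ (J x) (hJ.mem_domain x)
    rw [hAJ, map_add, map_smul] at this
    rw [eq_sub_iff_add_eq', this]
  have hH : ∀ ξ, ‖V ξ‖ ≤ M * t := by
    intro ξ
    have := hV1 ξ
    rwa [lam_re, ha_def, div_inv_eq_mul] at this
  have hcase : ∀ ξ, ‖V ξ‖ ≤ 2 * N ∨ ‖lam ξ‖ ≤ a + r := by
    intro ξ
    by_cases hs : r ≤ |2 * Real.pi * ξ|
    · left
      set s := 2 * Real.pi * ξ with hs_def
      have hs0 : s ≠ 0 := by
        intro h; rw [h, abs_zero] at hs; linarith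
      have hR := hRes s hs0
      have e : ∀ w, V ξ w = Res s w - a • V ξ (Res s w) := by
        intro w
        have h1 := hV3 ξ (Res s w) (hR.mem_domain w)
        have h2 : lam ξ • Res s w + A ⟨Res s w, hR.mem_domain w⟩ = (a:ℂ) • Res s w + w := by
          have h9 := hR.eq_apply w
          have hl' : lam ξ = a + I * s := by
            simp only [hlam, hs_def]
            push_cast; ring
          rw [hl', add_smul, add_assoc, h9]
        rw [h2, map_add, map_smul, Complex.coe_smul] at h1
        rw [eq_sub_iff_add_eq', h1]
      have h5 : ‖V ξ‖ ≤ N + ‖V ξ‖ / 2 := by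
        refine ContinuousLinearMap.opNorm_le_bound _ (by positivity) fun w => ?_
        rw [e w]
        refine (norm_sub_le _ _).trans ?_
        rw [norm_smul, Real.norm_of_nonneg ha.le]
        have h6 := (Res s).le_of_opNorm_le (hb s hs) w
        have h7 := (V ξ).le_opNorm (Res s w)
        have h8 : a * N ≤ 1 / 2 := by
          rw [ha_def]
          calc t⁻¹ * N ≤ t⁻¹ * (t/2) := by gcongr
            _ = 1/2 := by field_simp
        calc ‖Res s w‖ + a * ‖V ξ (Res s w)‖ ≤ N * ‖w‖ + a * (‖V ξ‖ * (N * ‖w‖)) := by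
              gcongr
              exact h7.trans (by gcongr)
          _ = N * ‖w‖ + (a * N) * (‖V ξ‖ * ‖w‖) := by ring
          _ ≤ N * ‖w‖ + 1 / 2 * (‖V ξ‖ * ‖w‖) := by gcongr
          _ = _ := by ring
      linarith
    · right
      push Not at hs
      simp only [hlam]
      refine (norm_add_le _ _).trans ?_
      have : ‖(2 * Real.pi * ξ * I : ℂ)‖ = |2 * Real.pi * ξ| := by
        rw [norm_mul, Complex.norm_I, mul_one]
        rw [← Real.norm_eq_abs, ← Complex.norm_real]
        push_cast; rfl
      rw [this, Complex.norm_real, Real.norm_of_nonneg ha.le]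
      linarith
  -- square function bounds
  have sq1 : ∀ x, MemLp (fun ξ => ‖V ξ x‖) 2 ∧ ∫ ξ, ‖V ξ x‖ ^ 2 ≤ (M * ‖x‖) ^ 2 * (t / 2) := by
    intro x
    obtain ⟨p, q⟩ := ktLap_sq a ha _ (Tsg.strong_continuity x) (M * ‖x‖)
      (fun u hu => (Tsg.T u).le_of_opNorm_le (hM u hu) x)
    simp only [hV0]
    refine ⟨p.norm, q.trans (le_of_eq ?_)⟩
    rw [ha_def]; field_simp
  have sq2 : ∀ z, MemLp (fun ξ => ‖(V ξ).adjoint (J.adjoint z)‖) 2 ∧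
      ∫ ξ, ‖(V ξ).adjoint (J.adjoint z)‖ ^ 2 ≤ (M * ‖J.adjoint z‖) ^ 2 * (t / 2) := by
    intro z
    have hy := kt_adj_cont Tsg M hM A hgen J hJ z
    obtain ⟨p, q⟩ := ktLap_sq a ha _ hy (M * ‖J.adjoint z‖)
      (fun u hu => by
        refine ContinuousLinearMap.le_of_opNorm_le _ ?_ _
        rw [LinearIsometryEquiv.norm_map]
        exact hM u hu)
    have e : ∀ ξ : ℝ, (V ξ).adjoint (J.adjoint z) =
        ktLap (a + 2 * Real.pi * (-ξ : ℝ) * I) 0 (fun t => (Tsg.T t).adjoint (J.adjoint z)) := by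
      intro ξ
      rw [kt_adj_lap Tsg M hM (lam ξ) (hl ξ) (V ξ) (hV0 ξ) _ hy]
      congr 1
      simp [hlam]
      left
      exact map_ofNat _ 2
    simp only [e]
    constructor
    · exact (p.norm).comp_measurePreserving (Measure.measurePreserving_neg volume)
    · rw [integral_neg_eq_self (fun ξ : ℝ => ‖ktLap (a + 2 * Real.pi * (ξ : ℝ) * I) 0
        (fun t => (Tsg.T t).adjoint (J.adjoint z))‖ ^ 2)]
      refine q.trans (le_of_eq ?_)
      rw [ha_def]; field_simp
  set CC : ℝ := ((2 * N) ^ (n+1) * ‖B‖ + ((M * t) ^ n + (a + r) * (M * t) ^ (n+1)) * ‖J‖)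
    * (M ^ 2 * (t / 2)) with hCC
  have hCC0 : 0 ≤ CC := by positivity
  set om : ℝ := t ^ (n+2) / (n+2).factorial * Real.exp (-1) with hom
  have hom0 : 0 < om := by positivity
  -- weak estimate
  have weak : ∀ x z, ‖inner ℂ (J.adjoint z) (Tsg.T t (B x))‖ * om ≤ CC * ‖x‖ * ‖J.adjoint z‖ := by
    intro x z
    set y := J.adjoint z with hy
    set F : ℝ → X := (Ioi (0:ℝ)).indicator (fun u => ktW a (n+2) u • Tsg.T u (B x)) with hF
    have hFi : Integrable F := (integrable_indicator_iff measurableSet_Ioi).2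
      (kt_int Tsg M hM a (by simpa using ha) (n+2) (B x))
    set f : ℝ → ℂ := fun u => inner ℂ y (F u) with hf
    have hfi : Integrable f := hFi.const_inner y
    have hfF : ∀ ξ, 𝓕 f ξ = inner ℂ y ((V ξ ^ (n+3)) (B x)) := by
      intro ξ
      rw [hV2 ξ (n+2), ← ktLap_fourier a (n+2) _ ξ]
      rw [Real.fourier_real_eq, Real.fourier_real_eq]
      have i := (Real.fourierIntegral_convergent_iff (f := F) (μ := volume) ξ).2 hFi
      simp only [RCLike.inner_apply, conj_trivial] at i
      have i' : Integrable (fun v : ℝ => Real.fourierChar (-(v * ξ)) • F v) := by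
        refine i.congr (ae_of_all _ fun v => ?_)
        beta_reduce
        rw [mul_comm]
      rw [← integral_inner i']
      congr 1
      ext v
      rw [Circle.smul_def, Circle.smul_def, inner_smul_right]
      rfl
    obtain ⟨m1, b1⟩ := sq1 (B x)
    obtain ⟨m2, b2⟩ := sq1 (J x)
    obtain ⟨m3, b3⟩ := sq2 z
    obtain ⟨i1, c1⟩ := kt_cs _ _ m3 m1 (fun _ => norm_nonneg _) (fun _ => norm_nonneg _) _ _ _
      (by positivity) (by positivity) (by positivity) b3 b1
    obtain ⟨i2, c2⟩ := kt_cs _ _ m3 m2 (fun _ => norm_nonneg _) (fun _ => norm_nonneg _) _ _ _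
      (by positivity) (by positivity) (by positivity) b3 b2
    have hpt : ∀ ξ, ‖𝓕 f ξ‖ ≤ (2 * N) ^ (n+1) * (‖(V ξ).adjoint y‖ * ‖V ξ (B x)‖) +
        ((M * t) ^ n + (a + r) * (M * t) ^ (n+1)) * (‖(V ξ).adjoint y‖ * ‖V ξ (J x)‖) := by
      intro ξ
      rw [hfF]
      exact kt_pointwise (V ξ) B J (lam ξ) n (M * t) (2 * N) (a + r) (by positivity) (by positivity)
        (hVB ξ) (hH ξ) (hcase ξ) x y
    have hcont : Continuous (𝓕 f) := VectorFourier.fourierIntegral_continuous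
      Real.continuous_fourierChar (innerSL ℝ).continuous₂ hfi
    have idom := (i1.const_mul ((2 * N) ^ (n+1))).add
      (i2.const_mul ((M * t) ^ n + (a + r) * (M * t) ^ (n+1)))
    have hFfi : Integrable (𝓕 f) := idom.mono' hcont.aestronglyMeasurable (ae_of_all _ hpt)
    have hca : ContinuousAt f t := by
      have h1 : ContinuousAt (fun u => ktW a (n+2) u • Tsg.T u (B x)) t :=
        (ktW_cont a (n+2)).continuousAt.smul
          ((Tsg.strong_continuity (B x)).continuousAt (Ici_mem_nhds ht))
      have h2 : ContinuousAt F t := by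
        refine h1.congr ?_
        filter_upwards [Ioi_mem_nhds ht] with u hu
        simp [hF, indicator_of_mem hu]
      exact continuousAt_const.inner h2
    have hinv := hfi.fourierInv_fourier_eq hFfi hca
    have hle : ‖f t‖ ≤ ∫ ξ, ‖𝓕 f ξ‖ := by
      rw [← hinv, Real.fourierInv_eq]
      refine (norm_integral_le_integral_norm _).trans (le_of_eq ?_)
      simp only [Circle.norm_smul]
    have hft : ‖f t‖ = ‖inner ℂ y (Tsg.T t (B x))‖ * om := by
      have : t ∈ Ioi (0:ℝ) := ht
      simp only [hf, hF, indicator_of_mem this]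
      rw [inner_smul_right, norm_mul, ktW_norm _ _ _ ht.le, mul_comm]
      congr 2
      rw [Complex.ofReal_re, ha_def]
      congr 1
      field_simp
    have hintg := integral_mono hFfi.norm idom hpt
    simp only [Pi.add_apply] at hintg
    rw [integral_add (i1.const_mul _) (i2.const_mul _), integral_const_mul, integral_const_mul] at hintg
    rw [← hft]
    refine hle.trans (hintg.trans ?_)
    have hBx : ‖B x‖ ≤ ‖B‖ * ‖x‖ := B.le_opNorm x
    have hJx : ‖J x‖ ≤ ‖J‖ * ‖x‖ := J.le_opNorm x
    calc _ ≤ (2 * N) ^ (n+1) * (M * ‖y‖ * (M * (‖B‖ * ‖x‖)) * (t / 2)) +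
        ((M * t) ^ n + (a + r) * (M * t) ^ (n+1)) * (M * ‖y‖ * (M * (‖J‖ * ‖x‖)) * (t / 2)) := by
          gcongr
          · exact c1.trans (by gcongr)
          · exact c2.trans (by gcongr)
      _ = CC * ‖x‖ * ‖y‖ := by rw [hCC]; ring
  have weak2 : ∀ x y, ‖inner ℂ y (Tsg.T t (B x))‖ * om ≤ CC * ‖x‖ * ‖y‖ := by
    intro x y
    refine (kt_dense A J hJ).induction_on (p := fun y =>
      ‖inner ℂ y (Tsg.T t (B x))‖ * om ≤ CC * ‖x‖ * ‖y‖) y ?_ (weak x)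
    exact isClosed_le (by fun_prop) (by fun_prop)
  have hfin : ‖Tsg.T t ∘L B‖ ≤ CC / om := by
    refine ContinuousLinearMap.opNorm_le_bound _ (by positivity) fun x => ?_
    have h1 := weak2 x (Tsg.T t (B x))
    rw [inner_self_eq_norm_sq_to_K] at h1
    simp only [norm_pow, RCLike.norm_ofReal, abs_norm] at h1
    simp only [ContinuousLinearMap.comp_apply]
    rw [div_mul_eq_mul_div, le_div_iff₀ hom0]
    rcases (norm_nonneg (Tsg.T t (B x))).eq_or_lt with h | h
    · rw [← h, zero_mul]; positivity
    · refine le_of_mul_le_mul_right ?_ h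
      calc _ = _ := by ring
        _ ≤ _ := h1
  rw [le_div_iff₀ hom0] at hfin
  linarith

end

section
variable {X : Type*} [NormedAddCommGroup X] [InnerProductSpace ℂ X] [CompleteSpace X]

lemma kt_est (Tsg : C0Semigroup X) (M : ℝ) (hM : ∀ t, 0 ≤ t → ‖Tsg.T t‖ ≤ M)
    (A : X →ₗ.[ℂ] X) (hgen : IsGenerator Tsg A)
    (Res : ℝ → X →L[ℂ] X)
    (hRes : ∀ s : ℝ, s ≠ 0 → IsResolvent A (Complex.I * (s : ℂ)) (Res s))
    (J : X →L[ℂ] X) (hJ : IsResolvent A 1 J) (n : ℕ) :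
    ∃ C : ℝ, 0 ≤ C ∧ ∀ t r N : ℝ, 0 < t → 0 < r → 0 ≤ N → N ≤ t / 2 →
      (∀ s : ℝ, r ≤ |s| → ‖Res s‖ ≤ N) →
      ‖Tsg.T t ∘L ((1 : X →L[ℂ] X) - J)‖ ≤ C * ((N / t) ^ (n+1) + 1 / t + r) := by
  have hM0 : 0 ≤ M := (norm_nonneg _).trans (hM 0 le_rfl)
  refine ⟨(n+2).factorial * Real.exp 1 * (M ^ 2 / 2) *
    (2 ^ (n+1) * ‖(1 : X →L[ℂ] X) - J‖ + (M ^ n + M ^ (n+1)) * ‖J‖), by positivity, ?_⟩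
  intro t r N ht hr hN hNt hb
  have h := kt_main_est Tsg M hM A hgen Res hRes J hJ n t r N ht hr hN hNt hb
  set b := ‖(1 : X →L[ℂ] X) - J‖
  set j := ‖J‖
  set D := ‖Tsg.T t ∘L ((1 : X →L[ℂ] X) - J)‖
  have hb0 : 0 ≤ b := norm_nonneg _
  have hj0 : 0 ≤ j := norm_nonneg _
  have e1 : t ^ (n+2) / (n+2).factorial * Real.exp (-1) * D
      = D * (t ^ (n+2) / ((n+2).factorial * Real.exp 1)) := by
    rw [Real.exp_neg]; field_simp
  rw [e1, ← le_div_iff₀ (by positivity)] at h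
  refine h.trans ?_
  have e2 : ((2 * N) ^ (n+1) * b + ((M * t) ^ n + (t⁻¹ + r) * (M * t) ^ (n+1)) * j) *
      (M ^ 2 * (t / 2)) / (t ^ (n+2) / ((n+2).factorial * Real.exp 1)) =
      (n+2).factorial * Real.exp 1 * (M ^ 2 / 2) *
      (2 ^ (n+1) * b * (N / t) ^ (n+1) + (M ^ n * (1 / t) + M ^ (n+1) * (1 / t + r)) * j) := by
    rw [div_pow, mul_pow, mul_pow, mul_pow]
    field_simp
    ring
  rw [e2, mul_assoc _ (2 ^ (n+1) * b + _)]
  have hq : 0 ≤ (N / t) ^ (n+1) := by positivity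
  have ht' : 0 ≤ 1 / t := by positivity
  gcongr
  set q := (N / t) ^ (n+1)
  set u := 1 / t
  have p1 : 0 ≤ 2 ^ (n+1) * b * (u + r) := by positivity
  have p2 : 0 ≤ (M ^ n * (q + r) + M ^ (n+1) * q) * j := by positivity
  nlinarith

lemma kt_res_diff (A : X →ₗ.[ℂ] X) (l1 l2 : ℂ) (R1 R2 : X →L[ℂ] X)
    (h1 : IsResolvent A l1 R1) (h2 : IsResolvent A l2 R2) (w : X) :
    R2 w = R1 w + (l1 - l2) • R2 (R1 w) := by
  have h := h2.left_inv ⟨R1 w, h1.mem_domain w⟩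
  have e := h1.eq_apply w
  have e2 : l2 • R1 w + A ⟨R1 w, h1.mem_domain w⟩ = w - (l1 - l2) • R1 w := by
    rw [sub_smul, eq_sub_iff_add_eq]
    refine Eq.trans ?_ e
    abel
  simp only at h
  rw [e2, map_sub, map_smul] at h
  exact sub_eq_iff_eq_add.1 h

lemma kt_unif (A : X →ₗ.[ℂ] X) (Res : ℝ → X →L[ℂ] X)
    (hRes : ∀ s : ℝ, s ≠ 0 → IsResolvent A (Complex.I * (s : ℂ)) (Res s))
    (η : ℝ) (hsup : ∃ C : ℝ, ∀ s : ℝ, η ≤ |s| → ‖Res s‖ ≤ C) (r : ℝ) (hr : 0 < r) :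
    ∃ N : ℝ, 0 ≤ N ∧ ∀ s : ℝ, r ≤ |s| → ‖Res s‖ ≤ N := by
  obtain ⟨C, hC⟩ := hsup
  have hcpt : IsCompact {s : ℝ | r ≤ |s| ∧ |s| ≤ η} := by
    refine (isCompact_Icc (a := -η) (b := η)).of_isClosed_subset ?_ ?_
    · exact (isClosed_le continuous_const continuous_abs).inter
        (isClosed_le continuous_abs continuous_const)
    · intro s hs
      exact abs_le.1 hs.2
  have key : ∃ N : ℝ, ∀ s ∈ {s : ℝ | r ≤ |s| ∧ |s| ≤ η}, ‖Res s‖ ≤ N := by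
    refine hcpt.induction_on (p := fun S => ∃ N : ℝ, ∀ s ∈ S, ‖Res s‖ ≤ N) ⟨0, by simp⟩ ?_ ?_ ?_
    · rintro S S' hS ⟨N, hN⟩
      exact ⟨N, fun s hs => hN s (hS hs)⟩
    · rintro S S' ⟨N, hN⟩ ⟨N', hN'⟩
      refine ⟨max N N', fun s hs => ?_⟩
      rcases hs with hs | hs
      · exact (hN s hs).trans (le_max_left _ _)
      · exact (hN' s hs).trans (le_max_right _ _)
    · intro s0 hs0
      have hs00 : s0 ≠ 0 := by
        intro h
        have := hs0.1
        rw [h, abs_zero] at this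
        linarith
      have hpos : 0 < min (1 / (2 * (‖Res s0‖ + 1))) |s0| :=
        lt_min (by positivity) (abs_pos.2 hs00)
      refine ⟨Metric.ball s0 _, mem_nhdsWithin_of_mem_nhds (Metric.ball_mem_nhds s0 hpos),
        2 * ‖Res s0‖, fun s hs => ?_⟩
      rw [Metric.mem_ball, Real.dist_eq] at hs
      have hs1 := hs.trans_le (min_le_left _ _)
      have hs2 := hs.trans_le (min_le_right _ _)
      have hsne : s ≠ 0 := by
        intro h
        rw [h, zero_sub, abs_neg] at hs2
        exact lt_irrefl _ hs2
      have h3 : |s - s0| * ‖Res s0‖ ≤ 1 / 2 := by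
        have : |s - s0| * (2 * (‖Res s0‖ + 1)) ≤ 1 := by
          rw [← le_div_iff₀ (by positivity)]; exact hs1.le
        nlinarith [abs_nonneg (s - s0)]
      have h5 : ‖Res s‖ ≤ ‖Res s0‖ + ‖Res s‖ / 2 := by
        refine ContinuousLinearMap.opNorm_le_bound _ (by positivity) fun w => ?_
        rw [kt_res_diff A _ _ _ _ (hRes s0 hs00) (hRes s hsne) w]
        refine (norm_add_le _ _).trans ?_
        have hn : ‖I * (s0:ℂ) - I * s‖ = |s - s0| := by
          rw [← mul_sub, norm_mul, norm_I, one_mul, ← ofReal_sub, norm_real, Real.norm_eq_abs,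
            abs_sub_comm]
        rw [norm_smul, hn]
        have h6 := (Res s0).le_opNorm w
        have h7 := (Res s).le_opNorm (Res s0 w)
        calc ‖Res s0 w‖ + |s - s0| * ‖Res s (Res s0 w)‖
            ≤ ‖Res s0‖ * ‖w‖ + |s - s0| * (‖Res s‖ * (‖Res s0‖ * ‖w‖)) := by
              gcongr
              exact h7.trans (by gcongr)
          _ = ‖Res s0‖ * ‖w‖ + (|s - s0| * ‖Res s0‖) * (‖Res s‖ * ‖w‖) := by ring
          _ ≤ ‖Res s0‖ * ‖w‖ + (1 / 2) * (‖Res s‖ * ‖w‖) := by gcongr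
          _ = _ := by ring
      linarith
  obtain ⟨N, hN⟩ := key
  refine ⟨max 0 (max N C), le_max_left _ _, fun s hs => ?_⟩
  rcases le_total |s| η with h | h
  · exact (hN s ⟨hs, h⟩).trans ((le_max_left _ _).trans (le_max_right _ _))
  · exact (hC s h).trans ((le_max_right _ _).trans (le_max_right _ _))

lemma kt_lower (A : X →ₗ.[ℂ] X) (h0 : ¬ ∃ R : X →L[ℂ] X, IsResolvent A 0 R)
    (l : ℂ) (R : X →L[ℂ] X) (hR : IsResolvent A l R) : 1 ≤ ‖l‖ * ‖R‖ := by
  by_contra hlt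
  push Not at hlt
  apply h0
  have hn : ‖l • R‖ < 1 := by rwa [norm_smul]
  set u := Units.oneSub (l • R) hn with hu
  have hu1 : (u : X →L[ℂ] X) = 1 - l • R := rfl
  have hmul : ∀ w, (u : X →L[ℂ] X) ((↑u⁻¹ : X →L[ℂ] X) w) = w := by
    intro w
    rw [← mul_apply_eq_comp, Units.mul_inv]; rfl
  have hmul2 : ∀ w, (↑u⁻¹ : X →L[ℂ] X) ((u : X →L[ℂ] X) w) = w := by
    intro w
    rw [← mul_apply_eq_comp, Units.inv_mul]; rfl
  have hcomm : R * (↑u⁻¹ : X →L[ℂ] X) = (↑u⁻¹ : X →L[ℂ] X) * R := by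
    have : Commute R (u : X →L[ℂ] X) := by
      rw [hu1]
      exact (Commute.one_right R).sub_right ((Commute.refl R).smul_right l)
    exact this.units_inv_right.eq
  refine ⟨R * (↑u⁻¹ : X →L[ℂ] X), fun x => hR.mem_domain _, fun x => ?_, fun x => ?_⟩
  · have h := hR.eq_apply ((↑u⁻¹ : X →L[ℂ] X) x)
    have h2 := hmul x
    rw [hu1] at h2
    simp only [sub_apply, smul_apply,
      one_apply_eq_self] at h2
    rw [zero_smul, zero_add]
    rw [← eq_sub_iff_add_eq'] at h
    exact h.trans h2
  · rw [hcomm, zero_smul, zero_add]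
    have h := hR.left_inv x
    rw [map_add, map_smul] at h
    have h2 : R (A x) = (u : X →L[ℂ] X) x := by
      rw [hu1]
      simp only [sub_apply, smul_apply,
        one_apply_eq_self]
      rw [eq_sub_iff_add_eq', h]
    rw [mul_apply_eq_comp, h2, hmul2]

end

end KTHelpers

/-- Let `(T(t))_{t≥0}` be a bounded `C₀`-semigroup on a complex Hilbert
space `X` with generator `−A`.  Assume `σ(A) ∩ iℝ = {0}` and
`sup_{|s| ≥ η} ‖(is+A)⁻¹‖ < ∞` for some `η > 0`.  Then `‖T(t)A(I+A)⁻¹‖ → 0` as `t → ∞`.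
More precisely, if `m : (0,1) → (1,∞)` is continuous and decreasing with
`m(s) → ∞` as `s → 0+` and `‖(is+A)⁻¹‖ = O(m(|s|))` as `s → 0`, and `m⁻¹` is a right
inverse of `m`, then for every `ε ∈ (0,1)`,
`‖T(t)A(I+A)⁻¹‖ = O(m⁻¹(t^{1-ε}))` as `t → ∞`.  (Here `A(I+A)⁻¹ = 1 - J`.) -/
theorem katznelson_tzafriri_singularity_at_zero_with_rates
    {X : Type*} [NormedAddCommGroup X] [InnerProductSpace ℂ X] [CompleteSpace X]
    (Tsg : C0Semigroup X) (hbdd : Tsg.Bounded)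
    (A : X →ₗ.[ℂ] X) (hgen : IsGenerator Tsg A)
    (h0 : ¬ ∃ R : X →L[ℂ] X, IsResolvent A 0 R)
    (Res : ℝ → X →L[ℂ] X)
    (hRes : ∀ s : ℝ, s ≠ 0 → IsResolvent A (Complex.I * (s : ℂ)) (Res s))
    (η : ℝ) (hη : 0 < η)
    (hsup : ∃ C : ℝ, ∀ s : ℝ, η ≤ |s| → ‖Res s‖ ≤ C)
    (J : X →L[ℂ] X) (hJ : IsResolvent A 1 J) :
    Tendsto (fun t : ℝ => ‖Tsg.T t ∘L ((1 : X →L[ℂ] X) - J)‖) atTop (nhds 0) ∧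
    ∀ m minv : ℝ → ℝ,
      ContinuousOn m (Set.Ioo 0 1) → AntitoneOn m (Set.Ioo 0 1) →
      (∀ s ∈ Set.Ioo (0 : ℝ) 1, 1 < m s) →
      Tendsto m (nhdsWithin 0 (Set.Ioi 0)) atTop →
      (∃ C > (0 : ℝ), ∃ δ ∈ Set.Ioo (0 : ℝ) 1, ∀ s : ℝ, 0 < |s| → |s| ≤ δ →
        ‖Res s‖ ≤ C * m |s|) →
      (∀ᶠ t in atTop, minv t ∈ Set.Ioo (0 : ℝ) 1 ∧ m (minv t) = t) →
      ∀ ε ∈ Set.Ioo (0 : ℝ) 1,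
        (fun t : ℝ => ‖Tsg.T t ∘L ((1 : X →L[ℂ] X) - J)‖) =O[atTop]
          fun t : ℝ => minv (t ^ (1 - ε)) := by
  obtain ⟨M, hM⟩ := hbdd
  constructor
  · obtain ⟨C, hC0, hC⟩ := kt_est Tsg M hM A hgen Res hRes J hJ 0
    rw [Metric.tendsto_nhds]
    intro e he
    set r := e / (2 * (C + 1)) with hr_def
    have hr : 0 < r := by positivity
    obtain ⟨N, hN0, hN⟩ := kt_unif A Res hRes η hsup r hr
    filter_upwards [eventually_ge_atTop (2 * N), eventually_ge_atTop ((N + 1) / r),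
      eventually_gt_atTop 0] with t h1 h2 h3
    rw [Real.dist_eq, sub_zero, abs_norm]
    have h := hC t r N h3 hr hN0 (by linarith) hN
    refine h.trans_lt ?_
    have h4 : N / t + 1 / t ≤ r := by
      rw [← add_div, div_le_iff₀ h3]
      rw [div_le_iff₀ hr] at h2
      linarith
    rw [zero_add, pow_one]
    have h5 : C * (N / t + 1 / t + r) ≤ C * (2 * r) := by
      gcongr
      linarith
    refine h5.trans_lt ?_
    have h6 : (C + 1) * (2 * r) = e := by rw [hr_def]; field_simp
    nlinarith
  · intro m minv _ hanti hm1 hmtop hbound hinv ε hε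
    obtain ⟨C, hC0, δ, hδ, hCb⟩ := hbound
    obtain ⟨hε0, hε1⟩ := hε
    obtain ⟨n, hn⟩ := exists_nat_ge ((1 - ε) / ε)
    obtain ⟨K, hK0, hK⟩ := kt_est Tsg M hM A hgen Res hRes J hJ n
    obtain ⟨N0, hN00, hN0⟩ := kt_unif A Res hRes η hsup δ hδ.1
    set D := max C N0 with hD
    have hD0 : 0 < D := hC0.trans_le (le_max_left _ _)
    have hpow : Tendsto (fun t : ℝ => t ^ (1 - ε)) atTop atTop :=
      tendsto_rpow_atTop (by linarith)
    have hpow2 : Tendsto (fun t : ℝ => t ^ ε) atTop atTop := tendsto_rpow_atTop hε0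
    refine IsBigO.of_bound (K * (D ^ (n+1) * C + C + 1)) ?_
    filter_upwards [hpow.eventually hinv, hpow.eventually_gt_atTop (m δ),
      hpow2.eventually_ge_atTop (2 * D), eventually_ge_atTop 1] with t h1 h2 h3 h4
    obtain ⟨⟨hr0, hr1⟩, hmr⟩ := h1
    set r := minv (t ^ (1 - ε)) with hr_def
    have ht : 0 < t := by linarith
    set p := t ^ (1 - ε) with hp
    have hp1 : 1 ≤ p := Real.one_le_rpow h4 (by linarith)
    have hp0 : 0 < p := by linarith
    have hrδ : r ≤ δ := by
      by_contra hlt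
      push Not at hlt
      have := hanti hδ ⟨hr0, hr1⟩ hlt.le
      rw [hmr] at this
      linarith
    have hpt : p * t ^ ε = t := by
      rw [hp, ← Real.rpow_add ht]
      simp
    have hNt : D * p ≤ t / 2 := by
      have := mul_le_mul_of_nonneg_left h3 hp0.le
      rw [hpt] at this
      linarith
    have hb : ∀ s : ℝ, r ≤ |s| → ‖Res s‖ ≤ D * p := by
      intro s hs
      rcases le_total |s| δ with h | h
      · have hs0 : 0 < |s| := hr0.trans_le hs
        refine (hCb s hs0 h).trans ?_
        have h5 : m |s| ≤ p := by
          rw [← hmr]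
          exact hanti ⟨hr0, hr1⟩ ⟨hs0, h.trans_lt hδ.2⟩ hs
        calc C * m |s| ≤ C * p := by gcongr
          _ ≤ D * p := by gcongr; exact le_max_left _ _
      · calc ‖Res s‖ ≤ N0 := hN0 s h
          _ ≤ D := le_max_right _ _
          _ ≤ D * p := le_mul_of_one_le_right hD0.le hp1
    have h := hK t r (D * p) ht hr0 (by positivity) hNt hb
    rw [norm_norm, Real.norm_of_nonneg hr0.le]
    refine h.trans ?_
    rw [mul_assoc]
    gcongr
    have hlow : p⁻¹ ≤ C * r := by
      have h5 := kt_lower A h0 _ _ (hRes r hr0.ne')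
      have h6 := hCb r (by rwa [abs_of_pos hr0]) (by rwa [abs_of_pos hr0])
      rw [abs_of_pos hr0, hmr] at h6
      rw [norm_mul, norm_I, one_mul, norm_real, Real.norm_of_nonneg hr0.le] at h5
      rw [inv_le_iff_one_le_mul₀ hp0]
      calc 1 ≤ r * ‖Res r‖ := h5
        _ ≤ r * (C * p) := by gcongr
        _ = C * r * p := by ring
    have h7 : 1 / t ≤ C * r := by
      refine le_trans ?_ hlow
      rw [one_div]
      refine inv_anti₀ hp0 ?_
      calc p ≤ t ^ (1:ℝ) := Real.rpow_le_rpow_of_exponent_le h4 (by linarith)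
        _ = t := Real.rpow_one t
    have h8 : (D * p / t) ^ (n+1) ≤ D ^ (n+1) * (C * r) := by
      have e : D * p / t = D * (t ^ ε)⁻¹ := by
        rw [div_eq_iff ht.ne']
        nth_rw 2 [← hpt]
        have : t ^ ε ≠ 0 := (Real.rpow_pos_of_pos ht ε).ne'
        field_simp
      rw [e, mul_pow]
      gcongr
      refine le_trans ?_ hlow
      rw [inv_pow]
      refine inv_anti₀ hp0 ?_
      rw [← Real.rpow_mul_natCast ht.le, hp]
      refine Real.rpow_le_rpow_of_exponent_le h4 ?_
      rw [div_le_iff₀ hε0] at hn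
      push_cast
      nlinarith
    nlinarith
end

section
/- Let (T(t))_{t≥0} be a bounded C₀-semigroup on a complex Hilbert space X with generator −A, and let B : dom(A) → X be a linear operator which is bounded for the graph norm on dom(A) and satisfies T(t)Bx = BT(t)x for all t ≥ 0 and x ∈ dom(A). Assume that sup { ‖B(λ+A)^{-1}‖ : λ ∈ ℂ₊ } < ∞, where ℂ₊ = {λ ∈ ℂ : Re λ > 0}. Then for each t > 0 the operator T(t)B extends to a bounded linear operator on X (also denoted T(t)B), and ‖T(t)B‖ = O(t^{-1}) as t → ∞. -/
open Filter MeasureTheory Set Complex Asymptotics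

open scoped FourierTransform SchwartzMap ContDiff in
theorem planch {X : Type*} [NormedAddCommGroup X] [InnerProductSpace ℂ X] [CompleteSpace X]
    (f : ℝ → X) (h1 : Integrable f) (h2 : MemLp f 2) :
    MemLp (𝓕 f) 2 ∧ ∫ s, ‖𝓕 f s‖ ^ 2 = ∫ s, ‖f s‖ ^ 2 := by
  set F : Lp X 2 (volume : Measure ℝ) := h2.toLp f with hF
  have hcont : Continuous (𝓕 f) := by
    have := VectorFourier.fourierIntegral_continuous (μ := volume) (f := f)
      Real.continuous_fourierChar (L := innerₗ ℝ) (by exact continuous_inner) h1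
    exact this
  have hae : ∀ᵐ x, (𝓕 F : Lp X 2 (volume : Measure ℝ)) x = 𝓕 f x := by
    apply ae_eq_of_integral_contDiff_smul_eq
    · exact (Lp.memLp _).locallyIntegrable (by norm_num)
    · exact hcont.locallyIntegrable
    · intro g g_smooth g_cpt
      have hg₁ : HasCompactSupport (Complex.ofRealCLM ∘ g) := g_cpt.comp_left rfl
      have hg₂ : ContDiff ℝ ∞ (Complex.ofRealCLM ∘ g) := by fun_prop
      set G : 𝓢(ℝ, ℂ) := hg₁.toSchwartzMap hg₂ with hG
      have e1 : ∀ x, G x = (g x : ℂ) := fun x => rfl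
      have e2 : (F : 𝓢'(ℝ, X)) (𝓕 G) = ((𝓕 F : Lp X 2 (volume : Measure ℝ)) : 𝓢'(ℝ, X)) G := by
        rw [← Lp.fourier_toTemperedDistribution_eq]; rfl
      rw [Lp.toTemperedDistribution_apply, Lp.toTemperedDistribution_apply] at e2
      simp only [e1] at e2
      have e3 : ∫ x, (𝓕 G) x • F x = ∫ x, (𝓕 (G : ℝ → ℂ)) x • f x := by
        apply integral_congr_ae
        filter_upwards [h2.coeFn_toLp] with x hx
        rw [hF, hx, SchwartzMap.fourier_coe]
      have e4 := VectorFourier.integral_fourierIntegral_smul_eq_flip (μ := volume) (ν := volume)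
        (f := (G : ℝ → ℂ)) (g := f)
        Real.continuous_fourierChar (L := innerₗ ℝ) (by exact continuous_inner) G.integrable h1
      rw [flip_innerₗ] at e4
      have e5 : ∫ x, (𝓕 (G : ℝ → ℂ)) x • f x = ∫ x, (G x) • 𝓕 f x := e4
      simp only [e1] at e5
      have e6 := e2.symm.trans (e3.trans e5)
      simpa using e6
  have hm : MemLp (𝓕 f) 2 := (memLp_congr_ae hae).1 (Lp.memLp _)
  refine ⟨hm, ?_⟩
  have n1 := Lp.norm_fourier_eq F
  have key : ∀ G : Lp X 2 (volume : Measure ℝ), ∫ s, ‖G s‖ ^ 2 = ‖G‖ ^ 2 := by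
    intro G
    have := L2.inner_def (𝕜 := ℂ) G G
    have h := inner_self_eq_norm_sq_to_K (𝕜 := ℂ) G
    rw [this] at h
    simp only [inner_self_eq_norm_sq_to_K] at h
    have h' : ((∫ s, ‖G s‖ ^ 2 : ℝ) : ℂ) = ((‖G‖ ^ 2 : ℝ) : ℂ) := by
      rw [← integral_complex_ofReal]; push_cast; exact h
    exact_mod_cast h'
  calc ∫ s, ‖𝓕 f s‖ ^ 2 = ∫ s, ‖(𝓕 F : Lp X 2 (volume : Measure ℝ)) s‖ ^ 2 := by
        apply integral_congr_ae
        filter_upwards [hae] with x hx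
        rw [hx]
    _ = ∫ s, ‖F s‖ ^ 2 := by rw [key, key, n1]
    _ = _ := by
        apply integral_congr_ae
        filter_upwards [h2.coeFn_toLp] with x hx
        rw [hF, hx]

/-- Exponentially bounded continuous functions are integrable on the half line. -/
theorem tr_expInt {X : Type*} [NormedAddCommGroup X] [NormedSpace ℂ X] {f : ℝ → X}
    (hf : ContinuousOn f (Ioi 0)) {M a : ℝ} (ha : 0 < a)
    (hb : ∀ s, 0 < s → ‖f s‖ ≤ M * Real.exp (-a * s)) : IntegrableOn f (Ioi 0) := by
  have h1 : IntegrableOn (fun s => M * Real.exp (-a * s)) (Ioi 0) :=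
    (integrableOn_exp_mul_Ioi (by linarith) 0).const_mul M
  refine Integrable.mono' h1 (hf.aestronglyMeasurable measurableSet_Ioi) ?_
  exact (ae_restrict_iff' measurableSet_Ioi).2 (Eventually.of_forall fun s hs => hb s hs)

/-- The integrand of the Laplace transform. -/
noncomputable def trPhi {X : Type*} [NormedAddCommGroup X] [NormedSpace ℂ X] (Tsg : C0Semigroup X)
    (lam : ℂ) (w : X) (s : ℝ) : X := cexp (-lam * s) • Tsg.T s w

section
variable {X : Type*} [NormedAddCommGroup X] [NormedSpace ℂ X]
  (Tsg : C0Semigroup X)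

theorem trPhi_cont (lam : ℂ) (w : X) : ContinuousOn (trPhi Tsg lam w) (Ici 0) := by
  unfold trPhi
  exact ContinuousOn.smul (by fun_prop) (Tsg.strong_continuity w)

theorem trPhi_norm {K : ℝ} (hK : ∀ t : ℝ, 0 ≤ t → ‖Tsg.T t‖ ≤ K) (lam : ℂ) (w : X) (s : ℝ)
    (hs : 0 ≤ s) : ‖trPhi Tsg lam w s‖ ≤ K * ‖w‖ * Real.exp (-lam.re * s) := by
  unfold trPhi
  rw [norm_smul, Complex.norm_exp]
  have : (-lam * (s : ℂ)).re = -lam.re * s := by simp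
  rw [this, mul_comm]
  gcongr
  exact (Tsg.T s).le_of_opNorm_le (hK s hs) w

theorem trPhi_int {K : ℝ} (hK : ∀ t : ℝ, 0 ≤ t → ‖Tsg.T t‖ ≤ K) (lam : ℂ) (hl : 0 < lam.re)
    (w : X) : IntegrableOn (trPhi Tsg lam w) (Ioi 0) :=
  tr_expInt ((trPhi_cont Tsg lam w).mono Ioi_subset_Ici_self) hl
    (fun s hs => trPhi_norm Tsg hK lam w s hs.le)

theorem tr_linexp {d s : ℝ} (hd : 0 < d) :
    s * Real.exp (-d * s) ≤ 2 / d * Real.exp (-(d / 2) * s) := by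
  have h1 : d / 2 * s ≤ Real.exp (d / 2 * s) := by
    have := Real.add_one_le_exp (d / 2 * s); linarith
  have h2 : s ≤ 2 / d * Real.exp (d / 2 * s) := by
    calc s = 2 / d * (d / 2 * s) := by field_simp
      _ ≤ _ := by gcongr
  calc s * Real.exp (-d * s) ≤ 2 / d * Real.exp (d / 2 * s) * Real.exp (-d * s) := by gcongr
    _ = _ := by rw [mul_assoc, ← Real.exp_add]; congr 2; ring

theorem trPhi_snorm {K : ℝ} (hK : ∀ t : ℝ, 0 ≤ t → ‖Tsg.T t‖ ≤ K) (lam : ℂ) (hl : 0 < lam.re)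
    (w : X) (s : ℝ) (hs : 0 ≤ s) :
    ‖(s : ℂ) • trPhi Tsg lam w s‖ ≤ K * ‖w‖ * (2 / lam.re) * Real.exp (-(lam.re / 2) * s) := by
  have hK0 : 0 ≤ K := (norm_nonneg _).trans (hK 0 le_rfl)
  rw [norm_smul, Complex.norm_real, Real.norm_of_nonneg hs]
  calc s * ‖trPhi Tsg lam w s‖ ≤ s * (K * ‖w‖ * Real.exp (-lam.re * s)) := by
        gcongr; exact trPhi_norm Tsg hK lam w s hs
    _ = K * ‖w‖ * (s * Real.exp (-lam.re * s)) := by ring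
    _ ≤ K * ‖w‖ * (2 / lam.re * Real.exp (-(lam.re / 2) * s)) := by
        exact mul_le_mul_of_nonneg_left (tr_linexp hl) (by positivity)
    _ = _ := by ring

theorem trPhi_sint {K : ℝ} (hK : ∀ t : ℝ, 0 ≤ t → ‖Tsg.T t‖ ≤ K) (lam : ℂ) (hl : 0 < lam.re)
    (w : X) : IntegrableOn (fun s : ℝ => (s : ℂ) • trPhi Tsg lam w s) (Ioi 0) := by
  refine tr_expInt ?_ (half_pos hl) (fun s hs => trPhi_snorm Tsg hK lam hl w s hs.le)
  exact ContinuousOn.smul (by fun_prop) ((trPhi_cont Tsg lam w).mono Ioi_subset_Ici_self)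

/-- The resolvent as a Laplace transform. -/
noncomputable def trR {K : ℝ} (hK : ∀ t : ℝ, 0 ≤ t → ‖Tsg.T t‖ ≤ K) (lam : ℂ) (hl : 0 < lam.re) :
    X →L[ℂ] X :=
  LinearMap.mkContinuous
    { toFun := fun w => ∫ s in Ioi (0 : ℝ), trPhi Tsg lam w s
      map_add' := by
        intro x y
        rw [← integral_add (trPhi_int Tsg hK lam hl x) (trPhi_int Tsg hK lam hl y)]
        simp [trPhi]
      map_smul' := by
        intro c x
        rw [RingHom.id_apply, ← integral_smul]
        congr 1
        ext s
        simp [trPhi, smul_comm c] }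
    (∫ s in Ioi (0 : ℝ), K * Real.exp (-lam.re * s))
    (by
      intro w
      rw [← integral_mul_const]
      refine norm_integral_le_of_norm_le ?_ ?_
      · exact ((integrableOn_exp_mul_Ioi (by linarith) 0).const_mul K).mul_const _
      · refine (ae_restrict_iff' measurableSet_Ioi).2 (Eventually.of_forall fun s hs => ?_)
        refine (trPhi_norm Tsg hK lam w s (le_of_lt hs)).trans (le_of_eq (by ring)))

theorem trR_apply {K : ℝ} (hK : ∀ t : ℝ, 0 ≤ t → ‖Tsg.T t‖ ≤ K) (lam : ℂ) (hl : 0 < lam.re)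
    (w : X) : trR Tsg hK lam hl w = ∫ s in Ioi (0 : ℝ), trPhi Tsg lam w s := rfl

theorem tr_TR [CompleteSpace X] {K : ℝ} (hK : ∀ t : ℝ, 0 ≤ t → ‖Tsg.T t‖ ≤ K) (lam : ℂ)
    (hl : 0 < lam.re) (w : X) (h : ℝ) (hh : 0 ≤ h) :
    Tsg.T h (trR Tsg hK lam hl w) = trR Tsg hK lam hl (Tsg.T h w) := by
  rw [trR_apply, trR_apply, ← ContinuousLinearMap.integral_comp_comm _ (trPhi_int Tsg hK lam hl w)]
  refine setIntegral_congr_fun measurableSet_Ioi fun s hs => ?_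
  have hs' : 0 ≤ s := le_of_lt hs
  have h1 := Tsg.map_add h s hh hs'
  have h2 := Tsg.map_add s h hs' hh
  rw [add_comm, h1] at h2
  simp only [trPhi, map_smul]
  congr 1
  exact DFunLike.congr_fun h2 w

theorem tr_shift [CompleteSpace X] {K : ℝ} (hK : ∀ t : ℝ, 0 ≤ t → ‖Tsg.T t‖ ≤ K) (lam : ℂ)
    (hl : 0 < lam.re) (w : X) (h : ℝ) (hh : 0 ≤ h) :
    cexp (-lam * h) • Tsg.T h (trR Tsg hK lam hl w) =
      trR Tsg hK lam hl w - ∫ s in (0 : ℝ)..h, trPhi Tsg lam w s := by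
  have h1 : ∫ s in (0 : ℝ)..h, trPhi Tsg lam w s =
      trR Tsg hK lam hl w - ∫ s in Ioi h, trPhi Tsg lam w s :=
    (intervalIntegral.integral_Ioi_sub_Ioi (trPhi_int Tsg hK lam hl w) hh).symm
  rw [h1, sub_sub_cancel, trR_apply,
    ← ContinuousLinearMap.integral_comp_comm _ (trPhi_int Tsg hK lam hl w), ← integral_smul]
  have h2 : ∫ s in Ioi h, trPhi Tsg lam w s = ∫ s in Ioi (0 : ℝ), trPhi Tsg lam w (s + h) := by
    have := (measurePreserving_add_right (volume : Measure ℝ) h).setIntegral_preimage_emb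
      (measurableEmbedding_addRight h) (trPhi Tsg lam w) (Ioi h)
    rw [← this]
    congr 2
    ext s; simp
  rw [h2]
  refine setIntegral_congr_fun measurableSet_Ioi fun s hs => ?_
  simp only [trPhi, map_smul, smul_smul, ← Complex.exp_add]
  rw [add_comm s h, Tsg.map_add h s hh (le_of_lt hs)]
  congr 2
  push_cast; ring

theorem trPhi_zero (lam : ℂ) (w : X) : trPhi Tsg lam w 0 = w := by
  simp [trPhi, Tsg.map_zero]

theorem tr_intDeriv [CompleteSpace X] {K : ℝ} (hK : ∀ t : ℝ, 0 ≤ t → ‖Tsg.T t‖ ≤ K) (lam : ℂ)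
    (hl : 0 < lam.re) (w : X) (h : ℝ) (hh : 0 ≤ h) :
    HasDerivWithinAt (fun u : ℝ => ∫ s in (0 : ℝ)..u, trPhi Tsg lam w s) (trPhi Tsg lam w h)
      (Ici h) h := by
  have hi : IntervalIntegrable (trPhi Tsg lam w) volume 0 h := by
    rw [intervalIntegrable_iff_integrableOn_Ioc_of_le hh]
    exact (trPhi_int Tsg hK lam hl w).mono_set Ioc_subset_Ioi_self
  have hc : ContinuousOn (trPhi Tsg lam w) (Ici 0) := trPhi_cont Tsg lam w
  have hc' : ContinuousWithinAt (trPhi Tsg lam w) (Ioi h) h :=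
    (hc h hh).mono fun y hy => le_trans hh (le_of_lt hy)
  refine intervalIntegral.integral_hasDerivWithinAt_right hi (t := Ioi h) ?_ hc'
  refine ⟨Ioi h, self_mem_nhdsWithin, ?_⟩
  exact (hc.mono fun y hy => le_trans hh (le_of_lt hy)).aestronglyMeasurable measurableSet_Ioi

theorem tr_limit [CompleteSpace X] {K : ℝ} (hK : ∀ t : ℝ, 0 ≤ t → ‖Tsg.T t‖ ≤ K) (lam : ℂ)
    (hl : 0 < lam.re) (w : X) :
    Tendsto (fun t : ℝ => (t : ℂ)⁻¹ • (Tsg.T t (trR Tsg hK lam hl w) - trR Tsg hK lam hl w))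
      (nhdsWithin 0 (Ioi 0)) (nhds (lam • trR Tsg hK lam hl w - w)) := by
  have d1 := tr_intDeriv Tsg hK lam hl w 0 le_rfl
  rw [trPhi_zero] at d1
  have d2 : HasDerivWithinAt (fun u : ℝ => cexp (lam * u)) lam (Ici 0) 0 := by
    have : HasDerivAt (fun u : ℝ => cexp (lam * u)) (cexp (lam * (0 : ℝ)) * (lam * 1)) 0 := by
      have h0 : HasDerivAt (fun u : ℝ => (u : ℂ)) 1 0 := Complex.ofRealCLM.hasDerivAt
      exact (h0.const_mul lam).cexp
    simpa using this.hasDerivWithinAt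
  have d3 := d2.smul ((hasDerivWithinAt_const (0 : ℝ) (Ici 0) (trR Tsg hK lam hl w)).sub d1)
  have d4 := (hasDerivWithinAt_iff_tendsto_slope' (by simp)).1 (d3.mono Ioi_subset_Ici_self)
  have e : lam • trR Tsg hK lam hl w - w = cexp (lam * (0 : ℝ)) • (0 - w) +
      lam • (trR Tsg hK lam hl w - ∫ s in (0 : ℝ)..0, trPhi Tsg lam w s) := by
    simp; abel
  rw [e]
  refine d4.congr' ?_
  filter_upwards [self_mem_nhdsWithin] with t ht
  have ht' : (0 : ℝ) ≤ t := le_of_lt ht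
  rw [slope_def_module]
  simp only [Pi.smul_apply', Pi.sub_apply, sub_zero, ← Complex.coe_smul, Complex.ofReal_inv]
  congr 1
  rw [← tr_shift Tsg hK lam hl w t ht', smul_smul, ← Complex.exp_add]
  simp

theorem tr_isResolvent [CompleteSpace X] {K : ℝ} (hK : ∀ t : ℝ, 0 ≤ t → ‖Tsg.T t‖ ≤ K) (lam : ℂ)
    (hl : 0 < lam.re) (A : X →ₗ.[ℂ] X) (hgen : IsGenerator Tsg A) :
    IsResolvent A lam (trR Tsg hK lam hl) := by
  have h1 : ∀ w, ∃ hx : trR Tsg hK lam hl w ∈ A.domain,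
      A ⟨trR Tsg hK lam hl w, hx⟩ = w - lam • trR Tsg hK lam hl w := by
    intro w
    rw [hgen, neg_sub]
    exact tr_limit Tsg hK lam hl w
  refine ⟨fun x => (h1 x).1, fun x => ?_, fun x => ?_⟩
  · rw [(h1 x).2]; abel
  · have l1 := (hgen (x : X) (A x)).1 ⟨x.2, rfl⟩
    have l2 := ((trR Tsg hK lam hl).continuous.tendsto _).comp l1
    have l3 := tr_limit Tsg hK lam hl (x : X)
    have l4 : Tendsto (fun t : ℝ => (t : ℂ)⁻¹ •
        (Tsg.T t (trR Tsg hK lam hl x) - trR Tsg hK lam hl x))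
        (nhdsWithin 0 (Ioi 0)) (nhds (trR Tsg hK lam hl (-A x))) := by
      refine l2.congr' ?_
      filter_upwards [self_mem_nhdsWithin] with t ht
      simp only [Function.comp, map_smul, map_sub]
      rw [tr_TR Tsg hK lam hl x t (le_of_lt ht)]
    have l5 := tendsto_nhds_unique l4 l3
    rw [map_neg] at l5
    rw [map_add, map_smul, ← neg_neg (trR Tsg hK lam hl (A x)), l5]
    abel

theorem tr_RR [CompleteSpace X] {K : ℝ} (hK : ∀ t : ℝ, 0 ≤ t → ‖Tsg.T t‖ ≤ K) (lam : ℂ)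
    (hl : 0 < lam.re) (w : X) :
    ∫ s in Ioi (0 : ℝ), (s : ℂ) • trPhi Tsg lam w s =
      trR Tsg hK lam hl (trR Tsg hK lam hl w) := by
  set R := trR Tsg hK lam hl
  have hd : ∀ s ∈ Ioi (0 : ℝ), HasDerivAt (trPhi Tsg lam (R w)) (-trPhi Tsg lam w s) s := by
    intro s hs
    have hs' : (0 : ℝ) < s := hs
    have hi : IntervalIntegrable (trPhi Tsg lam w) volume 0 s := by
      rw [intervalIntegrable_iff_integrableOn_Ioc_of_le hs'.le]
      exact (trPhi_int Tsg hK lam hl w).mono_set Ioc_subset_Ioi_self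
    have hc : ContinuousOn (trPhi Tsg lam w) (Ioi 0) :=
      (trPhi_cont Tsg lam w).mono Ioi_subset_Ici_self
    have d := intervalIntegral.integral_hasDerivAt_right hi
      (hc.stronglyMeasurableAtFilter isOpen_Ioi s hs) (hc.continuousAt (Ioi_mem_nhds hs'))
    have d2 := (hasDerivAt_const s (R w)).sub d
    rw [zero_sub] at d2
    refine d2.congr_of_eventuallyEq ?_
    filter_upwards [Ioi_mem_nhds hs'] with u hu
    exact tr_shift Tsg hK lam hl w u (le_of_lt hu)
  have hd2 : ∀ s ∈ Ioi (0 : ℝ), HasDerivAt (fun s : ℝ => (s : ℂ) • trPhi Tsg lam (R w) s)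
      (trPhi Tsg lam (R w) s - (s : ℂ) • trPhi Tsg lam w s) s := by
    intro s hs
    have h0 : HasDerivAt (fun u : ℝ => (u : ℂ)) 1 s := Complex.ofRealCLM.hasDerivAt
    have := h0.smul (hd s hs)
    refine this.congr_deriv ?_
    rw [one_smul, smul_neg]; abel
  have i1 := trPhi_int Tsg hK lam hl (R w)
  have i2 := trPhi_sint Tsg hK lam hl w
  have hlim : Tendsto (fun s : ℝ => (s : ℂ) • trPhi Tsg lam (R w) s) atTop (nhds 0) := by
    have hz : Tendsto (fun s : ℝ => K * ‖R w‖ * (2 / lam.re) * Real.exp (-(lam.re / 2) * s))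
        atTop (nhds 0) := by
      have : Tendsto (fun s : ℝ => Real.exp (-(lam.re / 2) * s)) atTop (nhds 0) :=
        Real.tendsto_exp_atBot.comp
          (tendsto_id.const_mul_atTop_of_neg (by linarith : -(lam.re / 2) < 0))
      simpa using this.const_mul (K * ‖R w‖ * (2 / lam.re))
    refine squeeze_zero_norm' ?_ hz
    filter_upwards [eventually_ge_atTop 0] with s hs
    exact trPhi_snorm Tsg hK lam hl (R w) s hs
  have hcont : ContinuousWithinAt (fun s : ℝ => (s : ℂ) • trPhi Tsg lam (R w) s) (Ici 0) 0 :=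
    ContinuousWithinAt.smul (by fun_prop) (trPhi_cont Tsg lam (R w) 0 self_mem_Ici)
  have := integral_Ioi_of_hasDerivAt_of_tendsto hcont hd2 (i1.sub i2) hlim
  rw [integral_sub i1 i2] at this
  simp only [Complex.ofReal_zero, zero_smul, sub_zero] at this
  exact (sub_eq_zero.1 this).symm

end

section
variable {X : Type*} [NormedAddCommGroup X] [InnerProductSpace ℂ X] [CompleteSpace X]
  (Tsg : C0Semigroup X)

/-- `R² B x = B R (R x)` for `x` in the domain. -/
theorem tr_BRR {K : ℝ} (hK : ∀ t : ℝ, 0 ≤ t → ‖Tsg.T t‖ ≤ K)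
    (A : X →ₗ.[ℂ] X) (hgen : IsGenerator Tsg A)
    (B : A.domain →ₗ[ℂ] X)
    (hBcomm : ∀ t : ℝ, 0 ≤ t → ∀ x : A.domain,
      ∃ hx : Tsg.T t (x : X) ∈ A.domain, Tsg.T t (B x) = B ⟨Tsg.T t (x : X), hx⟩)
    {C : ℝ} (hC : ∀ lam : ℂ, 0 < lam.re →
      ∀ (R : X →L[ℂ] X) (hR : IsResolvent A lam R) (x : X),
        ‖B ⟨R x, hR.mem_domain x⟩‖ ≤ C * ‖x‖) (lam : ℂ) (hl : 0 < lam.re) (x : A.domain) :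
    ‖trR Tsg hK lam hl (trR Tsg hK lam hl (B x))‖ ≤ C * ‖trR Tsg hK lam hl x‖ := by
  have hR := tr_isResolvent Tsg hK lam hl A hgen
  set R := trR Tsg hK lam hl with hRdef
  let S : X →L[ℂ] X := LinearMap.mkContinuous
    { toFun := fun z => B ⟨R z, hR.mem_domain z⟩
      map_add' := by
        intro a b
        rw [← map_add]; congr 1; ext; simp
      map_smul' := by
        intro a b
        rw [RingHom.id_apply, ← map_smul]; congr 1; ext; simp } C (hC lam hl R hR)
  have hS : ∀ z, S z = B ⟨R z, hR.mem_domain z⟩ := fun z => rfl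
  have hST : ∀ s : ℝ, 0 ≤ s → ∀ z, Tsg.T s (S z) = S (Tsg.T s z) := by
    intro s hs z
    obtain ⟨h1, h2⟩ := hBcomm s hs ⟨R z, hR.mem_domain z⟩
    rw [hS, hS, h2]
    congr 2
    exact tr_TR Tsg hK lam hl z s hs
  have hRS : ∀ z, R (S z) = S (R z) := by
    intro z
    rw [hRdef, trR_apply, trR_apply,
      ← ContinuousLinearMap.integral_comp_comm _ (trPhi_int Tsg hK lam hl z)]
    refine setIntegral_congr_fun measurableSet_Ioi fun s hs => ?_
    simp only [trPhi, map_smul]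
    rw [hST s (le_of_lt hs)]
  have hz := hR.left_inv x
  set z := lam • (x : X) + A x
  have hBx : B x = S z := by
    rw [hS]; congr 1; ext; exact hz.symm
  rw [hBx, hRS, hRS, hz]
  exact hC lam hl R hR (R x)

theorem tr_memLp {f : ℝ → X}
    (hf : ContinuousOn f (Ioi 0)) {M a : ℝ} (ha : 0 < a)
    (hb : ∀ s, 0 < s → ‖f s‖ ≤ M * Real.exp (-a * s)) : MemLp ((Ioi 0).indicator f) 2 := by
  rw [memLp_indicator_iff_restrict measurableSet_Ioi]
  rw [memLp_two_iff_integrable_sq_norm (hf.aestronglyMeasurable measurableSet_Ioi)]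
  have h1 : IntegrableOn (fun s => M ^ 2 * Real.exp (-(2 * a) * s)) (Ioi 0) :=
    (integrableOn_exp_mul_Ioi (by linarith) 0).const_mul _
  refine Integrable.mono' h1 ((hf.norm.pow 2).aestronglyMeasurable measurableSet_Ioi) ?_
  refine (ae_restrict_iff' measurableSet_Ioi).2 (Eventually.of_forall fun s hs => ?_)
  rw [Real.norm_of_nonneg (by positivity)]
  calc ‖f s‖ ^ 2 ≤ (M * Real.exp (-a * s)) ^ 2 := by gcongr; exact hb s hs
    _ = _ := by rw [mul_pow, ← Real.exp_nat_mul]; congr 2; push_cast; ring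

open scoped FourierTransform in
theorem tr_fourier (f : ℝ → X) (d xi : ℝ) (w : X) (p : ℝ → ℂ)
    (hf : ∀ s, f s = (Ioi (0 : ℝ)).indicator (fun s => p s • trPhi Tsg d w s) s) :
    𝓕 f xi = ∫ s in Ioi (0 : ℝ), p s • trPhi Tsg (d + 2 * Real.pi * xi * I) w s := by
  rw [Real.fourier_real_eq_integral_exp_smul, ← integral_indicator measurableSet_Ioi]
  congr 1
  ext s
  rw [hf]
  by_cases hs : s ∈ Ioi (0 : ℝ)
  · rw [indicator_of_mem hs, indicator_of_mem hs, smul_comm]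
    congr 1
    rw [trPhi, trPhi, smul_smul, ← Complex.exp_add]
    congr 2
    push_cast; ring
  · rw [indicator_of_notMem hs, indicator_of_notMem hs, smul_zero]

open scoped FourierTransform in
theorem tr_main {K : ℝ} (hK : ∀ t : ℝ, 0 ≤ t → ‖Tsg.T t‖ ≤ K)
    (A : X →ₗ.[ℂ] X) (hgen : IsGenerator Tsg A)
    (B : A.domain →ₗ[ℂ] X)
    (hBcomm : ∀ t : ℝ, 0 ≤ t → ∀ x : A.domain,
      ∃ hx : Tsg.T t (x : X) ∈ A.domain, Tsg.T t (B x) = B ⟨Tsg.T t (x : X), hx⟩)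
    {C : ℝ} (hC0 : 0 ≤ C) (hC : ∀ lam : ℂ, 0 < lam.re →
      ∀ (R : X →L[ℂ] X) (hR : IsResolvent A lam R) (x : X),
        ‖B ⟨R x, hR.mem_domain x⟩‖ ≤ C * ‖x‖) (t : ℝ) (ht : 0 < t) (x : A.domain) :
    ‖Tsg.T t (B x)‖ ≤ 2 * Real.exp 1 * C * K ^ 2 * t⁻¹ * ‖(x : X)‖ := by
  have hK0 : 0 ≤ K := (norm_nonneg _).trans (hK 0 le_rfl)
  set d : ℝ := t⁻¹ with hd
  have hd0 : 0 < d := by positivity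
  have hdre : (0 : ℝ) < ((d : ℂ)).re := by simpa using hd0
  set u : ℝ → X := (Ioi (0 : ℝ)).indicator (trPhi Tsg d x) with hu
  set g : ℝ → X := (Ioi (0 : ℝ)).indicator (fun s => (s : ℂ) • trPhi Tsg d (B x) s) with hg
  have cu : ContinuousOn (trPhi Tsg d (x : X)) (Ioi 0) :=
    (trPhi_cont Tsg d (x : X)).mono Ioi_subset_Ici_self
  have cg : ContinuousOn (fun s : ℝ => (s : ℂ) • trPhi Tsg d (B x) s) (Ioi 0) :=
    ContinuousOn.smul (by fun_prop) ((trPhi_cont Tsg d (B x)).mono Ioi_subset_Ici_self)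
  have u1 : Integrable u := (integrable_indicator_iff measurableSet_Ioi).2 (trPhi_int Tsg hK d hdre x)
  have g1 : Integrable g := (integrable_indicator_iff measurableSet_Ioi).2
    (trPhi_sint Tsg hK d hdre (B x))
  have u2 : MemLp u 2 := tr_memLp cu hdre (fun s hs => trPhi_norm Tsg hK d x s hs.le)
  have g2 : MemLp g 2 := tr_memLp cg (half_pos hdre)
    (fun s hs => trPhi_snorm Tsg hK d hdre (B x) s hs.le)
  obtain ⟨mu, pu⟩ := planch u u1 u2
  obtain ⟨mg, pg⟩ := planch g g1 g2
  have hF : ∀ xi : ℝ, ‖𝓕 g xi‖ ^ 2 ≤ C ^ 2 * ‖𝓕 u xi‖ ^ 2 := by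
    intro xi
    have hl : 0 < ((d : ℂ) + 2 * Real.pi * xi * I).re := by simpa using hd0
    have e1 : 𝓕 u xi = trR Tsg hK _ hl (x : X) := by
      rw [tr_fourier Tsg u d xi x (fun _ => 1) (fun s => by simp [hu]), trR_apply]
      simp
    have e2 : 𝓕 g xi = trR Tsg hK _ hl (trR Tsg hK _ hl (B x)) := by
      rw [tr_fourier Tsg g d xi (B x) (fun s => (s : ℂ)) (fun s => by rw [hg]),
        tr_RR Tsg hK _ hl]
    rw [e1, e2, ← mul_pow]
    gcongr
    exact tr_BRR Tsg hK A hgen B hBcomm hC _ hl x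
  have iu : Integrable (fun s => ‖𝓕 u s‖ ^ 2) := mu.integrable_norm_pow (by norm_num)
  have ig : Integrable (fun s => ‖𝓕 g s‖ ^ 2) := mg.integrable_norm_pow (by norm_num)
  have iu' : Integrable (fun s => ‖u s‖ ^ 2) := u2.integrable_norm_pow (by norm_num)
  have ig' : Integrable (fun s => ‖g s‖ ^ 2) := g2.integrable_norm_pow (by norm_num)
  have main1 : ∫ s, ‖g s‖ ^ 2 ≤ C ^ 2 * ∫ s, ‖u s‖ ^ 2 := by
    rw [← pu, ← pg, ← integral_const_mul]
    exact integral_mono ig (iu.const_mul _) hF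
  have up : ∫ s, ‖u s‖ ^ 2 ≤ (K * ‖(x : X)‖) ^ 2 * (t / 2) := by
    have h0 : (fun s => ‖u s‖ ^ 2) = (Ioi (0 : ℝ)).indicator (fun s => ‖trPhi Tsg d (x : X) s‖ ^ 2) := by
      ext s
      by_cases hs : s ∈ Ioi (0 : ℝ) <;> simp [hu, hs]
    have hi : ∫ s in Ioi (0 : ℝ), (K * ‖(x : X)‖) ^ 2 * Real.exp (-(2 * d) * s) =
        (K * ‖(x : X)‖) ^ 2 * (t / 2) := by
      rw [integral_const_mul, integral_exp_mul_Ioi (by linarith)]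
      congr 1
      simp [hd]
      ring
    rw [← hi, h0, integral_indicator measurableSet_Ioi]
    refine setIntegral_mono_on ?_ ?_ measurableSet_Ioi ?_
    · rw [h0] at iu'
      exact (integrable_indicator_iff measurableSet_Ioi).1 iu'
    · exact (integrableOn_exp_mul_Ioi (by linarith) 0).const_mul _
    · intro s hs
      calc ‖trPhi Tsg d (x : X) s‖ ^ 2 ≤ (K * ‖(x : X)‖ * Real.exp (-d * s)) ^ 2 := by
            gcongr
            simpa using trPhi_norm Tsg hK d x s (le_of_lt hs)
        _ = _ := by rw [mul_pow, ← Real.exp_nat_mul]; congr 2; push_cast; ring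
  set c : ℝ := (t / 2) * Real.exp (-1) * ‖Tsg.T t (B x)‖ with hc
  have low : c ^ 2 * (t / 2) ≤ K ^ 2 * ∫ s, ‖g s‖ ^ 2 := by
    have h1 : ∫ s in Ioc (t / 2) t, c ^ 2 = c ^ 2 * (t / 2) := by
      simp [ht.le]
      ring
    rw [← h1, ← integral_const_mul]
    calc ∫ s in Ioc (t / 2) t, c ^ 2 ≤ ∫ s in Ioc (t / 2) t, K ^ 2 * ‖g s‖ ^ 2 := by
          refine setIntegral_mono_on ?_ (ig'.const_mul _).integrableOn measurableSet_Ioc ?_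
          · simp
          · intro s hs
            have hs0 : 0 < s := by have := hs.1; linarith
            rw [← mul_pow]
            gcongr
            have e : g s = (s : ℂ) • trPhi Tsg d (B x) s := indicator_of_mem (by exact hs0) _
            rw [e, trPhi, norm_smul, norm_smul, Complex.norm_real, Real.norm_of_nonneg hs0.le,
              Complex.norm_exp]
            have e2 : (-(d : ℂ) * (s : ℂ)).re = -(d * s) := by simp
            rw [e2]
            have e3 : Tsg.T t (B x) = Tsg.T (t - s) (Tsg.T s (B x)) := by
              have := Tsg.map_add (t - s) s (by linarith [hs.2]) hs0.le
              rw [sub_add_cancel] at this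
              rw [this]; rfl
            have e4 : ‖Tsg.T t (B x)‖ ≤ K * ‖Tsg.T s (B x)‖ := by
              rw [e3]
              exact (Tsg.T (t - s)).le_of_opNorm_le (hK _ (by linarith [hs.2])) _
            have e5 : d * s ≤ 1 := by
              rw [hd, inv_mul_le_iff₀ ht]; linarith [hs.2]
            calc c ≤ s * Real.exp (-(d * s)) * (K * ‖Tsg.T s (B x)‖) := by
                  rw [hc]
                  gcongr
                  exact hs.1.le
              _ = _ := by ring
      _ ≤ ∫ s, K ^ 2 * ‖g s‖ ^ 2 := by
          refine setIntegral_le_integral (ig'.const_mul _) (Eventually.of_forall fun s => ?_)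
          positivity
  have fin : c ^ 2 * (t / 2) ≤ (K * C * (K * ‖(x : X)‖)) ^ 2 * (t / 2) := by
    calc c ^ 2 * (t / 2) ≤ K ^ 2 * (C ^ 2 * ((K * ‖(x : X)‖) ^ 2 * (t / 2))) := by
          refine low.trans ?_
          gcongr
          exact main1.trans (by gcongr)
      _ = _ := by ring
  have fin2 : c ≤ K * C * (K * ‖(x : X)‖) := by
    have := le_of_mul_le_mul_right fin (by positivity)
    exact le_of_sq_le_sq this (by positivity)
  calc ‖Tsg.T t (B x)‖ = 2 * Real.exp 1 * t⁻¹ * c := by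
        rw [hc, Real.exp_neg]; field_simp
    _ ≤ 2 * Real.exp 1 * t⁻¹ * (K * C * (K * ‖(x : X)‖)) := by gcongr
    _ = _ := by ring

/-- Bounded extension from a subspace of a Hilbert space. -/
theorem tr_extend (M : Submodule ℂ X) (f : M →ₗ[ℂ] X) {D : ℝ} (hD : 0 ≤ D)
    (h : ∀ x : M, ‖f x‖ ≤ D * ‖(x : X)‖) :
    ∃ F : X →L[ℂ] X, (∀ x : M, F (x : X) = f x) ∧ ‖F‖ ≤ D := by
  have hle := M.le_topologicalClosure
  let e : M →ₗ[ℂ] M.topologicalClosure := Submodule.inclusion hle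
  have hdense : DenseRange e := by
    have := M.isClosed_topologicalClosure
    intro y
    rw [closure_subtype]
    have hy : (y : X) ∈ closure (M : Set X) := y.2
    convert hy using 2
    ext z
    constructor
    · rintro ⟨_, ⟨m, rfl⟩, rfl⟩
      exact m.2
    · intro hz
      exact ⟨e ⟨z, hz⟩, ⟨⟨z, hz⟩, rfl⟩, rfl⟩
  haveI : CompleteSpace M.topologicalClosure :=
    M.isClosed_topologicalClosure.completeSpace_coe
  refine ⟨(f.extendOfNorm e) ∘L M.topologicalClosure.orthogonalProjectionOnto, ?_, ?_⟩
  · intro x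
    rw [ContinuousLinearMap.comp_apply]
    have : M.topologicalClosure.orthogonalProjectionOnto (x : X) = e x :=
      Submodule.orthogonalProjectionOnto_mem_subspace_eq_self (K := M.topologicalClosure) (e x)
    rw [this]
    exact LinearMap.extendOfNorm_eq hdense ⟨D, h⟩ x
  · refine (ContinuousLinearMap.opNorm_comp_le _ _).trans ?_
    have h1 := LinearMap.opNorm_extendOfNorm_le hdense hD h
    have h2 := M.topologicalClosure.orthogonalProjectionOnto_norm_le
    calc _ ≤ D * 1 := mul_le_mul h1 h2 (ContinuousLinearMap.opNorm_nonneg _) hD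
      _ = D := mul_one D

end


/-- Let `(T(t))_{t≥0}` be a bounded `C₀`-semigroup on a complex Hilbert
space `X` with generator `−A`, and let `B : dom(A) → X` be linear, bounded for the graph
norm, and commuting with the semigroup.  If `sup_{λ ∈ ℂ₊} ‖B(λ+A)⁻¹‖ < ∞`, then for each
`t > 0` the operator `T(t)B` extends to a bounded operator on `X` and
`‖T(t)B‖ = O(t⁻¹)` as `t → ∞`. -/
theorem transference_resolvent_to_semigroup
    {X : Type*} [NormedAddCommGroup X] [InnerProductSpace ℂ X] [CompleteSpace X]
    (Tsg : C0Semigroup X) (hbdd : Tsg.Bounded)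
    (A : X →ₗ.[ℂ] X) (hgen : IsGenerator Tsg A)
    (B : A.domain →ₗ[ℂ] X)
    (hBgraph : ∃ C : ℝ, ∀ x : A.domain, ‖B x‖ ≤ C * (‖(x : X)‖ + ‖A x‖))
    (hBcomm : ∀ t : ℝ, 0 ≤ t → ∀ x : A.domain,
      ∃ hx : Tsg.T t (x : X) ∈ A.domain, Tsg.T t (B x) = B ⟨Tsg.T t (x : X), hx⟩)
    (hCR : ∃ C : ℝ, ∀ lam : ℂ, 0 < lam.re →
      ∀ (R : X →L[ℂ] X) (hR : IsResolvent A lam R) (x : X),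
        ‖B ⟨R x, hR.mem_domain x⟩‖ ≤ C * ‖x‖) :
    ∃ TB : ℝ → X →L[ℂ] X,
      (∀ t : ℝ, 0 < t → ∀ x : A.domain, TB t (x : X) = Tsg.T t (B x)) ∧
      (fun t : ℝ => ‖TB t‖) =O[atTop] fun t : ℝ => t⁻¹ := by
  obtain ⟨K, hK⟩ := hbdd
  obtain ⟨C0, hC0⟩ := hCR
  have hK0 : 0 ≤ K := (norm_nonneg _).trans (hK 0 le_rfl)
  set C : ℝ := max C0 0 with hCdef
  have hC : ∀ lam : ℂ, 0 < lam.re →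
      ∀ (R : X →L[ℂ] X) (hR : IsResolvent A lam R) (x : X),
        ‖B ⟨R x, hR.mem_domain x⟩‖ ≤ C * ‖x‖ := fun lam hl R hR x =>
    (hC0 lam hl R hR x).trans (by gcongr; exact le_max_left _ _)
  have hCn : 0 ≤ C := le_max_right _ _
  have key : ∀ t : ℝ, ∃ F : X →L[ℂ] X, 0 < t →
      ((∀ x : A.domain, F (x : X) = Tsg.T t (B x)) ∧
        ‖F‖ ≤ 2 * Real.exp 1 * C * K ^ 2 * t⁻¹) := by
    intro t
    by_cases ht : 0 < t
    · obtain ⟨F, h1, h2⟩ := tr_extend A.domain ((Tsg.T t).toLinearMap ∘ₗ B)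
        (D := 2 * Real.exp 1 * C * K ^ 2 * t⁻¹) (by positivity)
        (fun x => tr_main Tsg hK A hgen B hBcomm hCn hC t ht x)
      exact ⟨F, fun _ => ⟨h1, h2⟩⟩
    · exact ⟨0, fun h => absurd h ht⟩
  choose TB hTB using key
  refine ⟨TB, fun t ht => (hTB t ht).1, ?_⟩
  refine IsBigO.of_bound (2 * Real.exp 1 * C * K ^ 2) ?_
  filter_upwards [eventually_gt_atTop 0] with t ht
  rw [norm_norm, Real.norm_of_nonneg (by positivity)]
  exact (hTB t ht).2
end

section
/- Let −A be the generator of a bounded C₀-semigroup (T(t))_{t≥0} on a complex Banach space X, write B(A) = A(I+A)^{-1}, and assume that T(t)A ≠ 0 for each t > 0. Then there exists a constant c > 0, depending only on the semigroup, such that: (a) if A is invertible, f is a complete Bernstein function, γ ≤ 1, and A^γ f(A^{-1}) is a bounded operator, then ‖T(t₁)A^γ f(A^{-1})‖ ≥ c · (‖T(t₁+t₂)A^{γ-1}‖ / ‖T(t₂)A^{-1}‖) · f(‖T(t₂)A^{-1}‖) for all t₁, t₂ ≥ 0; (b) if f is a bounded complete Bernstein function and γ > 0, then ‖T(t₁)B(A)^γ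 f(A)‖ ≥ c · (‖T(t₁+t₂)B(A)^{γ+1}‖ / ‖T(t₂)B(A)‖) · f(‖T(t₂)B(A)‖) for all t₁, t₂ ≥ 0. -/
open Filter MeasureTheory Set Complex Asymptotics

theorem ci_spectral {ι : Type} [Fintype ι] [DecidableEq ι] (s m : ι → ℝ) (c : ℝ) (hc : 0 < c)
    (hs : ∀ i, 0 < s i) (hm : ∀ i, 0 ≤ m i) (hsum : ∑ i, m i ≤ c) :
    ∃ (u : ι → ι → ℝ) (σ : ι → ℝ), (∀ i, 0 ≤ σ i) ∧
      (∀ i j, s j * u i j - √(m j * s j) / c * ∑ k, √(m k * s k) * u i k = σ i * u i j) ∧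
      (∀ j, ∑ i, (∑ k, √(m k * s k) * u i k) * u i j = √(m j * s j)) := by
  set w : ι → ℝ := fun j => √(m j * s j) with hw
  let M : Matrix ι ι ℝ := Matrix.diagonal s - c⁻¹ • Matrix.vecMulVec w w
  have hMv : ∀ (x : ι → ℝ) j, (M.mulVec x) j = s j * x j - w j / c * ∑ k, w k * x k := by
    intro x j
    simp only [M, Matrix.sub_mulVec, Matrix.smul_mulVec, Pi.sub_apply, Matrix.mulVec_diagonal,
      Pi.smul_apply, Matrix.vecMulVec_mulVec, smul_eq_mul]
    simp [dotProduct]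
    ring
  have hH : M.IsHermitian := by
    ext i j
    simp only [M, Matrix.conjTranspose_apply, Matrix.sub_apply, Matrix.smul_apply,
      Matrix.vecMulVec_apply, Matrix.diagonal_apply, star_trivial, smul_eq_mul]
    by_cases h : i = j
    · subst h; simp
    · simp [h, Ne.symm h, mul_comm]
  have hP : M.PosSemidef := by
    refine Matrix.PosSemidef.of_dotProduct_mulVec_nonneg hH fun x => ?_
    have h1 : star x ⬝ᵥ M.mulVec x = ∑ j, s j * x j ^ 2 - (∑ k, w k * x k) ^ 2 / c := by
      simp only [dotProduct, hMv, star_trivial, Pi.star_apply]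
      rw [sq, mul_div_assoc, Finset.sum_mul, ← Finset.sum_sub_distrib]
      refine Finset.sum_congr rfl fun j _ => ?_
      ring
    rw [h1, sub_nonneg, div_le_iff₀ hc]
    have h2 := Finset.sum_mul_sq_le_sq_mul_sq Finset.univ (fun j => √(m j)) (fun j => √(s j) * x j)
    have h3 : ∀ j, √(m j) * (√(s j) * x j) = w j * x j := fun j => by
      rw [hw]; simp only []; rw [Real.sqrt_mul (hm j)]; ring
    simp only [h3, mul_pow, Real.sq_sqrt (hm _), Real.sq_sqrt (hs _).le] at h2
    have h4 : 0 ≤ ∑ j, s j * x j ^ 2 :=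
      Finset.sum_nonneg fun j _ => mul_nonneg (hs j).le (sq_nonneg _)
    nlinarith
  refine ⟨fun i j => hH.eigenvectorBasis i j, hH.eigenvalues, hP.eigenvalues_nonneg, ?_, ?_⟩
  · intro i j
    have := congrFun (hH.mulVec_eigenvectorBasis i) j
    rw [hMv] at this
    simpa using this
  · intro j
    have := hH.eigenvectorBasis.sum_repr' (WithLp.toLp 2 w)
    have := congrArg (fun v : EuclideanSpace ℝ ι => v j) this
    simp only [PiLp.inner_apply] at this
    simpa using this


theorem ci_alg {𝓐 : Type*} [Ring 𝓐] [Module ℝ 𝓐] [IsScalarTower ℝ 𝓐 𝓐] [SMulCommClass ℝ 𝓐 𝓐]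
    {ι : Type} [Fintype ι] (s m : ι → ℝ) (a c : ℝ) (hc : 0 < c)
    (hs : ∀ i, 0 < s i) (hm : ∀ i, 0 ≤ m i) (hsum : a + ∑ i, m i = c)
    (u : ι → ι → ℝ) (σ : ι → ℝ)
    (h1 : ∀ i j, s j * u i j - √(m j * s j) / c * ∑ k, √(m k * s k) * u i k = σ i * u i j)
    (h2 : ∀ j, ∑ i, (∑ k, √(m k * s k) * u i k) * u i j = √(m j * s j))
    (P Q : 𝓐) (N E : ι → 𝓐) (hPQ : P * Q = Q * P)
    (hN : ∀ j, N j * (P + s j • Q) = 1) (hE : ∀ i, (P + σ i • Q) * E i = P * Q) :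
    (a • (1 : 𝓐) + ∑ j, m j • (1 - s j • (N j * Q))) *
      (c⁻¹ • P + ∑ i, ((∑ k, √(m k * s k) * u i k) ^ 2 / c ^ 2) • E i) = P := by
  set w : ι → ℝ := fun j => √(m j * s j) with hw
  have hw2 : ∀ j, w j * w j = m j * s j := fun j =>
    Real.mul_self_sqrt (mul_nonneg (hm j) (hs j).le)
  set d : ι → ℝ := fun i => ∑ k, w k * u i k with hd
  change ∀ i j, s j * u i j - w j / c * d i = σ i * u i j at h1
  change ∀ j, ∑ i, d i * u i j = w j at h2
  change _ * (c⁻¹ • P + ∑ i, (d i ^ 2 / c ^ 2) • E i) = P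
  let Z : ι → 𝓐 := fun j => ∑ i, (d i * u i j) • E i
  let V : 𝓐 := ∑ i, (d i ^ 2) • E i
  have hV : ∑ j, w j • Z j = V := by
    simp only [Z, V, Finset.smul_sum, smul_smul]
    rw [Finset.sum_comm]
    refine Finset.sum_congr rfl fun i _ => ?_
    rw [← Finset.sum_smul]
    congr 1
    rw [sq]
    conv_rhs => rw [hd]
    simp only []
    rw [Finset.mul_sum]
    refine Finset.sum_congr rfl fun j _ => ?_
    simp only [hd]; ring
  have hZ : ∀ j, (P + s j • Q) * Z j = w j • (Q * (P + c⁻¹ • V)) := by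
    intro j
    have e1 : ∀ i, (d i * u i j) • ((P + s j • Q) * E i)
        = (d i * u i j) • (P * Q) + (w j / c * d i ^ 2) • (Q * E i) := by
      intro i
      have : P + s j • Q = (P + σ i • Q) + (s j - σ i) • Q := by
        rw [sub_smul]; abel
      rw [this, add_mul, hE, smul_add, smul_mul_assoc, smul_smul]
      congr 2
      linear_combination (d i) * h1 i j
    have e2 : (P + s j • Q) * Z j = ∑ i, (d i * u i j) • ((P + s j • Q) * E i) := by
      simp only [Z, Finset.mul_sum, mul_smul_comm]
    rw [e2, Finset.sum_congr rfl fun i _ => e1 i, Finset.sum_add_distrib, ← Finset.sum_smul, h2,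
      mul_add, smul_add, hPQ]
    congr 1
    simp only [V, mul_smul_comm, Finset.mul_sum, Finset.smul_sum, smul_smul]
    refine Finset.sum_congr rfl fun i _ => ?_
    congr 1; ring
  have hZ2 : ∀ j, Z j = w j • (N j * Q * (P + c⁻¹ • V)) := by
    intro j
    have := congrArg (fun z => N j * z) (hZ j)
    simp only [← mul_assoc, hN, one_mul, mul_smul_comm] at this
    exact this
  have hY : c⁻¹ • P + ∑ i, (d i ^ 2 / c ^ 2) • E i = c⁻¹ • (P + c⁻¹ • V) := by
    rw [smul_add]
    congr 1
    simp only [V, Finset.smul_sum, smul_smul]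
    refine Finset.sum_congr rfl fun i _ => ?_
    congr 1; field_simp
  have hF : (a • (1 : 𝓐) + ∑ j, m j • (1 - s j • (N j * Q)))
      = c • 1 - ∑ j, (w j * w j) • (N j * Q) := by
    rw [← hsum]
    simp only [smul_sub, Finset.sum_sub_distrib, smul_smul, hw2, add_smul, Finset.sum_smul]
    abel
  have hV2 : ∑ j, (w j * w j) • (N j * Q * (P + c⁻¹ • V)) = V := by
    rw [← hV]
    refine Finset.sum_congr rfl fun j _ => ?_
    rw [hV]
    rw [← smul_smul, ← hZ2]
  rw [hY, hF, mul_smul_comm, sub_mul, Finset.sum_mul]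
  simp only [smul_mul_assoc, one_mul]
  rw [hV2, smul_add, smul_smul, mul_inv_cancel₀ hc.ne', one_smul, add_sub_cancel_right, smul_smul,
    inv_mul_cancel₀ hc.ne', one_smul]

/-- approximate inverse for a finite sum -/
theorem ci_finite {𝓐 : Type*} [NormedRing 𝓐] [NormedSpace ℝ 𝓐] [IsScalarTower ℝ 𝓐 𝓐]
    [SMulCommClass ℝ 𝓐 𝓐]
    {ι : Type} [Fintype ι] (s m : ι → ℝ) (a : ℝ) (ha : 0 ≤ a)
    (hs : ∀ i, 0 < s i) (hm : ∀ i, 0 ≤ m i)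
    (P Q T : 𝓐) (N E : ℝ → 𝓐) (hPQ : P * Q = Q * P)
    (hN : ∀ t, 0 < t → N t * (P + t • Q) = 1)
    (hE : ∀ t, 0 ≤ t → (P + t • Q) * E t = P * Q)
    (C : ℝ) (hC : 1 ≤ C)
    (hE1 : ∀ t, 0 ≤ t → ‖E t‖ ≤ C) (hE2 : ∀ t, 0 ≤ t → t * ‖E t‖ ≤ C * ‖P‖)
    (hE3 : ∀ t, 0 ≤ t → ‖T * E t‖ ≤ C) (hE4 : ∀ t, 0 ≤ t → t * ‖T * E t‖ ≤ C * ‖T * P‖)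
    (hr : 0 < ‖T * P‖) (hφ : 0 < a + ∑ i, m i * (‖T * P‖ / (s i + ‖T * P‖))) :
    ∃ H : 𝓐, (a • (1 : 𝓐) + ∑ j, m j • (1 - s j • (N (s j) * Q))) * H = P ∧
      ‖T * H‖ ≤ 2 * C * ‖T * P‖ / (a + ∑ i, m i * (‖T * P‖ / (s i + ‖T * P‖))) ∧
      ‖H‖ ≤ C * (‖P‖ + ‖T * P‖) / (a + ∑ i, m i * (‖T * P‖ / (s i + ‖T * P‖))) ∧
      ∀ V, V * P = P * V → (∀ t, 0 ≤ t → V * E t = E t * V) → V * H = H * V := by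
  classical
  set r := ‖T * P‖ with hrdef
  have hc : 0 < a + ∑ i, m i := by
    refine hφ.trans_le ?_
    gcongr with i
    refine mul_le_of_le_one_right (hm i) ?_
    rw [div_le_one (by have := hs i; positivity)]
    linarith [hs i]
  set φ := a + ∑ i, m i * (r / (s i + r)) with hφd
  obtain ⟨u, σ, hσ, h1, h2⟩ := ci_spectral s m _ hc hs hm (le_add_of_nonneg_left ha)
  set c := a + ∑ i, m i with hcd
  set p : ι → ℝ := fun i => (∑ k, √(m k * s k) * u i k) ^ 2 / c ^ 2 with hp
  have hp0 : ∀ i, 0 ≤ p i := fun i => by positivity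
  have hsc : c⁻¹ + ∑ i, p i / (σ i + r) = 1 / φ := by
    have := ci_alg (𝓐 := ℝ) s m a c hc hs hm hcd.symm u σ h1 h2 r 1 (fun j => (r + s j)⁻¹)
      (fun i => r / (r + σ i)) (by ring)
      (fun j => by have := hs j; simp; field_simp) (fun i => by have := hσ i; simp; field_simp)
    have e1 : a + ∑ x, m x * (1 - s x * (r + s x)⁻¹) = φ := by
      rw [hφd]
      congr 1
      refine Finset.sum_congr rfl fun j _ => ?_
      have := hs j
      congr 1; field_simp; ring
    have e2 : c⁻¹ * r + ∑ i, p i * (r / (r + σ i)) = r * (c⁻¹ + ∑ i, p i / (σ i + r)) := by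
      rw [mul_add, Finset.mul_sum]
      congr 1
      · ring
      refine Finset.sum_congr rfl fun j _ => ?_
      rw [add_comm r]; ring
    simp only [smul_eq_mul, mul_one] at this
    rw [e1, e2] at this
    field_simp
    have h3 : r * (φ * (c⁻¹ + ∑ i, p i / (σ i + r)) - 1) = 0 := by linear_combination this
    have := (mul_eq_zero.1 h3).resolve_left hr.ne'
    have h4 : ∀ x : ℝ, φ * (c⁻¹ + x) - 1 = 0 → φ * (1 + c * x) = c := by
      intro x hx
      have : φ * (c⁻¹ + x) = 1 := by linarith
      calc φ * (1 + c * x) = c * (φ * (c⁻¹ + x)) := by field_simp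
        _ = c := by rw [this, mul_one]
    first | exact h4 _ this | linarith [h4 _ this]
  refine ⟨c⁻¹ • P + ∑ i, p i • E (σ i), ?_, ?_, ?_, ?_⟩
  rotate_left 3
  · intro V hVP hVE
    rw [mul_add, add_mul, mul_smul_comm, smul_mul_assoc, hVP, Finset.mul_sum, Finset.sum_mul]
    congr 1
    refine Finset.sum_congr rfl fun i _ => ?_
    rw [mul_smul_comm, smul_mul_assoc, hVE _ (hσ i)]
  · exact ci_alg s m a c hc hs hm hcd.symm u σ h1 h2 P Q (fun j => N (s j)) (fun i => E (σ i)) hPQ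
      (fun j => hN _ (hs j)) (fun i => hE _ (hσ i))
  · have e : 2 * C * r / φ = 2 * C * r * (c⁻¹ + ∑ i, p i / (σ i + r)) := by rw [hsc]; ring
    rw [e, mul_add, mul_smul_comm, mul_add, Finset.mul_sum, Finset.mul_sum]
    refine (norm_add_le _ _).trans (add_le_add ?_ ((norm_sum_le _ _).trans
      (Finset.sum_le_sum fun i _ => ?_)))
    · rw [norm_smul, Real.norm_of_nonneg (by positivity), ← hrdef]
      have : 0 ≤ c⁻¹ * r := by positivity
      nlinarith
    · rw [mul_smul_comm, norm_smul, Real.norm_of_nonneg (hp0 i)]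
      have h3 := hE3 _ (hσ i)
      have h4 := hE4 _ (hσ i)
      have h5 : ‖T * E (σ i)‖ ≤ 2 * C * r / (σ i + r) := by
        rw [le_div_iff₀ (by have := hσ i; positivity)]
        nlinarith
      calc p i * ‖T * E (σ i)‖ ≤ p i * (2 * C * r / (σ i + r)) :=
            mul_le_mul_of_nonneg_left h5 (hp0 i)
        _ = _ := by ring
  · have e : C * (‖P‖ + r) / φ = C * (‖P‖ + r) * (c⁻¹ + ∑ i, p i / (σ i + r)) := by
      rw [hsc]; ring
    rw [e, mul_add, Finset.mul_sum]
    refine (norm_add_le _ _).trans (add_le_add ?_ ((norm_sum_le _ _).trans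
      (Finset.sum_le_sum fun i _ => ?_)))
    · rw [norm_smul, Real.norm_of_nonneg (by positivity), mul_comm]
      have h0 := norm_nonneg P
      gcongr
      nlinarith
    · rw [norm_smul, Real.norm_of_nonneg (hp0 i)]
      have h3 := hE1 _ (hσ i)
      have h4 := hE2 _ (hσ i)
      have h5 : ‖E (σ i)‖ ≤ C * (‖P‖ + r) / (σ i + r) := by
        rw [le_div_iff₀ (by have := hσ i; positivity)]
        nlinarith
      calc p i * ‖E (σ i)‖ ≤ p i * (C * (‖P‖ + r) / (σ i + r)) :=
            mul_le_mul_of_nonneg_left h5 (hp0 i)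
        _ = _ := by ring

/-- finite nonnegative combinations -/
def ciCone {𝓔 : Type*} [AddCommGroup 𝓔] [Module ℝ 𝓔] (e : 𝓔) (Φ : ℝ → 𝓔) : Set 𝓔 :=
  {z | ∃ (ι : Type) (_ : Fintype ι) (a : ℝ) (m s : ι → ℝ), 0 ≤ a ∧ (∀ i, 0 ≤ m i) ∧
    (∀ i, 0 < s i) ∧ z = a • e + ∑ i, m i • Φ (s i)}

theorem ciCone_add {𝓔 : Type*} [AddCommGroup 𝓔] [Module ℝ 𝓔] {e : 𝓔} {Φ : ℝ → 𝓔} {x y : 𝓔}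
    (hx : x ∈ ciCone e Φ) (hy : y ∈ ciCone e Φ) : x + y ∈ ciCone e Φ := by
  obtain ⟨ι, _, a, m, s, ha, hm, hs, rfl⟩ := hx
  obtain ⟨κ, _, a', m', s', ha', hm', hs', rfl⟩ := hy
  refine ⟨ι ⊕ κ, inferInstance, a + a', Sum.elim m m', Sum.elim s s', add_nonneg ha ha', ?_, ?_, ?_⟩
  · rintro (i | i) <;> simp [hm, hm']
  · rintro (i | i) <;> simp [hs, hs']
  · simp only [Fintype.sum_sum_type, Sum.elim_inl, Sum.elim_inr, add_smul]; abel

theorem ciCone_smul {𝓔 : Type*} [AddCommGroup 𝓔] [Module ℝ 𝓔] {e : 𝓔} {Φ : ℝ → 𝓔} {x : 𝓔}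
    (hx : x ∈ ciCone e Φ) {t : ℝ} (ht : 0 ≤ t) : t • x ∈ ciCone e Φ := by
  obtain ⟨ι, _, a, m, s, ha, hm, hs, rfl⟩ := hx
  refine ⟨ι, inferInstance, t * a, fun i => t * m i, s, mul_nonneg ht ha,
    fun i => mul_nonneg ht (hm i), hs, ?_⟩
  simp [smul_add, Finset.smul_sum, smul_smul]

theorem ciCone_integral {𝓔 : Type*} [NormedAddCommGroup 𝓔] [NormedSpace ℝ 𝓔] [CompleteSpace 𝓔]
    (e v : 𝓔) (Φ : ℝ → 𝓔)
    (hv : v ∈ closure (ciCone e Φ)) (μ : MeasureTheory.Measure ℝ) {a b : ℝ} (ha : 0 ≤ a)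
    (hb : 0 ≤ b) (hI : MeasureTheory.IntegrableOn Φ (Set.Ioi 0) μ) :
    a • e + b • v + ∫ t in Set.Ioi (0 : ℝ), Φ t ∂μ ∈ closure (ciCone e Φ) := by
  by_contra hz
  have hconv : Convex ℝ (ciCone e Φ) := by
    intro x hx y hy p q hp hq _
    exact ciCone_add (ciCone_smul hx hp) (ciCone_smul hy hq)
  obtain ⟨l, u, h1, h2⟩ := geometric_hahn_banach_point_closed hconv.closure isClosed_closure hz
  have h0 : (0 : 𝓔) ∈ ciCone e Φ :=
    ⟨Empty, inferInstance, 0, fun _ => 0, fun _ => 1, le_rfl, by simp, by simp, by simp⟩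
  have hu : u < 0 := by simpa using h2 0 (subset_closure h0)
  have hpos : ∀ x ∈ ciCone e Φ, 0 ≤ l x := by
    intro x hx
    by_contra hneg
    push Not at hneg
    have := h2 _ (subset_closure (ciCone_smul hx (t := u / l x)
      (div_nonneg_of_nonpos hu.le hneg.le)))
    rw [map_smul, smul_eq_mul, div_mul_cancel₀ _ hneg.ne] at this
    exact lt_irrefl _ this
  have hpos' : ∀ x ∈ closure (ciCone e Φ), 0 ≤ l x := fun x hx =>
    closure_minimal (t := {x | 0 ≤ l x}) hpos (isClosed_le continuous_const l.continuous) hx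
  have he : e ∈ ciCone e Φ :=
    ⟨Empty, inferInstance, 1, fun _ => 0, fun _ => 1, zero_le_one, by simp, by simp, by simp⟩
  have hΦ : ∀ t, 0 < t → Φ t ∈ ciCone e Φ := fun t ht =>
    ⟨Unit, inferInstance, 0, fun _ => 1, fun _ => t, le_rfl, by simp, by simp [ht], by simp⟩
  have h3 : l (a • e + b • v + ∫ t in Set.Ioi (0 : ℝ), Φ t ∂μ)
      = a * l e + b * l v + ∫ t in Set.Ioi (0 : ℝ), l (Φ t) ∂μ := by
    rw [map_add, map_add, map_smul, map_smul, smul_eq_mul, smul_eq_mul,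
      l.integral_comp_comm hI]
  have h4 : 0 ≤ ∫ t in Set.Ioi (0 : ℝ), l (Φ t) ∂μ :=
    MeasureTheory.setIntegral_nonneg measurableSet_Ioi fun t ht => hpos _ (hΦ t ht)
  have h5 := mul_nonneg ha (hpos e he)
  have h6 := mul_nonneg hb (hpos' v hv)
  linarith

/-- approximate inverse in general -/
theorem ci_approx {𝓐 : Type*} [NormedRing 𝓐] [NormedSpace ℝ 𝓐] [IsScalarTower ℝ 𝓐 𝓐]
    [SMulCommClass ℝ 𝓐 𝓐]
    (P Q T : 𝓐) (N E : ℝ → 𝓐) (hPQ : P * Q = Q * P)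
    (hN : ∀ t, 0 < t → N t * (P + t • Q) = 1)
    (hE : ∀ t, 0 ≤ t → (P + t • Q) * E t = P * Q)
    (C : ℝ) (hC : 1 ≤ C)
    (hE1 : ∀ t, 0 ≤ t → ‖E t‖ ≤ C) (hE2 : ∀ t, 0 ≤ t → t * ‖E t‖ ≤ C * ‖P‖)
    (hE3 : ∀ t, 0 ≤ t → ‖T * E t‖ ≤ C) (hE4 : ∀ t, 0 ≤ t → t * ‖T * E t‖ ≤ C * ‖T * P‖)
    (hr : 0 < ‖T * P‖) (F : 𝓐) (φ : ℝ) (hφ : 0 < φ)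
    (hF : (F, φ) ∈ closure (ciCone ((1 : 𝓐), (1 : ℝ))
      (fun t => ((1 : 𝓐) - t • (N t * Q), ‖T * P‖ / (t + ‖T * P‖))))) (ε : ℝ) (hε : 0 < ε) :
    ∃ H : 𝓐, ‖F * H - P‖ ≤ ε ∧ ‖T * H‖ ≤ 4 * C * ‖T * P‖ / φ ∧
      ∀ V, V * P = P * V → (∀ t, 0 ≤ t → V * E t = E t * V) → V * H = H * V := by
  set r := ‖T * P‖ with hrdef
  set D := 2 * C * (‖P‖ + r) / φ with hD
  have hD0 : 0 < D := by positivity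
  obtain ⟨⟨F', φ'⟩, hmem, hdist⟩ := Metric.mem_closure_iff.1 hF (min (φ / 2) (ε / D)) (by positivity)
  obtain ⟨ι, _, a, m, s, ha, hm, hs, heq⟩ := hmem
  have hF' : F' = a • (1 : 𝓐) + ∑ j, m j • (1 - s j • (N (s j) * Q)) := by
    simpa [Prod.fst_sum] using congrArg Prod.fst heq
  have hφ' : φ' = a + ∑ i, m i * (r / (s i + r)) := by
    simpa [Prod.snd_sum] using congrArg Prod.snd heq
  rw [Prod.dist_eq, max_lt_iff] at hdist
  obtain ⟨d1, d2⟩ := hdist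
  have d1' : ‖F - F'‖ < ε / D := by
    rw [← dist_eq_norm]; exact d1.trans_le (min_le_right _ _)
  have d2' : φ / 2 ≤ φ' := by
    have := d2.trans_le (min_le_left _ _)
    rw [Real.dist_eq, abs_lt] at this
    simp only at this
    linarith [this.2]
  have hφ'0 : 0 < φ' := by linarith
  obtain ⟨H, h1, h2, h3, hV⟩ := ci_finite s m a ha hs hm P Q T N E hPQ hN hE C hC hE1 hE2 hE3 hE4 hr
    (by rw [← hrdef, ← hφ']; exact hφ'0)
  rw [← hF'] at h1
  rw [← hrdef, ← hφ'] at h2 h3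
  refine ⟨H, ?_, h2.trans ?_, hV⟩
  · have e : F * H - P = (F - F') * H := by rw [sub_mul, h1]
    have h4 : ‖H‖ ≤ D := by
      refine h3.trans ?_
      rw [hD]
      calc C * (‖P‖ + r) / φ' ≤ C * (‖P‖ + r) / (φ / 2) := by gcongr
        _ = _ := by field_simp
    rw [e]
    calc ‖(F - F') * H‖ ≤ ‖F - F'‖ * ‖H‖ := norm_mul_le _ _
      _ ≤ ε / D * D := by gcongr
      _ = ε := by field_simp
  · calc 2 * C * r / φ' ≤ 2 * C * r / (φ / 2) := by gcongr
      _ = _ := by field_simp; ring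


theorem ci_cont {𝓐 : Type*} [NormedRing 𝓐] [CompleteSpace 𝓐] [NormedSpace ℝ 𝓐]
    (P Q : 𝓐) (N : ℝ → 𝓐)
    (hN : ∀ t, 0 < t → N t * (P + t • Q) = 1) (hN' : ∀ t, 0 < t → (P + t • Q) * N t = 1) :
    ContinuousOn N (Set.Ioi 0) := by
  have h : ∀ t, 0 < t → N t = Ring.inverse (P + t • Q) := fun t ht => by
    let U : 𝓐ˣ := ⟨P + t • Q, N t, hN' t ht, hN t ht⟩
    exact (Ring.inverse_unit U).symm
  refine ContinuousOn.congr (f := fun t : ℝ => Ring.inverse (P + t • Q)) ?_ fun t ht => h t ht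
  intro t ht
  let U : 𝓐ˣ := ⟨P + t • Q, N t, hN' t ht, hN t ht⟩
  have h1 : ContinuousAt Ring.inverse (P + t • Q) := NormedRing.inverse_continuousAt U
  have h2 : ContinuousAt (fun t : ℝ => P + t • Q) t := by fun_prop
  exact (ContinuousAt.comp (f := fun t : ℝ => P + t • Q) (x := t) h1 h2).continuousWithinAt

section
variable {X : Type*} [NormedAddCommGroup X] [NormedSpace ℂ X]

theorem ci_resolvent_id {A : X →ₗ.[ℂ] X} {a b : ℂ} {R S : X →L[ℂ] X}
    (hR : IsResolvent A a R) (hS : IsResolvent A b S) : R - S = (b - a) • (R * S) := by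
  ext x
  have h1 := hR.left_inv ⟨S x, hS.mem_domain x⟩
  have h2 : A ⟨S x, hS.mem_domain x⟩ = x - b • S x := eq_sub_of_add_eq' (hS.eq_apply x)
  rw [h2] at h1
  simp only [map_add, map_sub, map_smul] at h1
  change R x - S x = (b - a) • R (S x)
  rw [sub_smul, sub_eq_iff_eq_add]
  nth_rewrite 3 [← h1]
  abel

theorem ci_sg_dom {Tsg : C0Semigroup X} {A : X →ₗ.[ℂ] X} (hgen : IsGenerator Tsg A)
    {t : ℝ} (ht : 0 ≤ t) (x : A.domain) :
    ∃ h : Tsg.T t x ∈ A.domain, A ⟨Tsg.T t x, h⟩ = Tsg.T t (A x) := by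
  rw [hgen]
  have h1 := (hgen x (A x)).1 ⟨x.2, rfl⟩
  have h2 := ((Tsg.T t).continuous.tendsto _).comp h1
  rw [map_neg] at h2
  refine h2.congr' ?_
  filter_upwards [self_mem_nhdsWithin] with s hs
  have e : Tsg.T t (Tsg.T s x) = Tsg.T s (Tsg.T t x) := by
    have e1 := Tsg.map_add s t (le_of_lt hs) ht
    have e2 := Tsg.map_add t s ht (le_of_lt hs)
    rw [add_comm, e2] at e1
    exact congrArg (fun f : X →L[ℂ] X => f x) e1
  simp [e]

theorem ci_sg_comm {Tsg : C0Semigroup X} {A : X →ₗ.[ℂ] X} (hgen : IsGenerator Tsg A)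
    {t : ℝ} (ht : 0 ≤ t) {lam : ℂ} {R : X →L[ℂ] X} (hR : IsResolvent A lam R) :
    R * Tsg.T t = Tsg.T t * R := by
  ext x
  obtain ⟨h, h1⟩ := ci_sg_dom hgen ht ⟨R x, hR.mem_domain x⟩
  have h2 := hR.left_inv ⟨Tsg.T t (R x), h⟩
  rw [h1] at h2
  simp only at h2
  rw [← map_smul, ← map_add, hR.eq_apply] at h2
  exact h2

theorem ci_sg_deriv {Tsg : C0Semigroup X} {A : X →ₗ.[ℂ] X} (hgen : IsGenerator Tsg A)
    {t : ℝ} (ht : 0 ≤ t) (x : A.domain) :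
    HasDerivWithinAt (fun s => Tsg.T s x) (-(Tsg.T t (A x))) (Set.Ici t) t := by
  rw [← hasDerivWithinAt_Ioi_iff_Ici, hasDerivWithinAt_iff_tendsto_slope' (by simp)]
  have h1 := (hgen x (A x)).1 ⟨x.2, rfl⟩
  have h2 := ((Tsg.T t).continuous.tendsto _).comp h1
  rw [map_neg] at h2
  have h3 : Tendsto (fun s : ℝ => s - t) (nhdsWithin t (Set.Ioi t)) (nhdsWithin 0 (Set.Ioi 0)) := by
    refine tendsto_nhdsWithin_iff.2 ⟨?_, ?_⟩
    · have : Tendsto (fun s : ℝ => s - t) (nhds t) (nhds (t - t)) :=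
        (continuous_id.sub continuous_const).tendsto t
      rw [sub_self] at this
      exact this.mono_left nhdsWithin_le_nhds
    · filter_upwards [self_mem_nhdsWithin] with s hs
      simpa using hs
  refine (h2.comp h3).congr' ?_
  filter_upwards [self_mem_nhdsWithin] with s hs
  have e : Tsg.T t (Tsg.T (s - t) x) = Tsg.T s x := by
    have e2 := Tsg.map_add t (s - t) ht (sub_nonneg.2 (le_of_lt hs))
    rw [add_sub_cancel] at e2
    rw [e2]; rfl
  simp only [Function.comp_apply, map_smul, map_sub, e, slope, vsub_eq_sub]
  rw [← Complex.ofReal_inv, Complex.coe_smul]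

theorem ci_sg_bound {Tsg : C0Semigroup X} {A : X →ₗ.[ℂ] X} (hgen : IsGenerator Tsg A)
    {K : ℝ} (hK : ∀ t : ℝ, 0 ≤ t → ‖Tsg.T t‖ ≤ K) {lam : ℝ} (hl : 0 < lam) {R : X →L[ℂ] X}
    (hR : IsResolvent A lam R) : lam * ‖R‖ ≤ K := by
  have hK0 : 0 ≤ K := (norm_nonneg _).trans (hK 0 le_rfl)
  suffices h : ‖R‖ ≤ K / lam by
    rw [le_div_iff₀ hl] at h; linarith
  refine R.opNorm_le_bound (by positivity) fun y => ?_
  let x : A.domain := ⟨R y, hR.mem_domain y⟩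
  have hy : (lam : ℂ) • (x : X) + A x = y := hR.eq_apply y
  -- the function e^{-lam t} T(t) x
  have hderiv : ∀ t : ℝ, 0 ≤ t → HasDerivWithinAt
      (fun s => Real.exp (-lam * s) • Tsg.T s x - x) (-(Real.exp (-lam * t) • Tsg.T t y))
      (Set.Ici t) t := by
    intro t ht
    have e1 : HasDerivAt (fun s => Real.exp (-lam * s)) (Real.exp (-lam * t) * (-lam)) t := by
      have := ((hasDerivAt_id t).const_mul (-lam)).exp
      simpa using this
    have e2 := (e1.hasDerivWithinAt (s := Set.Ici t)).smul (ci_sg_deriv hgen ht x)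
    have e3 := e2.sub_const (x : X)
    refine e3.congr_deriv ?_
    rw [← hy, map_add, map_smul, Complex.coe_smul]
    module
  have hcont : ContinuousOn (fun s => Real.exp (-lam * s) • Tsg.T s x - (x : X)) (Set.Ici 0) := by
    refine ContinuousOn.sub (ContinuousOn.smul (M := ℝ) (Continuous.continuousOn (by fun_prop)) (Tsg.strong_continuity x))
      continuousOn_const
  have key : ∀ t : ℝ, 0 ≤ t → ‖Real.exp (-lam * t) • Tsg.T t x - (x : X)‖
      ≤ K * ‖y‖ / lam * (1 - Real.exp (-lam * t)) := by
    intro t ht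
    refine image_norm_le_of_norm_deriv_right_le_deriv_boundary (a := 0) (b := t)
      (B := fun s => K * ‖y‖ / lam * (1 - Real.exp (-lam * s)))
      (B' := fun s => K * ‖y‖ * Real.exp (-lam * s))
      (hcont.mono fun s hs => hs.1) (fun s hs => hderiv s hs.1) ?_ ?_ ?_ ⟨ht, le_rfl⟩
    · simp [Tsg.map_zero]
    · intro s
      have e1 : HasDerivAt (fun s => Real.exp (-lam * s)) (Real.exp (-lam * s) * (-lam)) s := by
        have := ((hasDerivAt_id s).const_mul (-lam)).exp
        simpa using this
      have := (e1.const_sub 1).const_mul (K * ‖y‖ / lam)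
      refine this.congr_deriv ?_
      field_simp
    · intro s hs
      rw [norm_neg, norm_smul, Real.norm_of_nonneg (Real.exp_pos _).le, mul_comm]
      gcongr
      exact (Tsg.T s).le_of_opNorm_le (hK s hs.1) y
  have hlim : Tendsto (fun t : ℝ => Real.exp (-lam * t)) atTop (nhds 0) := by
    refine Real.tendsto_exp_atBot.comp ?_
    exact tendsto_id.const_mul_atTop_of_neg (by linarith)
  have hlim2 : Tendsto (fun t : ℝ => K * ‖y‖ / lam + Real.exp (-lam * t) * (K * ‖(x : X)‖)) atTop
      (nhds (K * ‖y‖ / lam + 0 * (K * ‖(x : X)‖))) := (hlim.mul_const _).const_add _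
  have : ‖(x : X)‖ ≤ K * ‖y‖ / lam + 0 * (K * ‖(x : X)‖) := by
    refine ge_of_tendsto hlim2 ?_
    filter_upwards [eventually_ge_atTop 0] with t ht
    have h1 := key t ht
    have h2 : ‖Real.exp (-lam * t) • Tsg.T t (x : X)‖ ≤ Real.exp (-lam * t) * (K * ‖(x : X)‖) := by
      rw [norm_smul, Real.norm_of_nonneg (Real.exp_pos _).le]
      gcongr
      exact (Tsg.T t).le_of_opNorm_le (hK t ht) _
    have h3 := norm_sub_norm_le (x : X) (Real.exp (-lam * t) • Tsg.T t (x : X))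
    rw [norm_sub_rev] at h3
    have h4 : K * ‖y‖ / lam * (1 - Real.exp (-lam * t)) ≤ K * ‖y‖ / lam := by
      refine mul_le_of_le_one_right (by positivity) ?_
      linarith [Real.exp_pos (-lam * t)]
    linarith
  calc ‖R y‖ ≤ K * ‖y‖ / lam + 0 * (K * ‖(x : X)‖) := this
    _ = K / lam * ‖y‖ := by ring

theorem ci_dense {Tsg : C0Semigroup X} {A : X →ₗ.[ℂ] X} (hgen : IsGenerator Tsg A)
    {S : X →L[ℂ] X} (hS : IsResolvent A 0 S) (x : X) : x ∈ closure (Set.range S) := by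
  have h0 : A ⟨S x, hS.mem_domain x⟩ = x := by simpa using hS.eq_apply x
  have h1 := ((hgen (S x) x).1 ⟨hS.mem_domain x, h0⟩).neg
  rw [neg_neg] at h1
  refine mem_closure_of_tendsto h1 ?_
  filter_upwards [self_mem_nhdsWithin] with t ht
  have e : S (Tsg.T t x) = Tsg.T t (S x) :=
    congrArg (fun f : X →L[ℂ] X => f x) (ci_sg_comm hgen (le_of_lt ht) hS)
  refine ⟨-((t : ℂ)⁻¹ • (Tsg.T t x - x)), ?_⟩
  simp [e]

variable [CompleteSpace X]

theorem ci_integral_comm (T : X →L[ℂ] X) (g : ℝ → X →L[ℂ] X) (ν : MeasureTheory.Measure ℝ)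
    (h : ∀ᵐ t ∂ν, T * g t = g t * T) : T * ∫ t, g t ∂ν = (∫ t, g t ∂ν) * T := by
  by_cases hg : MeasureTheory.Integrable g ν
  · rw [← integral_const_mul_of_integrable hg,
      ← integral_mul_const_of_integrable hg]
    exact MeasureTheory.integral_congr_ae h
  · rw [MeasureTheory.integral_undef hg]; simp

theorem ci_opPow_comm (T B : X →L[ℂ] X) (h : T * B = B * T) (α : ℝ) :
    T * opPow B α = opPow B α * T := by
  have hc : Commute T B := h
  have hb : ∀ γ, Commute T (balakrishnan B γ) := by
    intro γ
    unfold balakrishnan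
    refine Commute.smul_right ?_ _
    refine ci_integral_comm T _ _ (Filter.Eventually.of_forall fun t => ?_)
    refine Commute.smul_right (hc.mul_right ?_) _
    have hc2 : Commute T ((t : ℂ) • (1 : X →L[ℂ] X) + B) :=
      Commute.add_right ((Commute.one_right T).smul_right _) hc
    by_cases hu : IsUnit ((t : ℂ) • (1 : X →L[ℂ] X) + B)
    · obtain ⟨U, hU⟩ := hu
      rw [← hU] at hc2 ⊢
      rw [Ring.inverse_unit]
      exact hc2.units_inv_right
    · rw [Ring.inverse_non_unit _ hu]
      exact Commute.zero_right _
  unfold opPow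
  split_ifs
  · exact hc.pow_right _
  · exact (hc.pow_right _).mul_right (hb _)

theorem ci_opPow_succ (B : X →L[ℂ] X) {γ : ℝ} (hγ : 0 < γ) :
    opPow B (γ + 1) = opPow B γ * B := by
  have hB : B * opPow B γ = opPow B γ * B := ci_opPow_comm B B rfl γ
  rw [← hB]
  unfold opPow
  rw [Nat.floor_add_one hγ.le]
  push_cast
  have : (γ + 1 = (⌊γ⌋₊ : ℝ) + 1) ↔ γ = (⌊γ⌋₊ : ℝ) := add_left_inj 1
  simp only [this, add_sub_add_right_eq_sub]
  split_ifs
  · rw [pow_succ']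
  · rw [pow_succ', mul_assoc]

end


section
variable {X : Type*} [NormedAddCommGroup X] [NormedSpace ℂ X] [CompleteSpace X]

theorem ci_res_real {A : X →ₗ.[ℂ] X} {a b : ℝ} {R S : X →L[ℂ] X}
    (hR : IsResolvent A (a : ℂ) R) (hS : IsResolvent A (b : ℂ) S) :
    R - S = (b - a) • (R * S) := by
  rw [ci_resolvent_id hR hS, ← Complex.ofReal_sub, Complex.coe_smul]

theorem ci_final {c C x r φ y : ℝ} (hC : 0 < C) (hc : c = 1 / (4 * C)) (hr : 0 < r) (hφ : 0 < φ)
    (h : x ≤ y * (4 * C * r / φ)) : c * (x / r) * φ ≤ y := by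
  rw [hc]
  calc 1 / (4 * C) * (x / r) * φ ≤ 1 / (4 * C) * (y * (4 * C * r / φ) / r) * φ := by gcongr
    _ = y := by field_simp

theorem ci_scalar_integrable {r : ℝ} (hr : 0 < r) (μ : MeasureTheory.Measure ℝ)
    (hμ : MeasureTheory.IntegrableOn (fun s : ℝ => (s + 1)⁻¹) (Set.Ioi 0) μ) :
    MeasureTheory.IntegrableOn (fun s : ℝ => r / (s + r)) (Set.Ioi 0) μ := by
  refine MeasureTheory.Integrable.mono' (hμ.const_mul (1 + r)) ?_ ?_
  · exact (by fun_prop : Measurable (fun s : ℝ => r / (s + r))).aestronglyMeasurable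
  · filter_upwards [MeasureTheory.ae_restrict_mem measurableSet_Ioi] with s hs
    have hs : 0 < s := hs
    rw [Real.norm_of_nonneg (by positivity), ← div_eq_mul_inv, div_le_div_iff₀ (by positivity)
      (by positivity)]
    nlinarith

set_option maxHeartbeats 2000000 in
theorem ci_part_b (Tsg : C0Semigroup X)
    (A : X →ₗ.[ℂ] X) (hgen : IsGenerator Tsg A)
    (J : X →L[ℂ] X) (hJ : IsResolvent A 1 J)
    (Rp : ℝ → X →L[ℂ] X)
    (hRp : ∀ lam : ℝ, 0 < lam → IsResolvent A (lam : ℂ) (Rp lam))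
    (K : ℝ) (hK1 : 1 ≤ K) (hK : ∀ t : ℝ, 0 ≤ t → ‖Tsg.T t‖ ≤ K)
    (a : ℝ) (μ : MeasureTheory.Measure ℝ) (f : ℝ → ℝ) (γ : ℝ)
    (ha : 0 ≤ a) (hμ : MeasureTheory.IsFiniteMeasure μ)
    (hf : ∀ lam : ℝ, 0 < lam → f lam = a + ∫ s in Set.Ioi (0 : ℝ), lam / (s + lam) ∂μ)
    (hγ : 0 < γ) (t₁ t₂ : ℝ) (ht₁ : 0 ≤ t₁) (ht₂ : 0 ≤ t₂) :
    1 / (4 * (4 * K ^ 3)) * (‖Tsg.T (t₁ + t₂) ∘L opPow ((1 : X →L[ℂ] X) - J) (γ + 1)‖ /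
          ‖Tsg.T t₂ ∘L ((1 : X →L[ℂ] X) - J)‖) *
        f ‖Tsg.T t₂ ∘L ((1 : X →L[ℂ] X) - J)‖ ≤
      ‖Tsg.T t₁ ∘L (opPow ((1 : X →L[ℂ] X) - J) γ *
        (a • (1 : X →L[ℂ] X) +
          ∫ lam in Set.Ioi (0 : ℝ),
            ((1 : X →L[ℂ] X) - (lam : ℂ) • Rp lam) ∂μ))‖ := by
  simp only [← ContinuousLinearMap.mul_def]
  have hJ' : IsResolvent A ((1 : ℝ) : ℂ) J := by simpa using hJ
  set T := Tsg.T t₂ with hT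
  set P : X →L[ℂ] X := 1 - J with hP
  have hTJ : T * J = J * T := (ci_sg_comm hgen ht₂ hJ).symm
  have hTP : T * P = P * T := by rw [hP, mul_sub, sub_mul, hTJ, mul_one, one_mul]
  have hTK : ‖T‖ ≤ K := hK t₂ ht₂
  have hJK : ‖J‖ ≤ K := by simpa using ci_sg_bound hgen hK one_pos hJ'
  have hRK : ∀ t, 0 < t → t * ‖Rp t‖ ≤ K := fun t ht => ci_sg_bound hgen hK ht (hRp t ht)
  have hone : ‖(1 : X →L[ℂ] X)‖ ≤ 1 := ContinuousLinearMap.norm_id_le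
  have hLK : ∀ t, 0 < t → ‖(1 : X →L[ℂ] X) - t • Rp t‖ ≤ 2 * K := fun t ht => by
    refine (norm_sub_le _ _).trans ?_
    rw [norm_smul, Real.norm_of_nonneg ht.le]
    linarith [hRK t ht]
  set F : X →L[ℂ] X := a • (1 : X →L[ℂ] X) + ∫ lam in Set.Ioi (0 : ℝ),
            ((1 : X →L[ℂ] X) - (lam : ℂ) • Rp lam) ∂μ with hF
  rcases (norm_nonneg (T * P)).eq_or_lt with hr | hr
  · rw [← hr]; simp
  set r := ‖T * P‖ with hrdef
  rcases le_or_gt (f r) 0 with hφ | hφ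
  · exact (mul_nonpos_of_nonneg_of_nonpos (by positivity) hφ).trans (norm_nonneg _)
  -- resolvent identities
  have i1 : ∀ t, 0 < t → J - Rp t = (t - 1) • (J * Rp t) := fun t ht => ci_res_real hJ' (hRp t ht)
  have i2 : ∀ t, 0 < t → Rp t - J = (1 - t) • (Rp t * J) := fun t ht => ci_res_real (hRp t ht) hJ'
  let N : ℝ → X →L[ℂ] X := fun t => 1 + (1 - t) • Rp t
  have hPQt : ∀ t : ℝ, P + t • J = 1 + (t - 1) • J := fun t => by
    rw [hP, sub_smul, one_smul]; abel
  have hN : ∀ t, 0 < t → N t * (P + t • J) = 1 := by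
    intro t ht
    have h := i2 t ht
    rw [hPQt]
    simp only [N, add_mul, mul_add, one_mul, mul_one, smul_mul_assoc, mul_smul_comm]
    rw [← h]
    module
  have hN' : ∀ t, 0 < t → (P + t • J) * N t = 1 := by
    intro t ht
    have h := i1 t ht
    rw [hPQt]
    simp only [N, add_mul, mul_add, one_mul, mul_one, smul_mul_assoc, mul_smul_comm]
    rw [← h]
    module
  have hNJ : ∀ t, 0 < t → N t * J = Rp t := by
    intro t ht
    simp only [N, add_mul, one_mul, smul_mul_assoc]
    rw [← i2 t ht]; abel
  have hPJ : P * J = J * P := by rw [hP, mul_sub, sub_mul, mul_one, one_mul]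
  have hcN := ci_cont P J N hN hN'
  let E : ℝ → X →L[ℂ] X := fun t => if t = 0 then J else P * Rp t
  have hE0 : E 0 = J := if_pos rfl
  have hEt : ∀ t, 0 < t → E t = P * Rp t := fun t ht => if_neg ht.ne'
  have hEt' : ∀ t, 0 < t → E t = J * (1 - t • Rp t) := by
    intro t ht
    rw [hEt t ht, hP, sub_mul, one_mul, mul_sub, mul_one, mul_smul_comm]
    have h := i1 t ht
    rw [sub_smul, one_smul] at h
    have h' := sub_eq_iff_eq_add.1 h
    nth_rewrite 2 [h']
    abel
  have hE : ∀ t, 0 ≤ t → (P + t • J) * E t = P * J := by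
    intro t ht
    rcases ht.eq_or_lt with rfl | ht
    · rw [hE0]; simp
    · have hcomm : (P + t • J) * P = P * (P + t • J) := by
        rw [add_mul, mul_add, smul_mul_assoc, mul_smul_comm, hPJ]
      rw [hEt t ht, ← hNJ t ht, ← mul_assoc, hcomm, mul_assoc, ← mul_assoc (P + t • J), hN' t ht,
        one_mul]
  have hK0 : 0 ≤ K := by linarith
  have hE1 : ∀ t, 0 ≤ t → ‖E t‖ ≤ 2 * K ^ 2 := by
    intro t ht
    rcases ht.eq_or_lt with rfl | ht
    · rw [hE0]; nlinarith
    · rw [hEt' t ht]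
      calc ‖J * (1 - t • Rp t)‖ ≤ ‖J‖ * ‖1 - t • Rp t‖ := norm_mul_le _ _
        _ ≤ K * (2 * K) := by gcongr; exact hLK t ht
        _ = _ := by ring
  have hE2 : ∀ (V : X →L[ℂ] X) t, 0 ≤ t → t * ‖V * E t‖ ≤ K * ‖V * P‖ := by
    intro V t ht
    rcases ht.eq_or_lt with rfl | ht
    · rw [zero_mul]; positivity
    · rw [hEt t ht, ← mul_assoc]
      calc t * ‖V * P * Rp t‖ ≤ t * (‖V * P‖ * ‖Rp t‖) := by gcongr; exact norm_mul_le _ _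
        _ = t * ‖Rp t‖ * ‖V * P‖ := by ring
        _ ≤ K * ‖V * P‖ := by gcongr; exact hRK t ht
  have hKp : K ≤ 4 * K ^ 3 := by nlinarith [mul_nonneg hK0 hK0, mul_nonneg (mul_nonneg hK0 hK0) hK0]
  have hKp2 : 2 * K ^ 2 ≤ 4 * K ^ 3 := by nlinarith [mul_nonneg hK0 hK0]
  -- integrals
  have hintL : MeasureTheory.IntegrableOn (fun t : ℝ => (1 : X →L[ℂ] X) - t • (N t * J))
      (Set.Ioi 0) μ := by
    refine MeasureTheory.Integrable.mono' (g := fun _ => 2 * K) (MeasureTheory.integrable_const _)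
      ?_ ?_
    · refine ContinuousOn.aestronglyMeasurable ?_ measurableSet_Ioi
      exact continuousOn_const.sub (continuousOn_id.smul (hcN.mul continuousOn_const))
    · filter_upwards [MeasureTheory.ae_restrict_mem measurableSet_Ioi] with t ht
      rw [hNJ t ht]
      exact hLK t ht
  have hints : MeasureTheory.IntegrableOn (fun s : ℝ => r / (s + r)) (Set.Ioi 0) μ := by
    refine MeasureTheory.Integrable.mono' (g := fun _ => 1) (MeasureTheory.integrable_const _) ?_ ?_
    · exact (by fun_prop : Measurable (fun s : ℝ => r / (s + r))).aestronglyMeasurable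
    · filter_upwards [MeasureTheory.ae_restrict_mem measurableSet_Ioi] with s hs
      have hs : 0 < s := hs
      rw [Real.norm_of_nonneg (by positivity), div_le_one (by positivity)]
      linarith
  have hFeq : F = a • (1 : X →L[ℂ] X) + ∫ t in Set.Ioi (0 : ℝ),
      ((1 : X →L[ℂ] X) - t • (N t * J)) ∂μ := by
    rw [hF]
    congr 1
    refine MeasureTheory.setIntegral_congr_fun measurableSet_Ioi fun t ht => ?_
    simp only [hNJ t ht, Complex.coe_smul]
  have hmem : (F, f r) ∈ closure (ciCone ((1 : X →L[ℂ] X), (1 : ℝ))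
      (fun t => ((1 : X →L[ℂ] X) - t • (N t * J), r / (t + r)))) := by
    have h0 : (0 : (X →L[ℂ] X) × ℝ) ∈ ciCone ((1 : X →L[ℂ] X), (1 : ℝ))
      (fun t => ((1 : X →L[ℂ] X) - t • (N t * J), r / (t + r))) :=
      ⟨Empty, inferInstance, 0, fun _ => 0, fun _ => 1, le_rfl, by simp, by simp, by simp⟩
    have := ciCone_integral _ 0 _ (subset_closure h0) μ ha le_rfl (hintL.prodMk hints)
    rw [integral_pair hintL hints] at this
    convert this using 1
    rw [hFeq, hf r hr]
    simp
  have hTE : ∀ t, 0 ≤ t → ‖T * E t‖ ≤ 4 * K ^ 3 := by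
    intro t ht
    calc ‖T * E t‖ ≤ ‖T‖ * ‖E t‖ := norm_mul_le _ _
      _ ≤ K * (2 * K ^ 2) := by gcongr; exact hE1 t ht
      _ ≤ 4 * K ^ 3 := by nlinarith [mul_nonneg (mul_nonneg hK0 hK0) hK0]
  have happ := ci_approx P J T N E hPJ hN hE (4 * K ^ 3) (by linarith)
    (fun t ht => (hE1 t ht).trans hKp2)
    (fun t ht => by
      have := hE2 1 t ht
      simp only [one_mul] at this
      exact this.trans (by gcongr)) hTE
    (fun t ht => (hE2 T t ht).trans (by gcongr)) hr F (f r) hφ hmem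
  refine ci_final (C := 4 * K ^ 3) (by positivity) rfl hr hφ ?_
  have hadd : Tsg.T (t₁ + t₂) = Tsg.T t₁ * T := Tsg.map_add t₁ t₂ ht₁ ht₂
  rw [ci_opPow_succ P hγ, hadd]
  have hTO : T * opPow P γ = opPow P γ * T := ci_opPow_comm T P hTP γ
  have hTR : ∀ t, 0 < t → T * Rp t = Rp t * T := fun t ht => (ci_sg_comm hgen ht₂ (hRp t ht)).symm
  have hTF : T * F = F * T := by
    have := ci_integral_comm T (fun lam : ℝ => (1 : X →L[ℂ] X) - (lam : ℂ) • Rp lam)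
      (μ.restrict (Set.Ioi 0)) (by
        filter_upwards [MeasureTheory.ae_restrict_mem measurableSet_Ioi] with t ht
        rw [mul_sub, sub_mul, mul_one, one_mul, mul_smul_comm, smul_mul_assoc, hTR t ht])
    rw [hF, mul_add, add_mul, this, mul_smul_comm, smul_mul_assoc, mul_one, one_mul]
  refine le_of_forall_pos_le_add fun ε hε => ?_
  set W := Tsg.T t₁ * T * opPow P γ with hW
  obtain ⟨H, h1, h2, -⟩ := happ (ε / (‖W‖ + 1)) (by positivity)
  have e : Tsg.T t₁ * T * (opPow P γ * P)
      = Tsg.T t₁ * (opPow P γ * F) * (T * H) - W * (F * H - P) := by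
    have : Tsg.T t₁ * (opPow P γ * F) * (T * H) = W * (F * H) := by
      rw [hW]
      calc Tsg.T t₁ * (opPow P γ * F) * (T * H) = Tsg.T t₁ * (opPow P γ * (F * T)) * H := by
            simp only [mul_assoc]
        _ = Tsg.T t₁ * ((opPow P γ * T) * F) * H := by rw [← hTF]; simp only [mul_assoc]
        _ = _ := by rw [← hTO]; simp only [mul_assoc]
    rw [this, mul_sub W, sub_sub_cancel, hW]
    simp only [mul_assoc]
  rw [e]
  refine (norm_sub_le _ _).trans (add_le_add ?_ ?_)
  · exact (norm_mul_le _ _).trans (by gcongr)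
  · calc ‖W * (F * H - P)‖ ≤ ‖W‖ * ‖F * H - P‖ := norm_mul_le _ _
      _ ≤ (‖W‖ + 1) * (ε / (‖W‖ + 1)) := by gcongr; linarith
      _ = ε := by field_simp

set_option maxHeartbeats 2000000 in
theorem ci_part_a (Tsg : C0Semigroup X)
    (A : X →ₗ.[ℂ] X) (hgen : IsGenerator Tsg A)
    (Rp : ℝ → X →L[ℂ] X)
    (hRp : ∀ lam : ℝ, 0 < lam → IsResolvent A (lam : ℂ) (Rp lam))
    (K : ℝ) (hK1 : 1 ≤ K) (hK : ∀ t : ℝ, 0 ≤ t → ‖Tsg.T t‖ ≤ K)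
    (S : X →L[ℂ] X) (hS : IsResolvent A 0 S)
    (a b : ℝ) (μ : MeasureTheory.Measure ℝ) (f : ℝ → ℝ) (γ : ℝ) (G : X →L[ℂ] X)
    (ha : 0 ≤ a) (hb : 0 ≤ b)
    (hμ : (∫⁻ s in Set.Ioi (0 : ℝ), ENNReal.ofReal ((s + 1)⁻¹) ∂μ) ≠ ⊤)
    (hf : ∀ lam : ℝ, 0 < lam →
      f lam = a + b * lam + ∫ s in Set.Ioi (0 : ℝ), lam / (s + lam) ∂μ)
    (hG : S * G = opPow S (1 - γ) *
            (a • (1 : X →L[ℂ] X) + b • S +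
              ∫ lam in Set.Ioi (0 : ℝ),
                S * Ring.inverse ((lam : ℂ) • (1 : X →L[ℂ] X) + S) ∂μ))
    (t₁ t₂ : ℝ) (ht₁ : 0 ≤ t₁) (ht₂ : 0 ≤ t₂) :
    1 / (4 * (4 * K ^ 3)) * (‖Tsg.T (t₁ + t₂) ∘L opPow S (1 - γ)‖ / ‖Tsg.T t₂ ∘L S‖) *
                f ‖Tsg.T t₂ ∘L S‖ ≤ ‖Tsg.T t₁ ∘L G‖ := by
  simp only [← ContinuousLinearMap.mul_def]
  have hS' : IsResolvent A ((0 : ℝ) : ℂ) S := by simpa using hS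
  set T := Tsg.T t₂ with hT
  have hTS : T * S = S * T := (ci_sg_comm hgen ht₂ hS).symm
  have hTK : ‖T‖ ≤ K := hK t₂ ht₂
  have hRK : ∀ t, 0 < t → t * ‖Rp t‖ ≤ K := fun t ht => ci_sg_bound hgen hK ht (hRp t ht)
  have hone : ‖(1 : X →L[ℂ] X)‖ ≤ 1 := ContinuousLinearMap.norm_id_le
  set F : X →L[ℂ] X := a • (1 : X →L[ℂ] X) + b • S +
              ∫ lam in Set.Ioi (0 : ℝ),
                S * Ring.inverse ((lam : ℂ) • (1 : X →L[ℂ] X) + S) ∂μ with hF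
  rcases (norm_nonneg (T * S)).eq_or_lt with hr | hr
  · rw [← hr]; simp
  set r := ‖T * S‖ with hrdef
  rcases le_or_gt (f r) 0 with hφ | hφ
  · exact (mul_nonpos_of_nonneg_of_nonpos (by positivity) hφ).trans (norm_nonneg _)
  have hK0 : 0 ≤ K := by linarith
  -- resolvent identities
  have i1 : ∀ t, 0 < t → S - Rp t = t • (S * Rp t) := fun t ht => by
    simpa using ci_res_real hS' (hRp t ht)
  have i2 : ∀ t, 0 < t → S - Rp t = t • (Rp t * S) := fun t ht => by
    have := ci_res_real (hRp t ht) hS'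
    rw [zero_sub, neg_smul] at this
    rw [← neg_sub, this, neg_neg]
  let N : ℝ → X →L[ℂ] X := fun t => t⁻¹ • (1 - t⁻¹ • Rp t⁻¹)
  have hSN : ∀ t, 0 < t → S * N t = t⁻¹ • Rp t⁻¹ := by
    intro t ht
    have h := i1 t⁻¹ (inv_pos.2 ht)
    simp only [N, mul_smul_comm, mul_sub, mul_one]
    rw [← h, sub_sub_cancel]
  have hNS : ∀ t, 0 < t → N t * S = t⁻¹ • Rp t⁻¹ := by
    intro t ht
    have h := i2 t⁻¹ (inv_pos.2 ht)
    simp only [N, smul_mul_assoc, sub_mul, one_mul]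
    rw [← h, sub_sub_cancel]
  have htN : ∀ t, 0 < t → t • N t = 1 - t⁻¹ • Rp t⁻¹ := by
    intro t ht
    simp only [N]
    rw [smul_smul, mul_inv_cancel₀ ht.ne', one_smul]
  have hN : ∀ t, 0 < t → N t * (S + t • 1) = 1 := by
    intro t ht
    rw [mul_add, hNS t ht, mul_smul_comm, mul_one, htN t ht]; abel
  have hN' : ∀ t, 0 < t → (S + t • 1) * N t = 1 := by
    intro t ht
    rw [add_mul, hSN t ht, smul_mul_assoc, one_mul, htN t ht]; abel
  have hinv : ∀ t : ℝ, 0 < t → Ring.inverse ((t : ℂ) • (1 : X →L[ℂ] X) + S) = N t := by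
    intro t ht
    let U : (X →L[ℂ] X)ˣ := ⟨S + t • 1, N t, hN' t ht, hN t ht⟩
    have : (t : ℂ) • (1 : X →L[ℂ] X) + S = U := by
      rw [Complex.coe_smul, add_comm]
    rw [this, Ring.inverse_unit]; rfl
  have hL : ∀ t, 0 < t → (1 : X →L[ℂ] X) - t • (N t * 1) = S * N t := by
    intro t ht
    rw [mul_one, htN t ht, hSN t ht, sub_sub_cancel]
  have hSNK : ∀ t, 0 < t → ‖S * N t‖ ≤ K := by
    intro t ht
    rw [hSN t ht, norm_smul, Real.norm_of_nonneg (by positivity)]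
    exact hRK _ (inv_pos.2 ht)
  have hNK : ∀ t, 0 < t → t * ‖N t‖ ≤ 2 * K := by
    intro t ht
    have : t * ‖N t‖ = ‖t • N t‖ := by rw [norm_smul t (N t), Real.norm_of_nonneg ht.le]
    rw [this, htN t ht]
    refine (norm_sub_le _ _).trans ?_
    have := hSNK t ht
    rw [hSN t ht] at this
    linarith
  have hcN := ci_cont S 1 N hN hN'
  let E : ℝ → X →L[ℂ] X := fun t => if t = 0 then 1 else S * N t
  have hE0 : E 0 = 1 := if_pos rfl
  have hEt : ∀ t, 0 < t → E t = S * N t := fun t ht => if_neg ht.ne'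
  have hE : ∀ t, 0 ≤ t → (S + t • 1) * E t = S * 1 := by
    intro t ht
    rcases ht.eq_or_lt with rfl | ht
    · rw [hE0]; simp
    · have hcomm : (S + t • (1 : X →L[ℂ] X)) * S = S * (S + t • 1) := by
        rw [add_mul, mul_add, smul_mul_assoc, mul_smul_comm, one_mul, mul_one]
      rw [hEt t ht, ← mul_assoc, hcomm, mul_assoc, hN' t ht]
  have hE1 : ∀ t, 0 ≤ t → ‖E t‖ ≤ K := by
    intro t ht
    rcases ht.eq_or_lt with rfl | ht
    · rw [hE0]; linarith
    · rw [hEt t ht]; exact hSNK t ht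
  have hE2 : ∀ (V : X →L[ℂ] X) t, 0 ≤ t → t * ‖V * E t‖ ≤ 2 * K * ‖V * S‖ := by
    intro V t ht
    rcases ht.eq_or_lt with rfl | ht
    · rw [zero_mul]; positivity
    · rw [hEt t ht, ← mul_assoc]
      calc t * ‖V * S * N t‖ ≤ t * (‖V * S‖ * ‖N t‖) := by gcongr; exact norm_mul_le _ _
        _ = t * ‖N t‖ * ‖V * S‖ := by ring
        _ ≤ 2 * K * ‖V * S‖ := mul_le_mul_of_nonneg_right (hNK t ht) (by positivity)
  have hKK : K ≤ K ^ 2 := by nlinarith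
  have hKKK : K ^ 2 ≤ K ^ 3 := by nlinarith [mul_nonneg hK0 hK0]
  have hK3 : 2 * K ≤ 4 * K ^ 3 := by linarith
  -- integrals
  have hμ' : MeasureTheory.IntegrableOn (fun s : ℝ => (s + 1)⁻¹) (Set.Ioi 0) μ := by
    refine (MeasureTheory.lintegral_ofReal_ne_top_iff_integrable ?_ ?_).1 hμ
    · exact (by fun_prop : Measurable (fun s : ℝ => (s + 1)⁻¹)).aestronglyMeasurable
    · filter_upwards [MeasureTheory.ae_restrict_mem measurableSet_Ioi] with s hs
      have hs : 0 < s := hs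
      simp only [Pi.zero_apply]
      positivity
  have hintL : MeasureTheory.IntegrableOn (fun t : ℝ => (1 : X →L[ℂ] X) - t • (N t * 1))
      (Set.Ioi 0) μ := by
    refine MeasureTheory.Integrable.mono' (hμ'.const_mul (2 * K * ‖S‖ + K)) ?_ ?_
    · refine ContinuousOn.aestronglyMeasurable ?_ measurableSet_Ioi
      exact continuousOn_const.sub (continuousOn_id.smul (hcN.mul continuousOn_const))
    · filter_upwards [MeasureTheory.ae_restrict_mem measurableSet_Ioi] with t ht
      have ht : 0 < t := ht
      rw [hL t ht, ← div_eq_mul_inv, le_div_iff₀ (by positivity)]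
      have h1 := hSNK t ht
      have h2 : t * ‖S * N t‖ ≤ 2 * K * ‖S‖ := by
        calc t * ‖S * N t‖ ≤ t * (‖S‖ * ‖N t‖) := by gcongr; exact norm_mul_le _ _
          _ = t * ‖N t‖ * ‖S‖ := by ring
          _ ≤ 2 * K * ‖S‖ := mul_le_mul_of_nonneg_right (hNK t ht) (by positivity)
      linarith
  have hints := ci_scalar_integrable hr μ hμ'
  have hFeq : F = a • (1 : X →L[ℂ] X) + b • S + ∫ t in Set.Ioi (0 : ℝ),
      ((1 : X →L[ℂ] X) - t • (N t * 1)) ∂μ := by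
    rw [hF]
    congr 1
    refine MeasureTheory.setIntegral_congr_fun measurableSet_Ioi fun t ht => ?_
    simp only [hL t ht, hinv t ht]
  have hmem : (F, f r) ∈ closure (ciCone ((1 : X →L[ℂ] X), (1 : ℝ))
      (fun t => ((1 : X →L[ℂ] X) - t • (N t * 1), r / (t + r)))) := by
    have hv : (S, r) ∈ closure (ciCone ((1 : X →L[ℂ] X), (1 : ℝ))
      (fun t => ((1 : X →L[ℂ] X) - t • (N t * 1), r / (t + r)))) := by
      have hl1 : Tendsto (fun t : ℝ => t • ((1 : X →L[ℂ] X) - t • (N t * 1))) atTop (nhds S) := by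
        rw [tendsto_iff_norm_sub_tendsto_zero]
        have hz : Tendsto (fun t : ℝ => 2 * K * ‖S‖ * ‖S‖ * t⁻¹) atTop (nhds 0) := by
          simpa using tendsto_inv_atTop_zero.const_mul (2 * K * ‖S‖ * ‖S‖)
        refine squeeze_zero' (Filter.Eventually.of_forall fun _ => norm_nonneg _) ?_ hz
        filter_upwards [eventually_gt_atTop 0] with t ht
        have e : t • ((1 : X →L[ℂ] X) - t • (N t * 1)) - S = -(S * N t * S) := by
          rw [hL t ht, ← mul_smul_comm]
          have : t • N t = 1 - N t * S := by
            rw [hNS t ht, htN t ht]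
          rw [this, mul_sub, mul_one, ← mul_assoc]; abel
        rw [e, norm_neg, ← div_eq_mul_inv, le_div_iff₀ ht]
        calc ‖S * N t * S‖ * t ≤ (‖S‖ * ‖N t‖ * ‖S‖) * t := by
              gcongr
              exact (norm_mul_le _ _).trans (by gcongr; exact norm_mul_le _ _)
          _ = t * ‖N t‖ * (‖S‖ * ‖S‖) := by ring
          _ ≤ 2 * K * (‖S‖ * ‖S‖) := mul_le_mul_of_nonneg_right (hNK t ht) (by positivity)
          _ = _ := by ring
      have hl2 : Tendsto (fun t : ℝ => t • (r / (t + r))) atTop (nhds r) := by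
        have h1 : Tendsto (fun t : ℝ => r - r * r * (t + r)⁻¹) atTop (nhds (r - r * r * 0)) :=
          ((tendsto_inv_atTop_zero.comp
            (tendsto_atTop_add_const_right _ r tendsto_id)).const_mul (r * r)).const_sub r
        rw [mul_zero, sub_zero] at h1
        refine h1.congr' ?_
        filter_upwards [eventually_gt_atTop 0] with t ht
        rw [smul_eq_mul]
        field_simp
        ring
      refine mem_closure_of_tendsto (hl1.prodMk_nhds hl2) ?_
      filter_upwards [eventually_gt_atTop 0] with t ht
      exact ⟨Unit, inferInstance, 0, fun _ => t, fun _ => t, le_rfl, by simp [ht.le], by simp [ht],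
        by simp⟩
    have := ciCone_integral _ _ _ hv μ ha hb (hintL.prodMk hints)
    rw [integral_pair hintL hints] at this
    convert this using 1
    rw [hFeq, hf r hr]
    simp
  have hTE : ∀ t, 0 ≤ t → ‖T * E t‖ ≤ 4 * K ^ 3 := by
    intro t ht
    calc ‖T * E t‖ ≤ ‖T‖ * ‖E t‖ := norm_mul_le _ _
      _ ≤ K * K := by gcongr; exact hE1 t ht
      _ ≤ 4 * K ^ 3 := by nlinarith
  have happ := ci_approx S 1 T N E (by rw [mul_one, one_mul]) hN hE (4 * K ^ 3) (by linarith)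
    (fun t ht => (hE1 t ht).trans (by linarith))
    (fun t ht => by
      have := hE2 1 t ht
      simp only [one_mul] at this
      exact this.trans (by gcongr)) hTE
    (fun t ht => (hE2 T t ht).trans (by gcongr)) hr F (f r) hφ hmem
  refine ci_final (C := 4 * K ^ 3) (by positivity) rfl hr hφ ?_
  have hadd : Tsg.T (t₁ + t₂) = Tsg.T t₁ * T := Tsg.map_add t₁ t₂ ht₁ ht₂
  rw [hadd]
  set O := opPow S (1 - γ) with hO
  have hTO : T * O = O * T := ci_opPow_comm T S hTS _
  have hSO : S * O = O * S := ci_opPow_comm S S rfl _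
  have hFcomm : ∀ V : X →L[ℂ] X, V * S = S * V → (∀ t, 0 < t → V * Rp t = Rp t * V) →
      V * F = F * V := by
    intro V hVS hVR
    have := ci_integral_comm V (fun lam : ℝ => (S * Ring.inverse ((lam : ℂ) • (1 : X →L[ℂ] X) + S)))
      (μ.restrict (Set.Ioi 0)) (by
        filter_upwards [MeasureTheory.ae_restrict_mem measurableSet_Ioi] with t ht
        rw [hinv t ht, hSN t ht, mul_smul_comm, smul_mul_assoc, hVR _ (inv_pos.2 ht)])
    rw [hF, mul_add, add_mul, this, mul_add, add_mul, mul_smul_comm, smul_mul_assoc, mul_smul_comm,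
      smul_mul_assoc, mul_one, one_mul, hVS]
  have hTF : T * F = F * T :=
    hFcomm T hTS fun t ht => (ci_sg_comm hgen ht₂ (hRp t ht)).symm
  have hSF : S * F = F * S := by
    refine hFcomm S rfl fun t ht => ?_
    have := (i1 t ht).symm.trans (i2 t ht)
    exact smul_right_injective _ ht.ne' this
  have hSinj : ∀ x, S x = 0 → x = 0 := by
    intro x hx
    have h := hS.eq_apply x
    have h0 : A ⟨S x, hS.mem_domain x⟩ = 0 := by
      have : (⟨S x, hS.mem_domain x⟩ : A.domain) = 0 := Subtype.ext hx
      rw [this, LinearPMap.map_zero]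
    rw [h0] at h
    simpa using h.symm
  have hGS : G * S = O * F := by
    have h1 : S * (G * S) = S * (O * F) := by
      rw [← mul_assoc, hG, mul_assoc, ← hSF, ← mul_assoc, ← hSO, mul_assoc]
    ext x
    have h2 : S ((G * S) x - (O * F) x) = 0 := by
      rw [map_sub, sub_eq_zero]
      exact congrArg (fun V : X →L[ℂ] X => V x) h1
    exact sub_eq_zero.1 (hSinj _ h2)
  set W := Tsg.T t₁ * T * O with hW
  set M := ‖Tsg.T t₁ * G‖ * (4 * (4 * K ^ 3) * r / f r) with hM
  have hM0 : 0 ≤ M := by positivity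
  have hSE : ∀ t, 0 ≤ t → S * E t = E t * S := by
    intro t ht
    rcases ht.eq_or_lt with rfl | ht
    · rw [hE0, mul_one, one_mul]
    · rw [hEt t ht, mul_assoc S (N t) S, hNS t ht, hSN t ht]
  have key : ∀ y, ‖W (S y)‖ ≤ M * ‖S y‖ := by
    intro y
    refine le_of_forall_pos_le_add fun ε hε => ?_
    obtain ⟨H, h1, h2, h3⟩ := happ (ε / ((‖W‖ + 1) * (‖y‖ + 1))) (by positivity)
    have hSH : S * H = H * S := h3 S rfl hSE
    have e1 : Tsg.T t₁ * G * (T * H) * S = W * (F * H) := by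
      calc Tsg.T t₁ * G * (T * H) * S = Tsg.T t₁ * G * (T * (H * S)) := by simp only [mul_assoc]
        _ = Tsg.T t₁ * G * ((T * S) * H) := by rw [← hSH]; simp only [mul_assoc]
        _ = Tsg.T t₁ * (G * S) * T * H := by rw [hTS]; simp only [mul_assoc]
        _ = Tsg.T t₁ * O * (F * T) * H := by rw [hGS]; simp only [mul_assoc]
        _ = Tsg.T t₁ * (O * T) * F * H := by rw [← hTF]; simp only [mul_assoc]
        _ = W * (F * H) := by rw [← hTO, hW]; simp only [mul_assoc]
    have e2 : W (S y) = (Tsg.T t₁ * G * (T * H)) (S y) - (W * (F * H - S)) y := by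
      have : (Tsg.T t₁ * G * (T * H)) (S y) = (W * (F * H)) y := by rw [← e1]; rfl
      rw [this, mul_sub W, ContinuousLinearMap.sub_apply, sub_sub_cancel]; rfl
    rw [e2]
    refine (norm_sub_le _ _).trans (add_le_add ?_ ?_)
    · refine (ContinuousLinearMap.le_opNorm _ _).trans ?_
      refine mul_le_mul_of_nonneg_right ?_ (norm_nonneg _)
      exact (norm_mul_le _ _).trans (mul_le_mul_of_nonneg_left h2 (norm_nonneg _))
    · calc ‖(W * (F * H - S)) y‖ ≤ ‖W * (F * H - S)‖ * ‖y‖ := ContinuousLinearMap.le_opNorm _ _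
        _ ≤ (‖W‖ * ‖F * H - S‖) * ‖y‖ :=
            mul_le_mul_of_nonneg_right (norm_mul_le _ _) (norm_nonneg _)
        _ ≤ ((‖W‖ + 1) * (ε / ((‖W‖ + 1) * (‖y‖ + 1)))) * (‖y‖ + 1) := by
            refine mul_le_mul (mul_le_mul ?_ h1 (norm_nonneg _) ?_) ?_ (norm_nonneg _) ?_
            · linarith
            · positivity
            · linarith
            · positivity
        _ = ε := by field_simp
  refine ContinuousLinearMap.opNorm_le_bound _ hM0 fun x => ?_
  exact closure_minimal (t := {x | ‖W x‖ ≤ M * ‖x‖}) (by rintro _ ⟨y, rfl⟩; exact key y)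
    (isClosed_le W.continuous.norm (continuous_const.mul continuous_norm)) (ci_dense hgen hS x)

end


/-- converse interpolation inequalities.  Let `−A` generate a bounded
`C₀`-semigroup on a complex Banach space `X`, write `B(A) = A(I+A)⁻¹ = 1 - J` with
`J = (1+A)⁻¹`, and assume `T(t)A ≠ 0` for each `t > 0`.  Then there is `c > 0`, depending
only on the semigroup, such that:
(a) if `A` is invertible (with inverse `Ainv`), `f` is a complete Bernstein function with
Stieltjes representation `(a,b,μ)`, `γ ≤ 1`, and `G = A^γ f(A⁻¹)` is a bounded operator
(characterised by `A⁻¹ G = (A⁻¹)^{1-γ} f(A⁻¹)`, where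
`f(A⁻¹) = a + b A⁻¹ + ∫ A⁻¹(λ+A⁻¹)⁻¹ dμ(λ)`), then
`‖T(t₁)G‖ ≥ c (‖T(t₁+t₂)A^{γ-1}‖/‖T(t₂)A⁻¹‖) f(‖T(t₂)A⁻¹‖)` for all `t₁,t₂ ≥ 0`
(note `A^{γ-1} = (A⁻¹)^{1-γ}`);
(b) if `f` is a bounded complete Bernstein function (so `b = 0`, `μ` finite, and
`f(A) = a + ∫ A(λ+A)⁻¹ dμ(λ)` with `A(λ+A)⁻¹ = 1 - λ(λ+A)⁻¹`) and `γ > 0`, then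
`‖T(t₁)B(A)^γ f(A)‖ ≥ c (‖T(t₁+t₂)B(A)^{γ+1}‖/‖T(t₂)B(A)‖) f(‖T(t₂)B(A)‖)`
for all `t₁,t₂ ≥ 0`. -/
theorem converse_interpolation_inequalities
    {X : Type*} [NormedAddCommGroup X] [NormedSpace ℂ X] [CompleteSpace X]
    (Tsg : C0Semigroup X) (hbdd : Tsg.Bounded)
    (A : X →ₗ.[ℂ] X) (hgen : IsGenerator Tsg A)
    (hTA : ∀ t : ℝ, 0 < t → ∃ x : A.domain, Tsg.T t (A x) ≠ 0)
    (J : X →L[ℂ] X) (hJ : IsResolvent A 1 J)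
    (Rp : ℝ → X →L[ℂ] X)
    (hRp : ∀ lam : ℝ, 0 < lam → IsResolvent A (lam : ℂ) (Rp lam)) :
    ∃ c > (0 : ℝ),
      (∀ (Ainv : X →L[ℂ] X), IsResolvent A 0 Ainv →
        ∀ (a b : ℝ) (μ : MeasureTheory.Measure ℝ) (f : ℝ → ℝ) (γ : ℝ) (G : X →L[ℂ] X),
          0 ≤ a → 0 ≤ b →
          (∫⁻ s in Set.Ioi (0 : ℝ), ENNReal.ofReal ((s + 1)⁻¹) ∂μ) ≠ ⊤ →
          (∀ lam : ℝ, 0 < lam →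
            f lam = a + b * lam + ∫ s in Set.Ioi (0 : ℝ), lam / (s + lam) ∂μ) →
          γ ≤ 1 →
          Ainv * G = opPow Ainv (1 - γ) *
            (a • (1 : X →L[ℂ] X) + b • Ainv +
              ∫ lam in Set.Ioi (0 : ℝ),
                Ainv * Ring.inverse ((lam : ℂ) • (1 : X →L[ℂ] X) + Ainv) ∂μ) →
          ∀ t₁ t₂ : ℝ, 0 ≤ t₁ → 0 ≤ t₂ →
            c * (‖Tsg.T (t₁ + t₂) ∘L opPow Ainv (1 - γ)‖ / ‖Tsg.T t₂ ∘L Ainv‖) *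
                f ‖Tsg.T t₂ ∘L Ainv‖ ≤ ‖Tsg.T t₁ ∘L G‖) ∧
      (∀ (a : ℝ) (μ : MeasureTheory.Measure ℝ) (f : ℝ → ℝ) (γ : ℝ),
          0 ≤ a → MeasureTheory.IsFiniteMeasure μ →
          (∀ lam : ℝ, 0 < lam →
            f lam = a + ∫ s in Set.Ioi (0 : ℝ), lam / (s + lam) ∂μ) →
          0 < γ →
          ∀ t₁ t₂ : ℝ, 0 ≤ t₁ → 0 ≤ t₂ →
            c * (‖Tsg.T (t₁ + t₂) ∘L opPow ((1 : X →L[ℂ] X) - J) (γ + 1)‖ /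
                  ‖Tsg.T t₂ ∘L ((1 : X →L[ℂ] X) - J)‖) *
                f ‖Tsg.T t₂ ∘L ((1 : X →L[ℂ] X) - J)‖ ≤
              ‖Tsg.T t₁ ∘L (opPow ((1 : X →L[ℂ] X) - J) γ *
                (a • (1 : X →L[ℂ] X) +
                  ∫ lam in Set.Ioi (0 : ℝ),
                    ((1 : X →L[ℂ] X) - (lam : ℂ) • Rp lam) ∂μ))‖) := by
  obtain ⟨K₀, hK₀⟩ := hbdd
  have hK : ∀ t, 0 ≤ t → ‖Tsg.T t‖ ≤ max K₀ 1 := fun t ht => (hK₀ t ht).trans (le_max_left _ _)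
  have hK1 : 1 ≤ max K₀ 1 := le_max_right _ _
  refine ⟨1 / (4 * (4 * max K₀ 1 ^ 3)), by positivity, ?_, ?_⟩
  · intro Ainv hA a b μ f γ G ha hb hμ hf hγ hG t₁ t₂ h1 h2
    exact ci_part_a Tsg A hgen Rp hRp _ hK1 hK Ainv hA a b μ f γ G ha hb hμ hf hG t₁ t₂ h1 h2
  · intro a μ f γ ha hμ hf hγ t₁ t₂ h1 h2
    exact ci_part_b Tsg A hgen J hJ Rp hRp _ hK1 hK a μ f γ ha hμ hf hγ t₁ t₂ h1 h2
end

section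
/- Let Y be a complex Banach space and let f : {z ∈ ℂ : Re z ≥ 0} \ {0} → Y be continuous, holomorphic on ℂ₊ = {z : Re z > 0}, and bounded on iℝ \ {0}. If there exists C > 0 such that ‖f(z)‖ ≤ C / Re z for all z ∈ ℂ₊, then f is bounded on {z ∈ ℂ : Re z ≥ 0} \ {0}. -/
open Complex

lemma pl_norm_factor (z : ℂ) : ‖z ^ 2 + (‖z‖ : ℂ) ^ 2‖ = ‖z‖ * (2 * |z.re|) := by
  have h : z ^ 2 + (‖z‖ : ℂ) ^ 2 = z * ((2 * z.re : ℝ) : ℂ) := by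
    rw [← Complex.mul_conj', ← Complex.add_conj]; ring
  rw [h, norm_mul, Complex.norm_real, Real.norm_eq_abs, abs_mul]
  simp

lemma pl_den (z : ℂ) (e : ℝ) (he : 0 < e) (hz : 0 ≤ z.re) :
    ‖z‖ ≤ ‖z + e‖ ∧ e ≤ ‖z + e‖ := by
  constructor
  · rw [← sq_le_sq₀ (norm_nonneg _) (norm_nonneg _), Complex.sq_norm, Complex.sq_norm,
      Complex.normSq_apply, Complex.normSq_apply]
    simp
    nlinarith [mul_nonneg he.le hz, sq_nonneg e]
  · calc e ≤ (z + e).re := by simpa using hz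
      _ ≤ _ := Complex.re_le_norm _

lemma pl_aux
    {Y : Type*} [NormedAddCommGroup Y] [NormedSpace ℂ Y]
    (f : ℂ → Y)
    (hcont : ContinuousOn f {z : ℂ | 0 ≤ z.re ∧ z ≠ 0})
    (hholo : DifferentiableOn ℂ f {z : ℂ | 0 < z.re})
    (K : ℝ) (hK : 0 ≤ K) (hbdry : ∀ s : ℝ, s ≠ 0 → ‖f (Complex.I * (s : ℂ))‖ ≤ K)
    (C : ℝ) (hC : 0 < C)
    (hest : ∀ z : ℂ, 0 < z.re → ‖f z‖ ≤ C / z.re)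
    (r e : ℝ) (hr : 0 < r) (hr1 : r < 1) (he : 0 < e) (z : ℂ) (hz : 0 < z.re)
    (hz1 : r < ‖z‖) (hz2 : r * ‖z‖ < 1) :
    ‖((z ^ 2 + (r : ℂ) ^ 2) * (1 + (r : ℂ) ^ 2 * z ^ 2) / (z + e) ^ 2) • f z‖
      ≤ K + 4 * C * r + 4 * C * r / e ^ 2 := by
  set U : Set ℂ := {z | 0 < z.re ∧ r < ‖z‖ ∧ r * ‖z‖ < 1} with hU
  set V : Set ℂ := {z | 0 ≤ z.re ∧ r ≤ ‖z‖ ∧ r * ‖z‖ ≤ 1} with hV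
  have hUo : IsOpen U := by
    have c1 : IsOpen {z : ℂ | 0 < z.re} := isOpen_lt continuous_const Complex.continuous_re
    have c2 : IsOpen {z : ℂ | r < ‖z‖} := isOpen_lt continuous_const continuous_norm
    have c3 : IsOpen {z : ℂ | r * ‖z‖ < 1} := isOpen_lt (by fun_prop) continuous_const
    exact c1.inter (c2.inter c3)
  have hVc : IsClosed V := by
    have c1 : IsClosed {z : ℂ | 0 ≤ z.re} := isClosed_le continuous_const Complex.continuous_re
    have c2 : IsClosed {z : ℂ | r ≤ ‖z‖} := isClosed_le continuous_const continuous_norm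
    have c3 : IsClosed {z : ℂ | r * ‖z‖ ≤ 1} := isClosed_le (by fun_prop) continuous_const
    exact c1.inter (c2.inter c3)
  have hUV : closure U ⊆ V :=
    closure_minimal (fun w hw => ⟨hw.1.le, hw.2.1.le, hw.2.2.le⟩) hVc
  have hUb : Bornology.IsBounded U := by
    refine (Metric.isBounded_closedBall (x := (0 : ℂ)) (r := 1 / r)).subset fun w hw => ?_
    rw [mem_closedBall_zero_iff, le_div_iff₀ hr, mul_comm]
    exact hw.2.2.le
  have hden : ∀ w : ℂ, 0 ≤ w.re → (w + e) ^ 2 ≠ 0 := fun w hw => by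
    have := (pl_den w e he hw).2
    exact pow_ne_zero _ (norm_pos_iff.1 (he.trans_le this))
  refine Complex.norm_le_of_forall_mem_frontier_norm_le
    (f := fun z => ((z ^ 2 + (r : ℂ) ^ 2) * (1 + (r : ℂ) ^ 2 * z ^ 2) / (z + e) ^ 2) • f z)
    hUb ⟨?_, ?_⟩ ?_ (subset_closure (⟨hz, hz1, hz2⟩ : z ∈ U))
  · refine DifferentiableOn.smul ?_ (hholo.mono fun w hw => hw.1)
    exact DifferentiableOn.div (by fun_prop) (by fun_prop) fun w hw => hden w hw.1.le
  · refine ContinuousOn.mono ?_ hUV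
    refine ContinuousOn.smul ?_ (hcont.mono fun w hw => ⟨hw.1, ?_⟩)
    · exact ContinuousOn.div (by fun_prop) (by fun_prop) fun w hw => hden w hw.1
    · exact norm_pos_iff.1 (hr.trans_le hw.2.1)
  · intro w hw
    have hwV := hUV hw.1
    have hwU : w ∉ U := by
      have := hw.2
      rwa [hUo.interior_eq] at this
    obtain ⟨h0, h1, h2⟩ := hwV
    obtain ⟨d1, d2⟩ := pl_den w e he h0
    have hwpos : 0 < ‖w‖ := hr.trans_le h1
    have hdpos : 0 < ‖w + e‖ := he.trans_le d2
    have p1 : 0 ≤ 4 * C * r := by positivity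
    have p2 : 0 ≤ 4 * C * r / e ^ 2 := by positivity
    rw [norm_smul, norm_div, norm_mul, norm_pow (w + e)]
    have hd1 : ‖w‖ ^ 2 ≤ ‖w + e‖ ^ 2 := by gcongr
    have hd2 : e ^ 2 ≤ ‖w + e‖ ^ 2 := by gcongr
    rcases h0.eq_or_lt with h0 | h0
    · have hwI : w = I * (w.im : ℂ) := by
        apply Complex.ext <;> simp [← h0]
      have hw2 : w ^ 2 = ((-(‖w‖ ^ 2) : ℝ) : ℂ) := by
        have : ‖w‖ ^ 2 = w.im ^ 2 := by
          rw [Complex.sq_norm, Complex.normSq_apply, ← h0]; ring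
        rw [this]
        conv_lhs => rw [hwI]
        rw [mul_pow, I_sq]; push_cast; ring
      have hf : ‖f w‖ ≤ K := by
        rw [hwI]; apply hbdry
        intro h; rw [h] at hwI; simp [hwI] at hwpos
      have a1 : ‖w ^ 2 + (r : ℂ) ^ 2‖ ≤ ‖w‖ ^ 2 := by
        rw [hw2]; norm_cast
        rw [Real.norm_eq_abs, abs_le]; constructor <;> nlinarith
      have a2 : ‖1 + (r : ℂ) ^ 2 * w ^ 2‖ ≤ 1 := by
        rw [hw2]; norm_cast
        have : (r * ‖w‖) ^ 2 ≤ 1 := pow_le_one₀ (by positivity) h2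
        rw [Real.norm_eq_abs, abs_le]; constructor <;> nlinarith [sq_nonneg (r * ‖w‖)]
      have : ‖w ^ 2 + (r : ℂ) ^ 2‖ * ‖1 + (r : ℂ) ^ 2 * w ^ 2‖ / ‖w + e‖ ^ 2 ≤ 1 := by
        rw [div_le_one (by positivity)]
        calc _ ≤ ‖w‖ ^ 2 * 1 := by gcongr
          _ ≤ _ := by linarith
      calc _ ≤ 1 * K := by gcongr
        _ ≤ _ := by linarith
    · have hf := hest w h0
      have key : ‖w‖ = r ∨ r * ‖w‖ = 1 := by
        by_contra! hcon
        exact hwU ⟨h0, lt_of_le_of_ne h1 hcon.1.symm, lt_of_le_of_ne h2 hcon.2⟩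
      rcases key with hk | hk
      · have a1 : ‖w ^ 2 + (r : ℂ) ^ 2‖ = r * (2 * w.re) := by
          have := pl_norm_factor w
          rwa [hk, abs_of_pos h0] at this
        have a2 : ‖1 + (r : ℂ) ^ 2 * w ^ 2‖ ≤ 2 := by
          calc _ ≤ ‖(1 : ℂ)‖ + ‖(r : ℂ) ^ 2 * w ^ 2‖ := norm_add_le _ _
            _ = 1 + (r * ‖w‖) ^ 2 := by simp [mul_pow]
            _ ≤ 1 + 1 := by gcongr; exact pow_le_one₀ (by positivity) h2
            _ = 2 := by norm_num
        calc _ ≤ (r * (2 * w.re)) * 2 / e ^ 2 * (C / w.re) := by rw [a1]; gcongr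
          _ = 4 * C * r / e ^ 2 := by field_simp; ring
          _ ≤ _ := by linarith
      · have a1 : ‖w ^ 2 + (r : ℂ) ^ 2‖ ≤ 2 * ‖w‖ ^ 2 := by
          calc _ ≤ ‖w ^ 2‖ + ‖(r : ℂ) ^ 2‖ := norm_add_le _ _
            _ = ‖w‖ ^ 2 + r ^ 2 := by simp
            _ ≤ ‖w‖ ^ 2 + ‖w‖ ^ 2 := by gcongr
            _ = _ := by ring
        have a2 : ‖1 + (r : ℂ) ^ 2 * w ^ 2‖ = r * (2 * w.re) := by
          have hkc : (r : ℂ) * (‖w‖ : ℂ) = 1 := by exact_mod_cast hk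
          have h : 1 + (r : ℂ) ^ 2 * w ^ 2 = (r : ℂ) ^ 2 * (w ^ 2 + (‖w‖ : ℂ) ^ 2) := by
            rw [mul_add, ← mul_pow (r : ℂ) (‖w‖ : ℂ), hkc]; ring
          rw [h, norm_mul, pl_norm_factor, abs_of_pos h0]
          simp only [norm_pow, Complex.norm_real, Real.norm_eq_abs, abs_of_pos hr]
          linear_combination (r * 2 * w.re) * hk
        calc _ ≤ (2 * ‖w‖ ^ 2) * (r * (2 * w.re)) / ‖w‖ ^ 2 * (C / w.re) := by
              rw [a2]; gcongr
          _ = 4 * C * r := by field_simp; ring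
          _ ≤ _ := by linarith

/-- a Phragmén–Lindelöf lemma.  Let `Y` be a complex Banach space and
`f : ℂ → Y` be continuous on `{Re z ≥ 0} \ {0}`, holomorphic on `ℂ₊ = {Re z > 0}`, and
bounded on `iℝ \ {0}`.  If `‖f z‖ ≤ C / Re z` on `ℂ₊` for some `C > 0`, then `f` is
bounded on `{Re z ≥ 0} \ {0}`. -/
theorem phragmen_lindelof_halfplane
    {Y : Type*} [NormedAddCommGroup Y] [NormedSpace ℂ Y] [CompleteSpace Y]
    (f : ℂ → Y)
    (hcont : ContinuousOn f {z : ℂ | 0 ≤ z.re ∧ z ≠ 0})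
    (hholo : DifferentiableOn ℂ f {z : ℂ | 0 < z.re})
    (hbdry : ∃ K : ℝ, ∀ s : ℝ, s ≠ 0 → ‖f (Complex.I * (s : ℂ))‖ ≤ K)
    (C : ℝ) (hC : 0 < C)
    (hest : ∀ z : ℂ, 0 < z.re → ‖f z‖ ≤ C / z.re) :
    ∃ M : ℝ, ∀ z : ℂ, 0 ≤ z.re → z ≠ 0 → ‖f z‖ ≤ M := by
  obtain ⟨K, hKb⟩ := hbdry
  have hK : 0 ≤ K := (norm_nonneg _).trans (hKb 1 one_ne_zero)
  refine ⟨K, fun z hz hz0 => ?_⟩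
  rcases hz.eq_or_lt with h0 | h0
  · have hwI : z = I * (z.im : ℂ) := by
      apply Complex.ext <;> simp [← h0]
    rw [hwI]; apply hKb
    intro h; rw [h] at hwI; simp [hwI] at hz0
  have hzpos : 0 < ‖z‖ := norm_pos_iff.2 hz0
  have L : Filter.Tendsto (fun e : ℝ => ‖((z ^ 2 + ((e ^ 3 : ℝ) : ℂ) ^ 2) *
      (1 + ((e ^ 3 : ℝ) : ℂ) ^ 2 * z ^ 2) / (z + e) ^ 2) • f z‖) (nhdsWithin 0 (Set.Ioi 0))
      (nhds ‖f z‖) := by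
    have hc : ContinuousAt (fun e : ℝ => ‖((z ^ 2 + ((e ^ 3 : ℝ) : ℂ) ^ 2) *
      (1 + ((e ^ 3 : ℝ) : ℂ) ^ 2 * z ^ 2) / (z + e) ^ 2) • f z‖) 0 := by
      refine (ContinuousAt.smul (ContinuousAt.div ?_ ?_ ?_) continuousAt_const).norm
      · fun_prop
      · fun_prop
      · simpa using hz0
    have := hc.tendsto
    simp only [ofReal_zero, ne_eq, OfNat.ofNat_ne_zero, not_false_eq_true, zero_pow, add_zero,
      zero_mul, mul_one, div_self (pow_ne_zero 2 hz0), one_smul] at this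
    exact this.mono_left nhdsWithin_le_nhds
  have R : Filter.Tendsto (fun e : ℝ => K + 4 * C * e ^ 3 + 4 * C * e)
      (nhdsWithin 0 (Set.Ioi 0)) (nhds K) :=
    (Continuous.tendsto' (by fun_prop) 0 K (by simp)).mono_left nhdsWithin_le_nhds
  refine le_of_tendsto_of_tendsto L R ?_
  have t1 : Filter.Tendsto (fun e : ℝ => e ^ 3) (nhdsWithin 0 (Set.Ioi 0)) (nhds 0) :=
    (Continuous.tendsto' (by fun_prop) 0 0 (by simp)).mono_left nhdsWithin_le_nhds
  have t2 : Filter.Tendsto (fun e : ℝ => e ^ 3 * ‖z‖) (nhdsWithin 0 (Set.Ioi 0)) (nhds 0) :=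
    (Continuous.tendsto' (by fun_prop) 0 0 (by simp)).mono_left nhdsWithin_le_nhds
  filter_upwards [self_mem_nhdsWithin, t1.eventually_lt_const one_pos,
    t1.eventually_lt_const hzpos, t2.eventually_lt_const one_pos] with e he e1 e2 e3
  have he : 0 < e := he
  have := pl_aux f hcont hholo K hK hKb C hC hest (e ^ 3) e (by positivity) e1 he z h0 e2 e3
  refine this.trans (le_of_eq ?_)
  field_simp
end
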